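/- arXiv:1303.6093 — 5 statements merged into one kernel-verified Lean document; each statement's English description precedes it below -/
import Mathlib

section
/- Let θ₁, θ₂ be real numbers such that 1, θ₁, θ₂ are linearly independent over ℤ, let L(x) = x₀ + x₁θ₁ + x₂θ₂ for x = (x₀,x₁,x₂) ∈ ℤ³, and let P be a linear form on ℝ³ that is linearly independent of L. Suppose α > 0 and C > 0 are such that for every real t ≥ 1 one has min{|L(x)| : x ∈ ℤ³, 0 < |x| ≤ t} ≤ C·t^{−α} (i.e. α is admissible for the uniform exponent ω̂ of L). Then for every real r < α² − α + 1 there exist infinitely many x ∈ ℤ³ such that |L(x)| ≤ |P(x)|·|x|^{−r}. (Consequently the exponent ω_{LP} = sup{γ : there exist infinitely many x ∈ ℤ³ with |L(x)| ≤ |P(x)|·|x|^{−γ}} satisfies ω_{LP} ≥ ω̂² − ω̂ + 1.) -/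
/-- Euclidean norm of an integer vector in `ℤ³`. -/
noncomputable def enormZ (v : Fin 3 → ℤ) : ℝ :=
  Real.sqrt ((v 0 : ℝ) ^ 2 + (v 1 : ℝ) ^ 2 + (v 2 : ℝ) ^ 2)

/-- The real vector associated to an integer vector. -/
def toR (v : Fin 3 → ℤ) : Fin 3 → ℝ := fun i => (v i : ℝ)

/-- The linear form `L(x) = x₀ + x₁ θ₁ + x₂ θ₂` on `ℝ³`. -/
noncomputable def Lform (θ₁ θ₂ : ℝ) : (Fin 3 → ℝ) →ₗ[ℝ] ℝ :=
  LinearMap.proj 0 + θ₁ • LinearMap.proj 1 + θ₂ • LinearMap.proj 2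


/-- The numerical data attached to the sequence of minimal points `z n` of a linear form `L`, under
the assumption that a second form `P` satisfies `|P| ≤ |L| |z| ^ r` along the sequence:
`X n`, `l n`, `p n` are the norm of `z n` and the absolute values of `L` and `P` at `z n`,
`I n` says that `z n, z (n + 1), z (n + 2)` are independent, while `R n` and `W n` depend only on
the plane spanned by `z n` and `z (n + 1)`. -/
structure MinimalSystem (α r C K : ℝ) (X l p R W : ℕ → ℝ) (I : ℕ → Prop) : Prop where
  two_le : 2 ≤ α
  one_le_r : 1 ≤ r
  r_lt : r < α ^ 2 - α + 1
  C_pos : 0 < C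
  K_pos : 0 < K
  one_le_X : ∀ n, 1 ≤ X n
  X_mono : Monotone X
  X_tendsto : Filter.Tendsto X Filter.atTop Filter.atTop
  l_pos : ∀ n, 0 < l n
  l_anti : Antitone l
  p_nonneg : ∀ n, 0 ≤ p n
  l_le : ∀ n, l n ≤ C * X (n + 1) ^ (-α)
  p_le : ∀ n, p n ≤ l n * X n ^ r
  p_le_X : ∀ n, p n ≤ K * X n
  one_le_det : ∀ n, I n → 1 ≤ K *
    (l n * p (n + 1) * X (n + 2) + l n * p (n + 2) * X (n + 1) + l (n + 1) * p n * X (n + 2) +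
      l (n + 1) * p (n + 2) * X n + l (n + 2) * p n * X (n + 1) + l (n + 2) * p (n + 1) * X n)
  R_succ : ∀ n, ¬ I n → R (n + 1) = R n
  R_mul_le : ∀ n, R n * (l n * X (n + 1)) ≤ 2 * (l n * p (n + 1) + l (n + 1) * p n)
  le_R_mul : ∀ n, l n * p (n + 1) - l (n + 1) * p n ≤ R n * (2 * (l n * X (n + 1)))
  W_succ : ∀ n, ¬ I n → W (n + 1) = W n
  W_pos : ∀ n, 0 < W n
  W_le : ∀ n, W n ≤ 2 * (l n * X (n + 1))

namespace MinimalSystem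

variable {α r C K : ℝ} {X l p R W : ℕ → ℝ} {I : ℕ → Prop}

lemma X_pos (h : MinimalSystem α r C K X l p R W I) (n : ℕ) : 0 < X n :=
  zero_lt_one.trans_le (h.one_le_X n)

lemma frequently_independent (h : MinimalSystem α r C K X l p R W I) (N : ℕ) :
    ∃ n, N ≤ n ∧ I n := by
  by_contra! hI
  have hα := h.two_le
  have hconst : ∀ k, W (N + k) = W N := by
    intro k
    induction k with
    | zero => rfl
    | succ k ih => rw [← ih, ← add_assoc, h.W_succ _ (hI _ (by omega))]
  have hle : ∀ k, W N ≤ 2 * C * X (N + k + 1) ^ (-(α - 1)) := by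
    intro k
    have hX := h.X_pos (N + k + 1)
    calc W N = W (N + k) := (hconst k).symm
      _ ≤ 2 * (l (N + k) * X (N + k + 1)) := h.W_le _
      _ ≤ 2 * (C * X (N + k + 1) ^ (-α) * X (N + k + 1)) := by gcongr; exact h.l_le _
      _ = 2 * C * X (N + k + 1) ^ (-(α - 1)) := by
        rw [mul_assoc C, ← Real.rpow_add_one hX.ne']; ring_nf
  have hlim : Filter.Tendsto (fun k => 2 * C * X (N + k + 1) ^ (-(α - 1))) Filter.atTop
      (nhds (2 * C * 0)) := by
    refine Filter.Tendsto.const_mul _ ?_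
    refine (tendsto_rpow_neg_atTop (by linarith : 0 < α - 1)).comp (h.X_tendsto.comp ?_)
    exact Filter.tendsto_atTop_mono (fun k => (by omega : k ≤ N + k + 1)) Filter.tendsto_id
  have := ge_of_tendsto' hlim hle
  linarith [h.W_pos N]

lemma rpow_le_next (h : MinimalSystem α r C K X l p R W I) {n : ℕ} (hn : I n) :
    X (n + 1) ^ (α - 1) ≤ 6 * K ^ 2 * C * X (n + 2) := by
  have hK := h.K_pos
  have h0 := h.X_pos n
  have h1 := h.X_pos (n + 1)
  have h2 := h.X_pos (n + 2)
  have l0 := h.l_pos n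
  have l1 := h.l_pos (n + 1)
  have l2 := h.l_pos (n + 2)
  have l01 : l (n + 1) ≤ l n := h.l_anti (by omega)
  have l02 : l (n + 2) ≤ l n := h.l_anti (by omega)
  have X01 : X n ≤ X (n + 1) := h.X_mono (by omega)
  have X12 : X (n + 1) ≤ X (n + 2) := h.X_mono (by omega)
  have p0 := h.p_nonneg n
  have p1 := h.p_nonneg (n + 1)
  have p2 := h.p_nonneg (n + 2)
  have q0 : p n ≤ K * X (n + 1) := (h.p_le_X n).trans (by gcongr)
  have q1 := h.p_le_X (n + 1)
  have q2 := h.p_le_X (n + 2)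
  have hdet := h.one_le_det n hn
  set M := l n * (K * X (n + 1)) * X (n + 2) with hM
  have t1 : l n * p (n + 1) * X (n + 2) ≤ M := by rw [hM]; gcongr
  have t2 : l n * p (n + 2) * X (n + 1) ≤ M := by
    calc _ ≤ l n * (K * X (n + 2)) * X (n + 1) := by gcongr
      _ = M := by ring
  have t3 : l (n + 1) * p n * X (n + 2) ≤ M := by rw [hM]; gcongr
  have t4 : l (n + 1) * p (n + 2) * X n ≤ M := by
    calc _ ≤ l n * (K * X (n + 2)) * X (n + 1) := by gcongr
      _ = M := by ring
  have t5 : l (n + 2) * p n * X (n + 1) ≤ M := by rw [hM]; gcongr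
  have t6 : l (n + 2) * p (n + 1) * X n ≤ M := by
    rw [hM]; gcongr; exact X01.trans X12
  have hone : 1 ≤ 6 * K ^ 2 * l n * X (n + 1) * X (n + 2) := by
    calc _ ≤ _ := hdet
      _ ≤ K * (6 * M) := by gcongr; linarith
      _ = _ := by rw [hM]; ring
  have hpow : X (n + 1) ^ (α - 1) * (X (n + 1) ^ (-α) * X (n + 1)) = 1 := by
    rw [← Real.rpow_add_one h1.ne', ← Real.rpow_add h1]
    ring_nf
    simp
  calc X (n + 1) ^ (α - 1) = X (n + 1) ^ (α - 1) * 1 := by ring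
    _ ≤ X (n + 1) ^ (α - 1) * (6 * K ^ 2 * l n * X (n + 1) * X (n + 2)) := by gcongr
    _ ≤ X (n + 1) ^ (α - 1) * (6 * K ^ 2 * (C * X (n + 1) ^ (-α)) * X (n + 1) * X (n + 2)) := by
      gcongr; exact h.l_le n
    _ = 6 * K ^ 2 * C * X (n + 2) * (X (n + 1) ^ (α - 1) * (X (n + 1) ^ (-α) * X (n + 1))) := by
      ring
    _ = _ := by rw [hpow, mul_one]

/-- Negative powers of the norm of the third point of an independent triple are bounded by powers
of the norm of the second one. -/
lemma rpow_neg_next_le (h : MinimalSystem α r C K X l p R W I) {n : ℕ} (hn : I n) {s : ℝ}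
    (hs : 0 ≤ s) :
    X (n + 2) ^ (-s) ≤ (6 * K ^ 2 * C) ^ s * X (n + 1) ^ (-((α - 1) * s)) := by
  have hK := h.K_pos
  have hC := h.C_pos
  have h1 := h.X_pos (n + 1)
  have h2 := h.X_pos (n + 2)
  have hle := Real.rpow_le_rpow (by positivity) (h.rpow_le_next hn) hs
  rw [← Real.rpow_mul h1.le, Real.mul_rpow (by positivity) h2.le] at hle
  rw [Real.rpow_neg h2.le, Real.rpow_neg h1.le, ← div_eq_mul_inv, inv_le_comm₀ (by positivity)
    (by positivity), inv_div, div_le_iff₀ (by positivity)]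
  linarith

lemma eventually_mul_rpow_le (h : MinimalSystem α r C K X l p R W I) (A : ℝ) {ε : ℝ}
    (hε : 0 < ε) : ∃ N, ∀ n, N ≤ n → A * X n ^ (-(α ^ 2 - α + 1 - r)) ≤ ε := by
  have hlim := ((tendsto_rpow_neg_atTop (by linarith [h.r_lt] : 0 < α ^ 2 - α + 1 - r)).comp
    h.X_tendsto).const_mul A
  rw [mul_zero] at hlim
  exact Filter.eventually_atTop.1 ((hlim.eventually (gt_mem_nhds hε)).mono fun _ hx => hx.le)

lemma eventually_rpow_le_p (h : MinimalSystem α r C K X l p R W I) :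
    ∃ N, ∀ n, N ≤ n → I n → X (n + 1) ^ (α - 1) ≤ 4 * K * C * p (n + 2) := by
  have hα := h.two_le
  have hK := h.K_pos
  have hC := h.C_pos
  have hr : 0 ≤ r := by linarith [h.one_le_r]
  obtain ⟨N, hN⟩ := h.eventually_mul_rpow_le
    (K * (4 * (C ^ 2 * (6 * K ^ 2 * C) ^ (α - 1)))) (show (0 : ℝ) < 1 / 2 by norm_num)
  refine ⟨N, fun n hNn hn => ?_⟩
  have h0 := h.X_pos n
  have h1 := h.X_pos (n + 1)
  have h2 := h.X_pos (n + 2)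
  have l0 := h.l_pos n
  have l1 := h.l_pos (n + 1)
  have l2 := h.l_pos (n + 2)
  have l01 : l (n + 1) ≤ l n := h.l_anti (by omega)
  have l12 : l (n + 2) ≤ l (n + 1) := h.l_anti (by omega)
  have X01 : X n ≤ X (n + 1) := h.X_mono (by omega)
  have X12 : X (n + 1) ≤ X (n + 2) := h.X_mono (by omega)
  have p0 := h.p_nonneg n
  have p1 := h.p_nonneg (n + 1)
  have p2 := h.p_nonneg (n + 2)
  have q0 : p n ≤ l n * X (n + 1) ^ r := (h.p_le n).trans (by gcongr)
  have q1 := h.p_le (n + 1)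
  have hdet := h.one_le_det n hn
  set M := l n * l (n + 1) * X (n + 1) ^ r * X (n + 2) with hM
  have t1 : l n * p (n + 1) * X (n + 2) ≤ M := by
    calc _ ≤ l n * (l (n + 1) * X (n + 1) ^ r) * X (n + 2) := by gcongr
      _ = M := by ring
  have t3 : l (n + 1) * p n * X (n + 2) ≤ M := by
    calc _ ≤ l (n + 1) * (l n * X (n + 1) ^ r) * X (n + 2) := by gcongr
      _ = M := by ring
  have t4 : l (n + 1) * p (n + 2) * X n ≤ l n * p (n + 2) * X (n + 1) := by gcongr
  have t5 : l (n + 2) * p n * X (n + 1) ≤ M := by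
    calc _ ≤ l (n + 1) * (l n * X (n + 1) ^ r) * X (n + 2) := by gcongr
      _ = M := by ring
  have t6 : l (n + 2) * p (n + 1) * X n ≤ M := by
    calc _ ≤ l n * (l (n + 1) * X (n + 1) ^ r) * X (n + 2) := by
          gcongr
          · exact l12.trans l01
          · exact X01.trans X12
      _ = M := by ring
  have hMle : M ≤ C ^ 2 * (6 * K ^ 2 * C) ^ (α - 1) * X (n + 1) ^ (-(α ^ 2 - α + 1 - r)) := by
    calc M ≤ C * X (n + 1) ^ (-α) * (C * X (n + 2) ^ (-α)) * X (n + 1) ^ r * X (n + 2) := by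
          rw [hM]
          gcongr
          · exact h.l_le n
          · exact h.l_le (n + 1)
      _ = C ^ 2 * (X (n + 1) ^ (-α) * X (n + 1) ^ r) * (X (n + 2) ^ (-α) * X (n + 2)) := by ring
      _ = C ^ 2 * X (n + 1) ^ (-α + r) * X (n + 2) ^ (-(α - 1)) := by
          rw [← Real.rpow_add h1, ← Real.rpow_add_one h2.ne']
          ring_nf
      _ ≤ C ^ 2 * X (n + 1) ^ (-α + r) *
            ((6 * K ^ 2 * C) ^ (α - 1) * X (n + 1) ^ (-((α - 1) * (α - 1)))) := by
          gcongr
          exact h.rpow_neg_next_le hn (by linarith)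
      _ = C ^ 2 * (6 * K ^ 2 * C) ^ (α - 1) *
            (X (n + 1) ^ (-α + r) * X (n + 1) ^ (-((α - 1) * (α - 1)))) := by ring
      _ = _ := by
          rw [← Real.rpow_add h1]
          ring_nf
  have hsmall : K * (4 * M) ≤ 1 / 2 := by
    refine le_trans ?_ (hN (n + 1) (by omega))
    calc K * (4 * M) ≤ K * (4 * (C ^ 2 * (6 * K ^ 2 * C) ^ (α - 1) *
            X (n + 1) ^ (-(α ^ 2 - α + 1 - r)))) := by gcongr
      _ = _ := by ring
  have hhalf : 1 ≤ 4 * K * (l n * p (n + 2) * X (n + 1)) := by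
    have : K * (l n * p (n + 1) * X (n + 2) + l n * p (n + 2) * X (n + 1) +
        l (n + 1) * p n * X (n + 2) + l (n + 1) * p (n + 2) * X n +
        l (n + 2) * p n * X (n + 1) + l (n + 2) * p (n + 1) * X n) ≤
        K * (4 * M + 2 * (l n * p (n + 2) * X (n + 1))) :=
      mul_le_mul_of_nonneg_left (by linarith) hK.le
    linarith
  have hpow : X (n + 1) ^ (α - 1) * (X (n + 1) ^ (-α) * X (n + 1)) = 1 := by
    rw [← Real.rpow_add_one h1.ne', ← Real.rpow_add h1]
    ring_nf
    simp
  calc X (n + 1) ^ (α - 1) = X (n + 1) ^ (α - 1) * 1 := by ring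
    _ ≤ X (n + 1) ^ (α - 1) * (4 * K * (l n * p (n + 2) * X (n + 1))) := by gcongr
    _ ≤ X (n + 1) ^ (α - 1) * (4 * K * (C * X (n + 1) ^ (-α) * p (n + 2) * X (n + 1))) := by
      gcongr; exact h.l_le n
    _ = 4 * K * C * p (n + 2) * (X (n + 1) ^ (α - 1) * (X (n + 1) ^ (-α) * X (n + 1))) := by ring
    _ = _ := by rw [hpow, mul_one]

lemma eventually_le_R (h : MinimalSystem α r C K X l p R W I) :
    ∃ N, ∀ n, N ≤ n → I n → X (n + 1) ^ (α - 1) ≤ 16 * K * C * R (n + 1) * X (n + 2) := by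
  have hα := h.two_le
  have hK := h.K_pos
  have hC := h.C_pos
  have hr : 0 ≤ r := by linarith [h.one_le_r]
  obtain ⟨N₁, hN₁⟩ := h.eventually_rpow_le_p
  obtain ⟨N₂, hN₂⟩ := h.eventually_mul_rpow_le (8 * K * C * (C * (6 * K ^ 2 * C) ^ α)) zero_lt_one
  refine ⟨max N₁ N₂, fun n hNn hn => ?_⟩
  have hp := hN₁ n (le_of_max_le_left hNn) hn
  have hε := hN₂ (n + 1) (by have := le_of_max_le_right hNn; omega)
  have h1 := h.X_pos (n + 1)
  have h2 := h.X_pos (n + 2)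
  have l1 := h.l_pos (n + 1)
  have l2 := h.l_pos (n + 2)
  have p2 := h.p_nonneg (n + 2)
  have hl2 : l (n + 2) * X (n + 1) ^ r ≤
      C * (6 * K ^ 2 * C) ^ α * X (n + 1) ^ (-(α ^ 2 - α + 1 - r)) * X (n + 1) := by
    calc l (n + 2) * X (n + 1) ^ r ≤ C * X (n + 3) ^ (-α) * X (n + 1) ^ r := by
          gcongr; exact h.l_le (n + 2)
      _ ≤ C * X (n + 2) ^ (-α) * X (n + 1) ^ r := by
          have := Real.rpow_le_rpow_of_nonpos h2 (h.X_mono (by omega : n + 2 ≤ n + 3))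
            (by linarith : -α ≤ 0)
          gcongr C * ?_ * _
      _ ≤ C * ((6 * K ^ 2 * C) ^ α * X (n + 1) ^ (-((α - 1) * α))) * X (n + 1) ^ r := by
          gcongr; exact h.rpow_neg_next_le hn (by linarith)
      _ = C * (6 * K ^ 2 * C) ^ α * (X (n + 1) ^ (-((α - 1) * α)) * X (n + 1) ^ r) := by ring
      _ = _ := by
          rw [mul_assoc _ _ (X (n + 1)), ← Real.rpow_add h1, ← Real.rpow_add_one h1.ne']
          ring_nf
  have hXle : X (n + 1) ≤ X (n + 1) ^ (α - 1) :=
    Real.self_le_rpow_of_one_le (h.one_le_X _) (by linarith)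
  have hsmall : l (n + 2) * X (n + 1) ^ r ≤ p (n + 2) / 2 := by
    have h8 : 8 * K * C * (l (n + 2) * X (n + 1) ^ r) ≤ 8 * K * C * (p (n + 2) / 2) := by
      calc 8 * K * C * (l (n + 2) * X (n + 1) ^ r)
          ≤ 8 * K * C * (C * (6 * K ^ 2 * C) ^ α * X (n + 1) ^ (-(α ^ 2 - α + 1 - r)) *
            X (n + 1)) := by gcongr
        _ = 8 * K * C * (C * (6 * K ^ 2 * C) ^ α) * X (n + 1) ^ (-(α ^ 2 - α + 1 - r)) *
            X (n + 1) := by ring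
        _ ≤ 1 * X (n + 1) := by gcongr
        _ ≤ 8 * K * C * (p (n + 2) / 2) := by linarith
    exact le_of_mul_le_mul_left h8 (by positivity)
  have hlow := h.le_R_mul (n + 1)
  have hneg : l (n + 2) * p (n + 1) ≤ l (n + 1) * (p (n + 2) / 2) := by
    calc l (n + 2) * p (n + 1) ≤ l (n + 2) * (l (n + 1) * X (n + 1) ^ r) := by
          gcongr; exact h.p_le (n + 1)
      _ = l (n + 1) * (l (n + 2) * X (n + 1) ^ r) := by ring
      _ ≤ _ := by gcongr
  have hR : p (n + 2) / 2 ≤ R (n + 1) * 2 * X (n + 2) := by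
    refine le_of_mul_le_mul_left ?_ l1
    simp only [show n + 1 + 1 = n + 2 from rfl] at hlow
    linarith
  calc X (n + 1) ^ (α - 1) ≤ 4 * K * C * p (n + 2) := hp
    _ ≤ 4 * K * C * (4 * (R (n + 1) * X (n + 2))) := by gcongr; linarith
    _ = _ := by ring

lemma R_le (h : MinimalSystem α r C K X l p R W I) (n : ℕ) :
    R n ≤ 4 * C * X (n + 1) ^ (r - 1) * X (n + 2) ^ (-α) := by
  have hC := h.C_pos
  have hr : 0 ≤ r := by linarith [h.one_le_r]
  have h0 := h.X_pos n
  have h1 := h.X_pos (n + 1)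
  have l0 := h.l_pos n
  have l1 := h.l_pos (n + 1)
  have q0 : p n ≤ l n * X (n + 1) ^ r :=
    (h.p_le n).trans (by gcongr; exact h.X_mono (by omega))
  have q1 := h.p_le (n + 1)
  have hR : R n * (l n * X (n + 1)) ≤
      4 * l (n + 1) * X (n + 1) ^ (r - 1) * (l n * X (n + 1)) := by
    calc R n * (l n * X (n + 1)) ≤ 2 * (l n * p (n + 1) + l (n + 1) * p n) := h.R_mul_le n
      _ ≤ 2 * (l n * (l (n + 1) * X (n + 1) ^ r) + l (n + 1) * (l n * X (n + 1) ^ r)) := by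
        gcongr
      _ = 4 * l (n + 1) * l n * X (n + 1) ^ (r - 1 + 1) := by ring_nf
      _ = _ := by rw [Real.rpow_add_one h1.ne']; ring
  calc R n ≤ 4 * l (n + 1) * X (n + 1) ^ (r - 1) := le_of_mul_le_mul_right hR (by positivity)
    _ ≤ 4 * (C * X (n + 2) ^ (-α)) * X (n + 1) ^ (r - 1) := by gcongr; exact h.l_le (n + 1)
    _ = _ := by ring

lemma exists_next_independent (h : MinimalSystem α r C K X l p R W I) (n : ℕ) :
    ∃ m, n < m ∧ I m ∧ R m = R (n + 1) := by
  classical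
  have hex : ∃ m, n < m ∧ I m := by
    obtain ⟨m, hm, hI⟩ := h.frequently_independent (n + 1)
    exact ⟨m, by omega, hI⟩
  obtain ⟨hlt, hI⟩ := Nat.find_spec hex
  refine ⟨Nat.find hex, hlt, hI, ?_⟩
  have hconst : ∀ k, n + 1 + k ≤ Nat.find hex → R (n + 1 + k) = R (n + 1) := by
    intro k
    induction k with
    | zero => intro; rfl
    | succ k ih =>
      intro hk
      rw [← ih (by omega), ← add_assoc, h.R_succ]
      intro hI'
      exact Nat.find_min hex (show n + 1 + k < Nat.find hex by omega) ⟨by omega, hI'⟩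
  obtain ⟨k, hk⟩ := Nat.exists_eq_add_of_le (Nat.succ_le_of_lt hlt)
  rw [hk]
  exact hconst k hk.ge

lemma eventually_ratio_halves (h : MinimalSystem α r C K X l p R W I) :
    ∃ N, ∀ n, N ≤ n → I n → ∃ m, N ≤ m ∧ I m ∧
      2 * (X (m + 2) / X (m + 1) ^ (α - 1)) ≤ X (n + 2) / X (n + 1) ^ (α - 1) := by
  have hα := h.two_le
  have hK := h.K_pos
  have hC := h.C_pos
  obtain ⟨N₁, hN₁⟩ := h.eventually_le_R
  obtain ⟨N₂, hN₂⟩ := h.eventually_mul_rpow_le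
    (2 * (16 * K * C * (4 * C)) * (6 * K ^ 2 * C) ^ (α - 1)) zero_lt_one
  refine ⟨max N₁ N₂, fun n hNn hn => ?_⟩
  obtain ⟨m, hnm, hm, hRm⟩ := h.exists_next_independent n
  refine ⟨m, by omega, hm, ?_⟩
  have hlow := hN₁ n (le_of_max_le_left hNn) hn
  have hε := hN₂ (m + 1) (by have := le_of_max_le_right hNn; omega)
  have hup := h.R_le m
  rw [hRm] at hup
  have n1 := h.X_pos (n + 1)
  have n2 := h.X_pos (n + 2)
  have m1 := h.X_pos (m + 1)
  have m2 := h.X_pos (m + 2)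
  have hpow : X (m + 1) ^ (r - 1) * X (m + 2) ^ (-α) * (X (m + 2) / X (m + 1) ^ (α - 1)) ≤
      (6 * K ^ 2 * C) ^ (α - 1) * X (m + 1) ^ (-(α ^ 2 - α + 1 - r)) := by
    calc _ = X (m + 1) ^ (r - 1) * (X (m + 1) ^ (α - 1))⁻¹ * (X (m + 2) ^ (-α) * X (m + 2)) := by
          rw [div_eq_mul_inv]; ring
      _ = X (m + 1) ^ (r - 1 + -(α - 1)) * X (m + 2) ^ (-(α - 1)) := by
          rw [← Real.rpow_neg m1.le, ← Real.rpow_add m1, ← Real.rpow_add_one m2.ne']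
          ring_nf
      _ ≤ X (m + 1) ^ (r - 1 + -(α - 1)) *
          ((6 * K ^ 2 * C) ^ (α - 1) * X (m + 1) ^ (-((α - 1) * (α - 1)))) := by
          gcongr
          exact h.rpow_neg_next_le hm (by linarith)
      _ = (6 * K ^ 2 * C) ^ (α - 1) *
          (X (m + 1) ^ (r - 1 + -(α - 1)) * X (m + 1) ^ (-((α - 1) * (α - 1)))) := by ring
      _ = _ := by
          rw [← Real.rpow_add m1]
          ring_nf
  set G := X (m + 2) / X (m + 1) ^ (α - 1) with hG
  have hGpos : 0 < G := by positivity
  rw [le_div_iff₀ (by positivity)]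
  calc 2 * G * X (n + 1) ^ (α - 1) ≤ 2 * G * (16 * K * C * R (n + 1) * X (n + 2)) := by gcongr
    _ ≤ 2 * G * (16 * K * C * (4 * C * X (m + 1) ^ (r - 1) * X (m + 2) ^ (-α)) * X (n + 2)) := by
      gcongr
    _ = 2 * (16 * K * C * (4 * C)) * (X (m + 1) ^ (r - 1) * X (m + 2) ^ (-α) * G) * X (n + 2) := by
      ring
    _ ≤ 2 * (16 * K * C * (4 * C)) * ((6 * K ^ 2 * C) ^ (α - 1) *
          X (m + 1) ^ (-(α ^ 2 - α + 1 - r))) * X (n + 2) := by gcongr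
    _ = 2 * (16 * K * C * (4 * C)) * (6 * K ^ 2 * C) ^ (α - 1) *
          X (m + 1) ^ (-(α ^ 2 - α + 1 - r)) * X (n + 2) := by ring
    _ ≤ 1 * X (n + 2) := by gcongr
    _ = X (n + 2) := one_mul _

theorem contradiction (h : MinimalSystem α r C K X l p R W I) : False := by
  have hK := h.K_pos
  have hC := h.C_pos
  obtain ⟨N, hN⟩ := h.eventually_ratio_halves
  have hlow : ∀ k n, N ≤ n → I n →
      2 ^ k ≤ 6 * K ^ 2 * C * (X (n + 2) / X (n + 1) ^ (α - 1)) := by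
    intro k
    induction k with
    | zero =>
      intro n _ hn
      have := h.X_pos (n + 1)
      rw [pow_zero, ← mul_div_assoc, one_le_div (by positivity)]
      exact h.rpow_le_next hn
    | succ k ih =>
      intro n hNn hn
      obtain ⟨m, hNm, hm, hle⟩ := hN n hNn hn
      calc (2 : ℝ) ^ (k + 1) = 2 * 2 ^ k := by ring
        _ ≤ 2 * (6 * K ^ 2 * C * (X (m + 2) / X (m + 1) ^ (α - 1))) := by
          gcongr; exact ih m hNm hm
        _ = 6 * K ^ 2 * C * (2 * (X (m + 2) / X (m + 1) ^ (α - 1))) := by ring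
        _ ≤ _ := by gcongr
  obtain ⟨n, hNn, hn⟩ := h.frequently_independent N
  obtain ⟨k, hk⟩ := pow_unbounded_of_one_lt
    (6 * K ^ 2 * C * (X (n + 2) / X (n + 1) ^ (α - 1))) (one_lt_two (α := ℝ))
  linarith [hlow k n hNn hn]

end MinimalSystem

section CrossProduct

open scoped Matrix

lemma dotProduct_self_nonneg_real (v : Fin 3 → ℝ) : 0 ≤ v ⬝ᵥ v :=
  Finset.sum_nonneg fun _ _ => mul_self_nonneg _

lemma abs_dotProduct_le (v w : Fin 3 → ℝ) : |v ⬝ᵥ w| ≤ √(v ⬝ᵥ v) * √(w ⬝ᵥ w) := by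
  rw [← Real.sqrt_mul (dotProduct_self_nonneg_real v)]
  apply Real.abs_le_sqrt
  have h := dotProduct_self_nonneg_real (v ⨯₃ w)
  rw [cross_dot_cross, dotProduct_comm w v] at h
  linarith

lemma cross_cross_dot_self (a v w : Fin 3 → ℝ) :
    a ⨯₃ (v ⨯₃ w) ⬝ᵥ a ⨯₃ (v ⨯₃ w) =
      (a ⬝ᵥ w) ^ 2 * (v ⬝ᵥ v) - 2 * ((a ⬝ᵥ v) * (a ⬝ᵥ w) * (v ⬝ᵥ w)) +
        (a ⬝ᵥ v) ^ 2 * (w ⬝ᵥ w) := by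
  simp only [cross_apply, Matrix.vec3_dotProduct, Matrix.cons_val]
  ring

lemma sqrt_cross_cross_le {a v w : Fin 3 → ℝ} (ha : |a ⬝ᵥ w| ≤ |a ⬝ᵥ v|)
    (hv : √(v ⬝ᵥ v) ≤ √(w ⬝ᵥ w)) :
    √(a ⨯₃ (v ⨯₃ w) ⬝ᵥ a ⨯₃ (v ⨯₃ w)) ≤ 2 * (|a ⬝ᵥ v| * √(w ⬝ᵥ w)) := by
  apply Real.sqrt_le_iff.2 ⟨by positivity, ?_⟩
  rw [cross_cross_dot_self]
  have hvw := abs_dotProduct_le v w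
  have h1 := Real.sq_sqrt (dotProduct_self_nonneg_real v)
  have h2 := Real.sq_sqrt (dotProduct_self_nonneg_real w)
  have h3 : -((a ⬝ᵥ v) * (a ⬝ᵥ w) * (v ⬝ᵥ w)) ≤
      |a ⬝ᵥ v| * |a ⬝ᵥ w| * (√(v ⬝ᵥ v) * √(w ⬝ᵥ w)) := by
    refine (neg_le_abs _).trans ?_
    rw [abs_mul, abs_mul]
    gcongr
  have h4 : |a ⬝ᵥ w| * √(v ⬝ᵥ v) ≤ |a ⬝ᵥ v| * √(w ⬝ᵥ w) := by gcongr
  have h5 := pow_le_pow_left₀ (by positivity)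
    (add_le_add_left h4 (|a ⬝ᵥ v| * √(w ⬝ᵥ w))) 2
  rw [← sq_abs (a ⬝ᵥ w), ← sq_abs (a ⬝ᵥ v), ← h1, mul_pow, mul_pow, h2]
  rw [add_sq, ← two_mul, mul_pow, mul_pow, mul_pow, mul_pow, h2] at h5
  linarith

lemma le_two_mul_sqrt_cross_cross {a v w : Fin 3 → ℝ}
    (hv : √(v ⬝ᵥ v) ≤ √(w ⬝ᵥ w))
    (hmin : 2 * ((a ⬝ᵥ v) * (a ⬝ᵥ w) * (v ⬝ᵥ w)) ≤ |a ⬝ᵥ v| * |a ⬝ᵥ w| * (v ⬝ᵥ v)) :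
    |a ⬝ᵥ v| * √(w ⬝ᵥ w) ≤ 2 * √(a ⨯₃ (v ⨯₃ w) ⬝ᵥ a ⨯₃ (v ⨯₃ w)) := by
  have hvw : v ⬝ᵥ v ≤ w ⬝ᵥ w := (Real.sqrt_le_sqrt_iff (dotProduct_self_nonneg_real w)).1 hv
  suffices |a ⬝ᵥ v| * √(w ⬝ᵥ w) / 2 ≤ √(a ⨯₃ (v ⨯₃ w) ⬝ᵥ a ⨯₃ (v ⨯₃ w)) by linarith
  apply Real.le_sqrt_of_sq_le
  rw [cross_cross_dot_self, div_pow, mul_pow, Real.sq_sqrt (dotProduct_self_nonneg_real w)]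
  have h1 : 0 ≤ (|a ⬝ᵥ w| - |a ⬝ᵥ v| / 2) ^ 2 * (v ⬝ᵥ v) :=
    mul_nonneg (sq_nonneg _) (dotProduct_self_nonneg_real v)
  have h2 := mul_le_mul_of_nonneg_left hvw (sq_nonneg |a ⬝ᵥ v|)
  have h3 := mul_nonneg (sq_nonneg |a ⬝ᵥ v|) (dotProduct_self_nonneg_real w)
  rw [← sq_abs (a ⬝ᵥ w), ← sq_abs (a ⬝ᵥ v)]
  nlinarith

/-- Multiplicativity of the determinant, for the forms `a`, `b`, `a ⨯₃ b`. -/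
lemma dot_cross_mul_triple (a b x y z : Fin 3 → ℝ) :
    (a ⨯₃ b ⬝ᵥ a ⨯₃ b) * (x ⬝ᵥ y ⨯₃ z) =
      (a ⬝ᵥ x) * (b ⬝ᵥ y) * (a ⨯₃ b ⬝ᵥ z) - (a ⬝ᵥ x) * (b ⬝ᵥ z) * (a ⨯₃ b ⬝ᵥ y) -
      (a ⬝ᵥ y) * (b ⬝ᵥ x) * (a ⨯₃ b ⬝ᵥ z) + (a ⬝ᵥ y) * (b ⬝ᵥ z) * (a ⨯₃ b ⬝ᵥ x) +
      (a ⬝ᵥ z) * (b ⬝ᵥ x) * (a ⨯₃ b ⬝ᵥ y) - (a ⬝ᵥ z) * (b ⬝ᵥ y) * (a ⨯₃ b ⬝ᵥ x) := by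
  simp only [cross_apply, Matrix.vec3_dotProduct, Matrix.cons_val]
  ring

lemma sqrt_dot_cross_le (a b x y z : Fin 3 → ℝ) (hab : a ⨯₃ b ≠ 0) (hdet : 1 ≤ |x ⬝ᵥ y ⨯₃ z|) :
    √(a ⨯₃ b ⬝ᵥ a ⨯₃ b) ≤
      |a ⬝ᵥ x| * |b ⬝ᵥ y| * √(z ⬝ᵥ z) + |a ⬝ᵥ x| * |b ⬝ᵥ z| * √(y ⬝ᵥ y) +
      |a ⬝ᵥ y| * |b ⬝ᵥ x| * √(z ⬝ᵥ z) + |a ⬝ᵥ y| * |b ⬝ᵥ z| * √(x ⬝ᵥ x) +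
      |a ⬝ᵥ z| * |b ⬝ᵥ x| * √(y ⬝ᵥ y) + |a ⬝ᵥ z| * |b ⬝ᵥ y| * √(x ⬝ᵥ x) := by
  set u := a ⨯₃ b with hu
  have hupos : 0 < u ⬝ᵥ u :=
    (dotProduct_self_nonneg_real u).lt_of_ne' (mt dotProduct_self_eq_zero.1 hab)
  have hterm : ∀ c d : ℝ, ∀ v : Fin 3 → ℝ,
      |c * d * (u ⬝ᵥ v)| ≤ √(u ⬝ᵥ u) * (|c| * |d| * √(v ⬝ᵥ v)) := by
    intro c d v
    rw [abs_mul, abs_mul]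
    calc |c| * |d| * |u ⬝ᵥ v| ≤ |c| * |d| * (√(u ⬝ᵥ u) * √(v ⬝ᵥ v)) := by
          gcongr; exact abs_dotProduct_le u v
      _ = _ := by ring
  refine le_of_mul_le_mul_left ?_ (Real.sqrt_pos.2 hupos)
  rw [Real.mul_self_sqrt hupos.le]
  have hid := dot_cross_mul_triple a b x y z
  rw [← hu] at hid
  have hle : u ⬝ᵥ u ≤ |(u ⬝ᵥ u) * (x ⬝ᵥ y ⨯₃ z)| := by
    rw [abs_mul, abs_of_pos hupos]
    exact le_mul_of_one_le_right hupos.le hdet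
  rw [hid] at hle
  have t1 := abs_le.1 (hterm (a ⬝ᵥ x) (b ⬝ᵥ y) z)
  have t2 := abs_le.1 (hterm (a ⬝ᵥ x) (b ⬝ᵥ z) y)
  have t3 := abs_le.1 (hterm (a ⬝ᵥ y) (b ⬝ᵥ x) z)
  have t4 := abs_le.1 (hterm (a ⬝ᵥ y) (b ⬝ᵥ z) x)
  have t5 := abs_le.1 (hterm (a ⬝ᵥ z) (b ⬝ᵥ x) y)
  have t6 := abs_le.1 (hterm (a ⬝ᵥ z) (b ⬝ᵥ y) x)
  refine hle.trans (abs_le.2 ⟨?_, ?_⟩) <;> linarith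

/-- If three vectors are coplanar, the cross products of the consecutive pairs are proportional. -/
lemma exists_smul_cross_of_triple_eq_zero {x y z : Fin 3 → ℝ} (hxy : x ⨯₃ y ≠ 0)
    (hyz : y ⨯₃ z ≠ 0) (h : x ⬝ᵥ y ⨯₃ z = 0) : ∃ c : ℝ, c ≠ 0 ∧ y ⨯₃ z = c • (x ⨯₃ y) := by
  have hcross : (x ⨯₃ y) ⨯₃ (y ⨯₃ z) = 0 := by
    rw [cross_cross_eq_smul_sub_smul, h, dot_self_cross, zero_smul, zero_smul, sub_zero]
  have hdep : ¬ LinearIndependent ℝ ![x ⨯₃ y, y ⨯₃ z] := fun hli =>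
    crossProduct_ne_zero_iff_linearIndependent.2 hli hcross
  rw [LinearIndependent.pair_iff' hxy] at hdep
  push Not at hdep
  obtain ⟨c, hc⟩ := hdep
  refine ⟨c, ?_, hc.symm⟩
  rintro rfl
  exact hyz (by rw [← hc, zero_smul])

lemma sqrt_smul_dot_smul (c : ℝ) (v : Fin 3 → ℝ) :
    √((c • v) ⬝ᵥ (c • v)) = |c| * √(v ⬝ᵥ v) := by
  rw [smul_dotProduct, dotProduct_smul, smul_eq_mul, smul_eq_mul, ← mul_assoc,
    Real.sqrt_mul (mul_self_nonneg c), Real.sqrt_mul_self_eq_abs]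

end CrossProduct

section IntegerVectors

open scoped Matrix

lemma enormZ_eq_sqrt (z : Fin 3 → ℤ) : enormZ z = √(toR z ⬝ᵥ toR z) := by
  simp only [enormZ, toR, Matrix.vec3_dotProduct]
  ring_nf

lemma one_le_enormZ {z : Fin 3 → ℤ} (hz : z ≠ 0) : 1 ≤ enormZ z := by
  have hz' : (0 : ℤ) < z ⬝ᵥ z :=
    (Finset.sum_nonneg fun _ _ => mul_self_nonneg _).lt_of_ne' (mt dotProduct_self_eq_zero.1 hz)
  rw [enormZ_eq_sqrt, Real.one_le_sqrt]
  simp only [toR, Matrix.vec3_dotProduct] at hz' ⊢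
  exact_mod_cast hz'

lemma toR_triple (x y z : Fin 3 → ℤ) :
    toR x ⬝ᵥ toR y ⨯₃ toR z = ((x ⬝ᵥ y ⨯₃ z : ℤ) : ℝ) := by
  simp only [cross_apply, Matrix.vec3_dotProduct, Matrix.cons_val, toR]
  push_cast
  ring

lemma toR_cross (x y : Fin 3 → ℤ) : toR x ⨯₃ toR y = toR (x ⨯₃ y) := by
  ext i
  fin_cases i <;> simp [cross_apply, toR]

lemma finite_enormZ_le (M : ℝ) : {z : Fin 3 → ℤ | enormZ z ≤ M}.Finite := by
  refine (Set.finite_Icc (fun _ => -⌈M⌉ : Fin 3 → ℤ) (fun _ => ⌈M⌉)).subset ?_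
  intro z hz
  have hcoord : ∀ i, |z i| ≤ ⌈M⌉ := by
    intro i
    have : |(z i : ℝ)| ≤ enormZ z := by
      apply Real.abs_le_sqrt
      fin_cases i <;> simp <;> nlinarith [sq_nonneg (z 0 : ℝ), sq_nonneg (z 1 : ℝ),
        sq_nonneg (z 2 : ℝ)]
    exact_mod_cast (this.trans hz).trans (Int.le_ceil M)
  exact ⟨fun i => (abs_le.1 (hcoord i)).1, fun i => (abs_le.1 (hcoord i)).2⟩

lemma exists_minimal_points (f : (Fin 3 → ℤ) → ℝ)
    (hsmall : ∀ ε > 0, ∃ z, z ≠ 0 ∧ f z < ε) (hpos : ∀ z, z ≠ 0 → 0 < f z) :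
    ∃ z : ℕ → Fin 3 → ℤ, (∀ n, z n ≠ 0) ∧ (∀ n, f (z (n + 1)) < f (z n)) ∧
      ∀ n y, y ≠ 0 → f y < f (z n) → enormZ (z (n + 1)) ≤ enormZ y := by
  have hnext : ∀ x : {x : Fin 3 → ℤ // x ≠ 0}, ∃ y : {y : Fin 3 → ℤ // y ≠ 0}, f y < f x ∧
      ∀ w, w ≠ 0 → f w < f x → enormZ y ≤ enormZ w := by
    rintro ⟨x, hx⟩
    obtain ⟨y₀, hy₀, hlt₀⟩ := hsmall (f x) (hpos x hx)
    obtain ⟨y, ⟨hy, hlt, -⟩, hmin⟩ := Set.exists_min_image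
      {y | y ≠ 0 ∧ f y < f x ∧ enormZ y ≤ enormZ y₀} enormZ
      ((finite_enormZ_le (enormZ y₀)).subset fun y hy => hy.2.2) ⟨y₀, hy₀, hlt₀, le_rfl⟩
    refine ⟨⟨y, hy⟩, hlt, fun w hw hwlt => ?_⟩
    rcases le_total (enormZ w) (enormZ y₀) with hle | hle
    · exact hmin w ⟨hw, hwlt, hle⟩
    · exact (hmin y₀ ⟨hy₀, hlt₀, le_rfl⟩).trans hle
  choose g hg hgmin using hnext
  obtain ⟨y₀, hy₀, -⟩ := hsmall 1 one_pos
  refine ⟨fun n => (g^[n] ⟨y₀, hy₀⟩).1, fun n => (g^[n] ⟨y₀, hy₀⟩).2, fun n => ?_,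
    fun n y hy hlt => ?_⟩
  · simp only [Function.iterate_succ_apply']; exact hg _
  · simp only [Function.iterate_succ_apply']; exact hgmin _ y hy hlt

end IntegerVectors

section MinimalPoints

open scoped Matrix

lemma two_mul_dot_le_of_minimal {a : Fin 3 → ℝ} {x y : Fin 3 → ℤ}
    (hpos : 0 < |a ⬝ᵥ toR y|) (hlt : |a ⬝ᵥ toR y| < |a ⬝ᵥ toR x|)
    (hmin : ∀ w, w ≠ 0 → |a ⬝ᵥ toR w| < |a ⬝ᵥ toR x| → enormZ y ≤ enormZ w) :
    2 * ((a ⬝ᵥ toR x) * (a ⬝ᵥ toR y) * (toR x ⬝ᵥ toR y)) ≤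
      |a ⬝ᵥ toR x| * |a ⬝ᵥ toR y| * (toR x ⬝ᵥ toR x) := by
  obtain ⟨s, hs, hsxy⟩ : ∃ s : ℤ, (s : ℝ) ^ 2 = 1 ∧
      (s : ℝ) * ((a ⬝ᵥ toR x) * (a ⬝ᵥ toR y)) = |a ⬝ᵥ toR x| * |a ⬝ᵥ toR y| := by
    rw [← abs_mul]
    rcases le_total 0 ((a ⬝ᵥ toR x) * (a ⬝ᵥ toR y)) with h | h
    · exact ⟨1, by norm_num, by rw [abs_of_nonneg h]; norm_num⟩
    · exact ⟨-1, by norm_num, by rw [abs_of_nonpos h]; norm_num⟩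
  have hw : toR (y - s • x) = toR y - (s : ℝ) • toR x := by
    ext i; simp [toR]
  have hdot : a ⬝ᵥ toR (y - s • x) = a ⬝ᵥ toR y - s * (a ⬝ᵥ toR x) := by
    rw [hw, dotProduct_sub, dotProduct_smul, smul_eq_mul]
  have hsq : (a ⬝ᵥ toR (y - s • x)) ^ 2 = (|a ⬝ᵥ toR x| - |a ⬝ᵥ toR y|) ^ 2 := by
    rw [hdot, sub_sq |_|, sq_abs, sq_abs, mul_assoc 2, ← hsxy]
    linear_combination (a ⬝ᵥ toR x) ^ 2 * hs
  have habs : |a ⬝ᵥ toR (y - s • x)| = |a ⬝ᵥ toR x| - |a ⬝ᵥ toR y| := by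
    rw [(sq_eq_sq_iff_abs_eq_abs _ _).1 hsq, abs_of_pos (sub_pos.2 hlt)]
  have hne : y - s • x ≠ 0 := by
    intro h0
    have h0' : toR (0 : Fin 3 → ℤ) = 0 := by ext i; simp [toR]
    rw [h0, h0', dotProduct_zero, abs_zero] at habs
    linarith
  have hle := hmin _ hne (by rw [habs]; linarith)
  rw [enormZ_eq_sqrt, enormZ_eq_sqrt, Real.sqrt_le_sqrt_iff (dotProduct_self_nonneg_real _), hw,
    sub_dotProduct, dotProduct_sub, dotProduct_sub, smul_dotProduct, smul_dotProduct,
    dotProduct_smul, dotProduct_smul, smul_eq_mul, smul_eq_mul, smul_eq_mul, smul_eq_mul,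
    dotProduct_comm (toR y) (toR x)] at hle
  have hvw : 2 * (s * (toR x ⬝ᵥ toR y)) ≤ toR x ⬝ᵥ toR x := by
    have : (s : ℝ) * (s * (toR x ⬝ᵥ toR x)) = toR x ⬝ᵥ toR x := by
      linear_combination (toR x ⬝ᵥ toR x) * hs
    linarith
  have hprod : (a ⬝ᵥ toR x) * (a ⬝ᵥ toR y) = s * (|a ⬝ᵥ toR x| * |a ⬝ᵥ toR y|) := by
    rw [← hsxy]
    linear_combination (-(a ⬝ᵥ toR x) * (a ⬝ᵥ toR y)) * hs
  calc 2 * ((a ⬝ᵥ toR x) * (a ⬝ᵥ toR y) * (toR x ⬝ᵥ toR y)) =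
        |a ⬝ᵥ toR x| * |a ⬝ᵥ toR y| * (2 * (s * (toR x ⬝ᵥ toR y))) := by rw [hprod]; ring
    _ ≤ _ := by gcongr

/-- A sequence of minimal points along which `|b| ≤ |a| |z| ^ r` yields a `MinimalSystem`. -/
lemma minimalSystem_of_minimal_points {a b : Fin 3 → ℝ} (hab : a ⨯₃ b ≠ 0)
    (ha : ∀ w : Fin 3 → ℤ, w ≠ 0 → 0 < |a ⬝ᵥ toR w|)
    {α r C : ℝ} (hα : 2 ≤ α) (hr₁ : 1 ≤ r) (hr : r < α ^ 2 - α + 1) (hC : 0 < C)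
    {z : ℕ → Fin 3 → ℤ} (hz : ∀ n, z n ≠ 0)
    (hanti : ∀ n, |a ⬝ᵥ toR (z (n + 1))| < |a ⬝ᵥ toR (z n)|)
    (hmin : ∀ n w, w ≠ 0 → |a ⬝ᵥ toR w| < |a ⬝ᵥ toR (z n)| → enormZ (z (n + 1)) ≤ enormZ w)
    (hmono : Monotone fun n => enormZ (z n))
    (htop : Filter.Tendsto (fun n => enormZ (z n)) Filter.atTop Filter.atTop)
    (hle : ∀ n, |a ⬝ᵥ toR (z n)| ≤ C * enormZ (z (n + 1)) ^ (-α))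
    (hb : ∀ n, |b ⬝ᵥ toR (z n)| ≤ |a ⬝ᵥ toR (z n)| * enormZ (z n) ^ r) :
    ∃ (K : ℝ) (R W : ℕ → ℝ) (I : ℕ → Prop), MinimalSystem α r C K (fun n => enormZ (z n))
      (fun n => |a ⬝ᵥ toR (z n)|) (fun n => |b ⬝ᵥ toR (z n)|) R W I := by
  have hupos : 0 < √(a ⨯₃ b ⬝ᵥ a ⨯₃ b) := Real.sqrt_pos.2 <|
    (dotProduct_self_nonneg_real _).lt_of_ne' (mt dotProduct_self_eq_zero.1 hab)
  set c : ℕ → Fin 3 → ℝ := fun n => toR (z n) ⨯₃ toR (z (n + 1)) with hc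
  set E : ℕ → ℝ := fun n => √(a ⨯₃ c n ⬝ᵥ a ⨯₃ c n) with hE
  have hX : ∀ n, 1 ≤ enormZ (z n) := fun n => one_le_enormZ (hz n)
  have hlpos : ∀ n, 0 < |a ⬝ᵥ toR (z n)| := fun n => ha _ (hz n)
  have hnorm : ∀ n, √(toR (z n) ⬝ᵥ toR (z n)) = enormZ (z n) := fun n => (enormZ_eq_sqrt _).symm
  have hE_le : ∀ n, E n ≤ 2 * (|a ⬝ᵥ toR (z n)| * enormZ (z (n + 1))) := by
    intro n
    rw [← hnorm (n + 1)]
    refine sqrt_cross_cross_le (hanti n).le ?_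
    rw [hnorm, hnorm]
    exact hmono n.le_succ
  have hle_E : ∀ n, |a ⬝ᵥ toR (z n)| * enormZ (z (n + 1)) ≤ 2 * E n := by
    intro n
    rw [← hnorm (n + 1)]
    refine le_two_mul_sqrt_cross_cross ?_
      (two_mul_dot_le_of_minimal (hlpos _) (hanti n) (hmin n))
    rw [hnorm, hnorm]
    exact hmono n.le_succ
  have hlX : ∀ n, 0 < |a ⬝ᵥ toR (z n)| * enormZ (z (n + 1)) := fun n =>
    mul_pos (hlpos n) (zero_lt_one.trans_le (hX _))
  have hEpos : ∀ n, 0 < E n := fun n => by linarith [hlX n, hle_E n]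
  have hcne : ∀ n, c n ≠ 0 := by
    intro n h0
    have := hEpos n
    simp [hE, h0] at this
  have hcone : ∀ n, 1 ≤ √(c n ⬝ᵥ c n) := by
    intro n
    simp only [hc, toR_cross, ← enormZ_eq_sqrt]
    refine one_le_enormZ fun h0 => hcne n ?_
    simp only [hc, toR_cross, h0]
    ext i; simp [toR]
  have hminor : ∀ n, a ⨯₃ b ⬝ᵥ c n = (a ⬝ᵥ toR (z n)) * (b ⬝ᵥ toR (z (n + 1))) -
      (a ⬝ᵥ toR (z (n + 1))) * (b ⬝ᵥ toR (z n)) := fun n => cross_dot_cross _ _ _ _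
  have hsucc : ∀ n, ¬ (toR (z n) ⬝ᵥ toR (z (n + 1)) ⨯₃ toR (z (n + 2)) ≠ 0) →
      ∃ k : ℝ, k ≠ 0 ∧ c (n + 1) = k • c n := fun n hn =>
    exists_smul_cross_of_triple_eq_zero (hcne n) (hcne (n + 1)) (not_not.1 hn)
  have hEsmul : ∀ n (k : ℝ), c (n + 1) = k • c n → E (n + 1) = |k| * E n := by
    intro n k hk
    simp only [hE, hk, map_smul, sqrt_smul_dot_smul]
  refine ⟨√(b ⬝ᵥ b) + (√(a ⨯₃ b ⬝ᵥ a ⨯₃ b))⁻¹, fun n => |a ⨯₃ b ⬝ᵥ c n| / E n,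
    fun n => E n / √(c n ⬝ᵥ c n),
    fun n => toR (z n) ⬝ᵥ toR (z (n + 1)) ⨯₃ toR (z (n + 2)) ≠ 0, ?_⟩
  constructor
  · exact hα
  · exact hr₁
  · exact hr
  · exact hC
  · positivity
  · exact hX
  · exact hmono
  · exact htop
  · exact hlpos
  · exact antitone_nat_of_succ_le fun n => (hanti n).le
  · exact fun n => abs_nonneg _
  · exact hle
  · exact hb
  · intro n
    refine (abs_dotProduct_le b _).trans ?_
    rw [hnorm]
    have := zero_lt_one.trans_le (hX n)
    gcongr
    exact le_add_of_nonneg_right (by positivity)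
  · intro n hn
    have hdet : 1 ≤ |toR (z n) ⬝ᵥ toR (z (n + 1)) ⨯₃ toR (z (n + 2))| := by
      rw [toR_triple] at hn ⊢
      exact_mod_cast Int.one_le_abs (by exact_mod_cast hn)
    have h6 := sqrt_dot_cross_le a b _ _ _ hab hdet
    rw [hnorm, hnorm, hnorm] at h6
    calc (1 : ℝ) = (√(a ⨯₃ b ⬝ᵥ a ⨯₃ b))⁻¹ * √(a ⨯₃ b ⬝ᵥ a ⨯₃ b) := (inv_mul_cancel₀ hupos.ne').symm
      _ ≤ (√(b ⬝ᵥ b) + (√(a ⨯₃ b ⬝ᵥ a ⨯₃ b))⁻¹) * √(a ⨯₃ b ⬝ᵥ a ⨯₃ b) := by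
        gcongr
        exact le_add_of_nonneg_left (by positivity)
      _ ≤ _ := mul_le_mul_of_nonneg_left h6 (by positivity)
  · intro n hn
    obtain ⟨k, hk, hck⟩ := hsucc n hn
    simp only [hEsmul n k hck]
    rw [hck, dotProduct_smul, smul_eq_mul, abs_mul, mul_div_mul_left _ _ (abs_pos.2 hk).ne']
  · intro n
    have h1 := hEpos n
    calc |a ⨯₃ b ⬝ᵥ c n| / E n * (|a ⬝ᵥ toR (z n)| * enormZ (z (n + 1)))
        ≤ |a ⨯₃ b ⬝ᵥ c n| / E n * (2 * E n) :=
          mul_le_mul_of_nonneg_left (hle_E n) (by positivity)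
      _ = 2 * |a ⨯₃ b ⬝ᵥ c n| := by field_simp
      _ ≤ _ := by
        rw [hminor, ← abs_mul, ← abs_mul]
        gcongr
        exact abs_sub _ _
  · intro n
    have h1 := hEpos n
    calc _ ≤ |a ⨯₃ b ⬝ᵥ c n| := by
          rw [hminor, ← abs_mul, ← abs_mul]
          exact abs_sub_abs_le_abs_sub _ _
      _ = |a ⨯₃ b ⬝ᵥ c n| / E n * E n := by field_simp
      _ ≤ _ := by gcongr; exact hE_le n
  · intro n hn
    obtain ⟨k, hk, hck⟩ := hsucc n hn
    simp only [hEsmul n k hck]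
    rw [hck, sqrt_smul_dot_smul, mul_div_mul_left _ _ (abs_pos.2 hk).ne']
  · exact fun n => div_pos (hEpos n) (zero_lt_one.trans_le (hcone n))
  · exact fun n => (div_le_self (hEpos n).le (hcone n)).trans (hE_le n)

theorem infinite_of_two_le {a b : Fin 3 → ℝ} (hab : a ⨯₃ b ≠ 0)
    (ha : ∀ w : Fin 3 → ℤ, w ≠ 0 → 0 < |a ⬝ᵥ toR w|)
    {α r C : ℝ} (hα : 2 ≤ α) (hr₁ : 1 ≤ r) (hr : r < α ^ 2 - α + 1) (hC : 0 < C)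
    (happrox : ∀ t : ℝ, 1 ≤ t → ∃ w : Fin 3 → ℤ, w ≠ 0 ∧ enormZ w ≤ t ∧
      |a ⬝ᵥ toR w| ≤ C * t ^ (-α)) :
    {w : Fin 3 → ℤ | |a ⬝ᵥ toR w| ≤ |b ⬝ᵥ toR w| * enormZ w ^ (-r)}.Infinite := by
  intro hfin
  obtain ⟨M, hM⟩ := (hfin.image enormZ).bddAbove
  have hfail : ∀ w : Fin 3 → ℤ, w ≠ 0 → M < enormZ w →
      |b ⬝ᵥ toR w| ≤ |a ⬝ᵥ toR w| * enormZ w ^ r := by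
    intro w hw hlt
    by_contra! hcon
    have hpos : 0 < enormZ w := zero_lt_one.trans_le (one_le_enormZ hw)
    refine hlt.not_ge (hM (Set.mem_image_of_mem _ ?_))
    rw [Set.mem_ofPred_eq, Real.rpow_neg hpos.le, ← div_eq_mul_inv, le_div_iff₀ (by positivity)]
    exact hcon.le
  obtain ⟨z, hz, hanti, hmin⟩ := exists_minimal_points (fun w => |a ⬝ᵥ toR w|) (by
    intro ε hε
    have hlim := (tendsto_rpow_neg_atTop (by linarith : 0 < α)).const_mul C
    rw [mul_zero] at hlim
    obtain ⟨t, ht, ht1⟩ :=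
      ((hlim.eventually (gt_mem_nhds hε)).and (Filter.eventually_ge_atTop 1)).exists
    obtain ⟨w, hw, -, hle⟩ := happrox t ht1
    exact ⟨w, hw, hle.trans_lt ht⟩) ha
  have hinj : Function.Injective z :=
    (strictAnti_nat_of_succ_lt (f := (fun w => |a ⬝ᵥ toR w|) ∘ z) hanti).injective.of_comp
  have htop : Filter.Tendsto (fun n => enormZ (z n)) Filter.atTop Filter.atTop := by
    refine Filter.tendsto_atTop.2 fun B => ?_
    obtain ⟨N, hN⟩ := ((finite_enormZ_le B).preimage hinj.injOn).bddAbove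
    filter_upwards [Filter.eventually_gt_atTop N] with n hn
    by_contra! hlt
    exact hn.not_ge (hN hlt.le)
  obtain ⟨N, hN⟩ := Filter.eventually_atTop.1 (htop.eventually_gt_atTop (max M 2))
  have hmono : ∀ n, enormZ (z (n + 1)) ≤ enormZ (z (n + 2)) := fun n =>
    hmin n _ (hz _) ((hanti (n + 1)).trans (hanti n))
  obtain ⟨K, R, W, I, hsys⟩ := minimalSystem_of_minimal_points
    (z := fun n => z (n + (N + 1))) (C := C * 2 ^ α) hab ha hα hr₁ hr (by positivity)
    (fun n => hz _) (fun n => by simpa only [add_right_comm] using hanti (n + (N + 1)))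
    (fun n => by simpa only [add_right_comm] using hmin (n + (N + 1)))
    (monotone_nat_of_le_succ fun n => by
      have := hmono (n + N)
      rw [show n + 1 + (N + 1) = n + N + 2 by ring]
      exact this)
    (htop.comp (Filter.tendsto_add_atTop_nat (N + 1)))
    (fun n => by
      set Y := enormZ (z (n + 1 + (N + 1))) with hY
      have h2 : 2 < Y := (le_max_right M 2).trans_lt (hN _ (by omega))
      obtain ⟨w, hw, hwle, hwa⟩ := happrox (Y / 2) (by linarith)
      have hge : |a ⬝ᵥ toR (z (n + (N + 1)))| ≤ |a ⬝ᵥ toR w| := by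
        by_contra! hlt
        have := hmin _ w hw hlt
        rw [add_right_comm, ← hY] at this
        linarith
      refine hge.trans (hwa.trans_eq ?_)
      rw [Real.div_rpow (by linarith) zero_le_two, Real.rpow_neg zero_le_two, div_inv_eq_mul]
      ring)
    (fun n => hfail _ (hz _) ((le_max_left M 2).trans_lt (hN _ (by omega))))
  exact hsys.contradiction

end MinimalPoints

/-- Dirichlet's theorem for the linear form `x₀ + x₁ θ₁ + x₂ θ₂`. -/
lemma exists_Lform_le_rpow_neg_two (θ₁ θ₂ : ℝ) : ∃ C > 0, ∀ t : ℝ, 1 ≤ t →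
    ∃ z : Fin 3 → ℤ, z ≠ 0 ∧ enormZ z ≤ t ∧ |Lform θ₁ θ₂ (toR z)| ≤ C * t ^ (-2 : ℝ) := by
  set K : ℝ := |θ₁| + |θ₂| + 4 with hK
  have hK4 : 4 ≤ K := by rw [hK]; linarith [abs_nonneg θ₁, abs_nonneg θ₂]
  have hL : ∀ z : Fin 3 → ℤ, Lform θ₁ θ₂ (toR z) = z 0 + θ₁ * z 1 + θ₂ * z 2 := by
    intro z; simp [Lform, toR]
  refine ⟨4 * K ^ 2, by positivity, fun t ht => ?_⟩
  have ht0 : 0 < t := by linarith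
  have hpow : 4 * K ^ 2 * t ^ (-2 : ℝ) = (2 * K / t) ^ 2 := by
    rw [Real.rpow_neg ht0.le, Real.rpow_two]
    field_simp
    ring
  rw [hpow]
  rcases lt_or_ge t K with htK | htK
  · refine ⟨![1, 0, 0], by simp, by simpa [enormZ] using ht, ?_⟩
    rw [hL]
    simp only [Matrix.cons_val, Int.cast_one, Int.cast_zero, mul_zero, add_zero, abs_one]
    apply one_le_pow₀
    rw [one_le_div ht0]
    linarith
  set N : ℕ := ⌊t / K⌋₊ with hN
  have hN1 : 1 ≤ N := (Nat.one_le_floor_iff _).2 (by rwa [one_le_div (by linarith)])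
  have hNt : N * K ≤ t := by
    rw [← le_div_iff₀ (by linarith)]
    exact Nat.floor_le (by positivity)
  have htN : t ≤ 2 * K * N := by
    have h1 : t / K < N + 1 := Nat.lt_floor_add_one _
    have h2 : (1 : ℝ) ≤ N := by exact_mod_cast hN1
    rw [div_lt_iff₀ (by linarith)] at h1
    nlinarith
  have hNpos : (0 : ℝ) < N := by exact_mod_cast hN1
  have hN2pos : (0 : ℝ) < (N : ℝ) ^ 2 := by positivity
  let f : ℕ × ℕ → ℝ := fun q => θ₁ * q.1 + θ₂ * q.2
  obtain ⟨q, hq, q', hq', hne, heq⟩ := Finset.exists_ne_map_eq_of_card_lt_of_maps_to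
    (s := Finset.range (N + 1) ×ˢ Finset.range (N + 1)) (t := Finset.range (N ^ 2))
    (f := fun q => ⌊Int.fract (f q) * (N : ℝ) ^ 2⌋₊)
    (by rw [Finset.card_product, Finset.card_range, Finset.card_range]; nlinarith)
    (by
      intro q _
      simp only [Finset.coe_range, Set.mem_Iio]
      rw [Nat.floor_lt (mul_nonneg (Int.fract_nonneg _) hN2pos.le)]
      push_cast
      exact mul_lt_of_lt_one_left hN2pos (Int.fract_lt_one _))
  simp only [Finset.mem_product, Finset.mem_range] at hq hq'
  have hclose : |Int.fract (f q) - Int.fract (f q')| * (N : ℝ) ^ 2 ≤ 1 := by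
    rw [← abs_of_pos hN2pos, ← abs_mul, sub_mul]
    have h1 := Nat.floor_le (mul_nonneg (Int.fract_nonneg (f q)) hN2pos.le)
    have h2 := Nat.lt_floor_add_one (Int.fract (f q) * (N : ℝ) ^ 2)
    have h3 := Nat.floor_le (mul_nonneg (Int.fract_nonneg (f q')) hN2pos.le)
    have h4 := Nat.lt_floor_add_one (Int.fract (f q') * (N : ℝ) ^ 2)
    rw [heq] at h1 h2
    rw [abs_le]
    constructor <;> linarith
  have hfq : f q - f q' = θ₁ * ((q.1 : ℝ) - q'.1) + θ₂ * ((q.2 : ℝ) - q'.2) := by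
    simp only [f]; ring
  have hx1 : |(q.1 : ℝ) - q'.1| ≤ N := by
    have h1 : (q.1 : ℝ) ≤ N := by exact_mod_cast Nat.lt_succ_iff.1 hq.1
    have h2 : (q'.1 : ℝ) ≤ N := by exact_mod_cast Nat.lt_succ_iff.1 hq'.1
    rw [abs_le]
    constructor <;> linarith [Nat.cast_nonneg (α := ℝ) q.1, Nat.cast_nonneg (α := ℝ) q'.1]
  have hx2 : |(q.2 : ℝ) - q'.2| ≤ N := by
    have h1 : (q.2 : ℝ) ≤ N := by exact_mod_cast Nat.lt_succ_iff.1 hq.2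
    have h2 : (q'.2 : ℝ) ≤ N := by exact_mod_cast Nat.lt_succ_iff.1 hq'.2
    rw [abs_le]
    constructor <;> linarith [Nat.cast_nonneg (α := ℝ) q.2, Nat.cast_nonneg (α := ℝ) q'.2]
  have hfract : (⌊f q'⌋ - ⌊f q⌋ : ℝ) + (f q - f q') = Int.fract (f q) - Int.fract (f q') := by
    rw [Int.fract, Int.fract]; ring
  have hx0 : |(⌊f q'⌋ - ⌊f q⌋ : ℝ)| ≤ (|θ₁| + |θ₂| + 1) * N := by
    have h1 : |Int.fract (f q) - Int.fract (f q')| ≤ 1 := by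
      rw [abs_le]
      constructor <;> linarith [Int.fract_nonneg (f q), Int.fract_nonneg (f q'),
        Int.fract_lt_one (f q), Int.fract_lt_one (f q')]
    have h2 : |f q - f q'| ≤ |θ₁| * N + |θ₂| * N := by
      rw [hfq]
      refine (abs_add_le _ _).trans ?_
      rw [abs_mul, abs_mul]
      gcongr
    have h3 : (1 : ℝ) ≤ N := by exact_mod_cast hN1
    rw [eq_sub_of_add_eq hfract]
    linarith [abs_sub (Int.fract (f q) - Int.fract (f q')) (f q - f q')]
  refine ⟨![⌊f q'⌋ - ⌊f q⌋, (q.1 : ℤ) - q'.1, (q.2 : ℤ) - q'.2], ?_, ?_, ?_⟩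
  · intro h0
    have h1 := congrFun h0 1
    have h2 := congrFun h0 2
    simp only [Matrix.cons_val, Pi.zero_apply] at h1 h2
    exact hne (Prod.ext (by omega) (by omega))
  · rw [enormZ]
    simp only [Matrix.cons_val]
    push_cast
    refine le_trans (Real.sqrt_le_iff.2 ⟨by positivity, ?_⟩) hNt
    have s0 := sq_le_sq' (abs_le.1 hx0).1 (abs_le.1 hx0).2
    have s1 := sq_le_sq' (abs_le.1 hx1).1 (abs_le.1 hx1).2
    have s2 := sq_le_sq' (abs_le.1 hx2).1 (abs_le.1 hx2).2
    have hs : (|θ₁| + |θ₂| + 1) ^ 2 + 2 ≤ K ^ 2 := by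
      rw [hK]; nlinarith [abs_nonneg θ₁, abs_nonneg θ₂]
    nlinarith
  · rw [hL]
    simp only [Matrix.cons_val]
    push_cast
    rw [add_assoc, ← hfq, hfract]
    have h1 : |Int.fract (f q) - Int.fract (f q')| ≤ (1 / N) ^ 2 := by
      rw [one_div, inv_pow, ← one_div, le_div_iff₀ hN2pos]
      exact hclose
    refine h1.trans ?_
    gcongr 1
    rw [div_le_div_iff₀ hNpos ht0]
    linarith

open scoped Matrix in
lemma linearMap_apply_eq_dotProduct (F : (Fin 3 → ℝ) →ₗ[ℝ] ℝ) (v : Fin 3 → ℝ) :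
    F v = (fun i => F (Pi.single i 1)) ⬝ᵥ v := by
  rw [LinearMap.pi_apply_eq_sum_univ F v, dotProduct]
  refine Finset.sum_congr rfl fun i _ => ?_
  rw [smul_eq_mul, mul_comm]
  congr 2
  ext j
  simp [Pi.single_apply, eq_comm]

/-- If `1, θ₁, θ₂` are linearly independent over `ℤ`, `P` is a linear form independent of
`L(x) = x₀ + x₁θ₁ + x₂θ₂`, and `α > 0` is admissible for the uniform exponent of `L`
(witnessed by `C > 0`), then for every `r < α² − α + 1` there are infinitely many `x ∈ ℤ³`
with `|L(x)| ≤ |P(x)|·|x|^{−r}`. -/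
theorem two_linear_forms (θ₁ θ₂ : ℝ)
    (hind : ∀ a b c : ℤ, (a : ℝ) + (b : ℝ) * θ₁ + (c : ℝ) * θ₂ = 0 → a = 0 ∧ b = 0 ∧ c = 0)
    (P : (Fin 3 → ℝ) →ₗ[ℝ] ℝ)
    (hPL : LinearIndependent ℝ ![Lform θ₁ θ₂, P])
    (α C : ℝ) (hα : 0 < α) (hC : 0 < C)
    (happrox : ∀ t : ℝ, 1 ≤ t → ∃ z : Fin 3 → ℤ, z ≠ 0 ∧ enormZ z ≤ t ∧
      |Lform θ₁ θ₂ (toR z)| ≤ C * t ^ (-α))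
    (r : ℝ) (hr : r < α ^ 2 - α + 1) :
    {z : Fin 3 → ℤ | |Lform θ₁ θ₂ (toR z)| ≤ |P (toR z)| * enormZ z ^ (-r)}.Infinite := by
  set a : Fin 3 → ℝ := fun i => Lform θ₁ θ₂ (Pi.single i 1) with ha
  set b : Fin 3 → ℝ := fun i => P (Pi.single i 1) with hb
  have hLa : ∀ v, Lform θ₁ θ₂ v = a ⬝ᵥ v := linearMap_apply_eq_dotProduct _
  have hPb : ∀ v, P v = b ⬝ᵥ v := linearMap_apply_eq_dotProduct _
  have hab : crossProduct a b ≠ 0 := by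
    rw [crossProduct_ne_zero_iff_linearIndependent, LinearIndependent.pair_iff]
    intro s t hst
    refine LinearIndependent.pair_iff.1 hPL s t (LinearMap.ext fun v => ?_)
    rw [LinearMap.add_apply, LinearMap.smul_apply, LinearMap.smul_apply, hLa, hPb,
      ← smul_dotProduct, ← smul_dotProduct, ← add_dotProduct, hst, zero_dotProduct,
      LinearMap.zero_apply]
  have hpos : ∀ w : Fin 3 → ℤ, w ≠ 0 → 0 < |a ⬝ᵥ toR w| := by
    intro w hw
    rw [← hLa, abs_pos]
    intro h0
    obtain ⟨h1, h2, h3⟩ := hind (w 0) (w 1) (w 2) (by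
      rw [← h0]; simp [Lform, toR]; ring)
    exact hw (by ext i; fin_cases i <;> assumption)
  have hkey : ∀ β D : ℝ, 2 ≤ β → r < β ^ 2 - β + 1 → 0 < D →
      (∀ t : ℝ, 1 ≤ t → ∃ z : Fin 3 → ℤ, z ≠ 0 ∧ enormZ z ≤ t ∧
        |Lform θ₁ θ₂ (toR z)| ≤ D * t ^ (-β)) →
      {z : Fin 3 → ℤ | |Lform θ₁ θ₂ (toR z)| ≤ |P (toR z)| * enormZ z ^ (-r)}.Infinite := by
    intro β D hβ hrβ hD happ
    simp only [hLa] at happ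
    have hinf := infinite_of_two_le hab hpos hβ (le_max_right r 1)
      (max_lt hrβ (by nlinarith)) hD happ
    refine (hinf.sdiff (Set.finite_singleton 0)).mono ?_
    rintro w ⟨hw, hw0⟩
    rw [Set.mem_ofPred_eq, hLa, hPb]
    refine hw.trans ?_
    gcongr
    · exact one_le_enormZ hw0
    · exact le_max_left r 1
  rcases le_or_gt 2 α with h2 | h2
  · exact hkey α C h2 hr hC happrox
  · obtain ⟨D, hD, happ⟩ := exists_Lform_le_rpow_neg_two θ₁ θ₂
    exact hkey 2 D le_rfl (by nlinarith) hD happ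
end

section
/- Let θ be a real number that is neither rational nor a quadratic irrationality. Suppose α > 0 and C > 0 are such that for every real t ≥ 1 one has min{|x₀ + x₁θ + x₂θ²| : (x₀,x₁,x₂) ∈ ℤ³, 0 < |(x₀,x₁,x₂)| ≤ t} ≤ C·t^{−α}. Then for every real γ < α² − α + 1 there exist infinitely many real algebraic numbers ξ of degree at most 2 such that |θ − ξ| ≤ H(ξ)^{−γ}. (Consequently ω_*(θ) ≥ ω̂² − ω̂ + 1 where ω̂ = ω̂(θ, θ²).) -/
/-- The height `H(ξ)` of an algebraic number of degree at most `2`: the maximum of the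
absolute values of the coefficients of its canonical polynomial `p` (of degree at most `2`). -/
def heightZ (p : Polynomial ℤ) : ℤ :=
  max |p.coeff 0| (max |p.coeff 1| |p.coeff 2|)

/-- `p` is the canonical (minimal integer) polynomial of the real algebraic number `ξ` of
degree at most `2`:  it is nonzero of degree at most `2`, vanishes at `ξ`, is primitive with
positive leading coefficient, and has minimal degree among the nonzero integer polynomials
vanishing at `ξ`. -/
def IsCanonicalPoly (ξ : ℝ) (p : Polynomial ℤ) : Prop :=
  p ≠ 0 ∧ p.natDegree ≤ 2 ∧ Polynomial.aeval ξ p = 0 ∧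
    p.IsPrimitive ∧ 0 < p.leadingCoeff ∧
    ∀ q : Polynomial ℤ, q ≠ 0 → Polynomial.aeval ξ q = 0 → p.degree ≤ q.degree

namespace QuadraticApprox

open Polynomial

/-- The value at `θ` of the polynomial with coefficient vector `v`. -/
noncomputable def form (θ : ℝ) (v : Fin 3 → ℤ) : ℝ :=
  (v 0 : ℝ) + (v 1 : ℝ) * θ + (v 2 : ℝ) * θ ^ 2

/-- The value at `θ` of the derivative of the polynomial with coefficient vector `v`. -/
noncomputable def derivForm (θ : ℝ) (v : Fin 3 → ℤ) : ℝ :=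
  (v 1 : ℝ) + 2 * (v 2 : ℝ) * θ

/-- The sup norm of an integer vector. -/
def supNorm (v : Fin 3 → ℤ) : ℕ :=
  max (v 0).natAbs (max (v 1).natAbs (v 2).natAbs)

lemma natAbs_le_supNorm (v : Fin 3 → ℤ) (i : Fin 3) : (v i).natAbs ≤ supNorm v := by
  fin_cases i <;> simp [supNorm]

lemma abs_le_supNorm (v : Fin 3 → ℤ) (i : Fin 3) : |(v i : ℝ)| ≤ supNorm v := by
  have h := natAbs_le_supNorm v i
  rw [← Int.cast_abs, Int.abs_eq_natAbs]
  exact_mod_cast h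

lemma ne_zero_iff {v : Fin 3 → ℤ} : v ≠ 0 ↔ v 0 ≠ 0 ∨ v 1 ≠ 0 ∨ v 2 ≠ 0 := by
  rw [Ne, funext_iff, Fin.forall_fin_succ, Fin.forall_fin_succ, Fin.forall_fin_succ]
  simp
  tauto

lemma supNorm_pos {v : Fin 3 → ℤ} (hv : v ≠ 0) : 0 < supNorm v := by
  rw [ne_zero_iff] at hv
  unfold supNorm
  omega

lemma supNorm_le_iff {v : Fin 3 → ℤ} {n : ℕ} :
    supNorm v ≤ n ↔ ∀ i, (v i).natAbs ≤ n := by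
  simp [supNorm, Fin.forall_fin_succ]

/-- A quadratic whose value at `0` is small compared with its derivative has a root near `0`. -/
lemma exists_small_root {L D e : ℝ} (hD : D ≠ 0) (h : 4 * |e| * |L| ≤ D ^ 2) :
    ∃ x : ℝ, L + D * x + e * x ^ 2 = 0 ∧ |x| ≤ 2 * |L| / |D| := by
  wlog hpos : 0 < D generalizing L D e
  · obtain ⟨x, hx, hx'⟩ := @this (-L) (-D) (-e) (by simpa using hD) (by simpa using h)
      (by have := lt_of_le_of_ne (not_lt.mp hpos) hD; linarith)
    exact ⟨x, by linarith, by simpa using hx'⟩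
  have hdisc : 0 ≤ D ^ 2 - 4 * e * L := by
    have h1 : e * L ≤ |e| * |L| := by rw [← abs_mul]; exact le_abs_self _
    nlinarith
  set s := Real.sqrt (D ^ 2 - 4 * e * L) with hs
  have hs0 : 0 ≤ s := Real.sqrt_nonneg _
  have hs2 : s ^ 2 = D ^ 2 - 4 * e * L := Real.sq_sqrt hdisc
  have hq : D + s ≠ 0 := by positivity
  refine ⟨-2 * L / (D + s), ?_, ?_⟩
  · field_simp
    linear_combination L * hs2
  · rw [abs_div, abs_mul, abs_neg, abs_two, abs_of_pos hpos, abs_of_pos (by positivity : 0 < D + s)]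
    gcongr
    linarith

lemma isCanonicalPoly_rat {a b : ℤ} (hb : 0 < b) (hab : IsCoprime a b) {ξ : ℝ}
    (hξ : (b : ℝ) * ξ = a) : IsCanonicalPoly ξ (C b * X + C (-a)) := by
  have hdeg : (C b * X + C (-a) : ℤ[X]).natDegree = 1 := natDegree_linear hb.ne'
  have hne : (C b * X + C (-a) : ℤ[X]) ≠ 0 := by
    intro h
    rw [h] at hdeg
    simp at hdeg
  refine ⟨hne, by omega, by simp [hξ], ?_, ?_, ?_⟩
  · rw [isPrimitive_iff_isUnit_of_C_dvd]
    intro r hr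
    rw [C_dvd_iff_dvd_coeff] at hr
    have h0 := hr 0
    have h1 := hr 1
    simp [coeff_C, -eq_intCast] at h0 h1
    exact hab.isUnit_of_dvd' h0 h1
  · rw [leadingCoeff, hdeg]
    simpa [coeff_C, -eq_intCast] using hb
  · intro q hq hq0
    rw [degree_eq_natDegree hne, hdeg, degree_eq_natDegree hq]
    by_contra! hlt
    have hq' : q.natDegree = 0 := by
      have : q.natDegree < 1 := by exact_mod_cast hlt
      omega
    rw [eq_C_of_natDegree_eq_zero hq'] at hq0 hq
    simp at hq0
    simp [hq0] at hq

lemma heightZ_pos {p : ℤ[X]} (hp : p ≠ 0) (hdeg : p.natDegree ≤ 2) : 0 < heightZ p := by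
  have h := abs_pos.mpr (leadingCoeff_ne_zero.mpr hp)
  rw [leadingCoeff] at h
  unfold heightZ
  interval_cases p.natDegree <;> simp only [lt_max_iff] <;> tauto

/-- The numerator and denominator of a rational root divide extreme coefficients. -/
lemma abs_le_supNorm_of_root {v : Fin 3 → ℤ} (hv : v ≠ 0) {a b : ℤ} (hden : 0 < b)
    (hcop : IsCoprime a b) (key : v 0 * b ^ 2 + v 1 * a * b + v 2 * a ^ 2 = 0) :
    |a| ≤ supNorm v ∧ |b| ≤ supNorm v := by
  have le_of_dvd : ∀ (x : ℤ) (i : Fin 3), v i ≠ 0 → x ∣ v i → |x| ≤ supNorm v := by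
    intro x i hi hx
    have h1 := Int.natAbs_le_of_dvd_ne_zero hx hi
    have h2 := natAbs_le_supNorm v i
    rw [Int.abs_eq_natAbs]
    omega
  have hb2 : b ∣ v 2 := by
    have : b ∣ v 2 * a ^ 2 := ⟨-(v 0 * b + v 1 * a), by linear_combination key⟩
    exact (hcop.symm.pow_right).dvd_of_dvd_mul_right this
  have ha0 : a ∣ v 0 := by
    have : a ∣ v 0 * b ^ 2 := ⟨-(v 1 * b + v 2 * a), by linear_combination key⟩
    exact (hcop.pow_right).dvd_of_dvd_mul_right this
  have hbb : |b| ≤ supNorm v := by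
    by_cases h2 : v 2 = 0
    · have h3 : v 0 * b + v 1 * a = 0 := by
        have : b * (v 0 * b + v 1 * a) = 0 := by rw [h2] at key; linear_combination key
        exact (mul_eq_zero.mp this).resolve_left hden.ne'
      have hb1 : b ∣ v 1 :=
        hcop.symm.dvd_of_dvd_mul_right ⟨-v 0, by linear_combination h3⟩
      refine le_of_dvd b 1 (fun h1 => ?_) hb1
      rw [h1] at h3
      have h0 : v 0 = 0 := by
        have : v 0 * b = 0 := by linear_combination h3
        exact (mul_eq_zero.mp this).resolve_right hden.ne'
      rw [ne_zero_iff] at hv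
      tauto
    · exact le_of_dvd b 2 h2 hb2
  have haa : |a| ≤ supNorm v := by
    by_cases ha : a = 0
    · rw [ha]; simp
    by_cases h0 : v 0 = 0
    · have h3 : v 1 * b + v 2 * a = 0 := by
        have : a * (v 1 * b + v 2 * a) = 0 := by rw [h0] at key; linear_combination key
        exact (mul_eq_zero.mp this).resolve_left ha
      have ha1 : a ∣ v 1 :=
        hcop.dvd_of_dvd_mul_right ⟨-v 2, by linear_combination h3⟩
      refine le_of_dvd a 1 (fun h1 => ?_) ha1
      rw [h1] at h3
      have h2 : v 2 = 0 := by
        have : v 2 * a = 0 := by linear_combination h3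
        exact (mul_eq_zero.mp this).resolve_right ha
      rw [ne_zero_iff] at hv
      tauto
    · exact le_of_dvd a 0 h0 ha0
  exact ⟨haa, hbb⟩

/-- A real root of a nonzero integer polynomial of degree at most `2` has a canonical polynomial
of no larger height. -/
lemma exists_isCanonicalPoly {v : Fin 3 → ℤ} (hv : v ≠ 0) {ξ : ℝ} (hξ : form ξ v = 0) :
    ∃ p : ℤ[X], IsCanonicalPoly ξ p ∧ heightZ p ≤ supNorm v := by
  by_cases hrat : ∃ r : ℚ, (r : ℝ) = ξ
  · obtain ⟨r, rfl⟩ := hrat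
    have hden : (0 : ℤ) < r.den := by exact_mod_cast r.den_pos
    have hnd : (r.den : ℝ) * r = r.num := by exact_mod_cast Rat.den_mul_eq_num r
    refine ⟨_, isCanonicalPoly_rat (a := r.num) (b := (r.den : ℤ)) hden ?_ ?_, ?_⟩
    · exact Rat.isCoprime_num_den r
    · exact_mod_cast hnd
    · have key : v 0 * (r.den : ℤ) ^ 2 + v 1 * r.num * r.den + v 2 * r.num ^ 2 = 0 := by
        have : (v 0 : ℝ) * r.den ^ 2 + v 1 * r.num * r.den + v 2 * r.num ^ 2 = 0 := by
          unfold form at hξ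
          rw [← hnd]
          linear_combination (r.den : ℝ) ^ 2 * hξ
        exact_mod_cast this
      obtain ⟨haa, hbb⟩ := abs_le_supNorm_of_root hv hden (Rat.isCoprime_num_den r) key
      unfold heightZ
      simp only [coeff_add, coeff_C_mul, coeff_X, coeff_C]
      rw [Nat.abs_cast, Nat.cast_le] at hbb
      simpa using ⟨haa, hbb⟩
  · set P : ℤ[X] := C (v 2) * X ^ 2 + C (v 1) * X + C (v 0) with hP
    have hc0 : P.coeff 0 = v 0 := by simp [hP]
    have hc1 : P.coeff 1 = v 1 := by
      simp only [hP, coeff_add, coeff_C_mul, coeff_X_pow, coeff_X, coeff_C]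
      norm_num
    have hc2 : P.coeff 2 = v 2 := by
      simp only [hP, coeff_add, coeff_C_mul, coeff_X_pow, coeff_X, coeff_C]
      norm_num
    have hP0 : aeval ξ P = 0 := by
      simp [hP]; unfold form at hξ; linear_combination hξ
    have hlow : ∀ q : ℤ[X], q ≠ 0 → aeval ξ q = 0 → 2 ≤ q.natDegree := by
      intro q hq hq0
      by_contra! hlt
      rw [eq_X_add_C_of_natDegree_le_one (by omega : q.natDegree ≤ 1)] at hq0 hq
      simp at hq0
      by_cases h1 : q.coeff 1 = 0
      · simp [h1] at hq0 hq
        exact hq hq0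
      · have h1' : (q.coeff 1 : ℝ) ≠ 0 := by exact_mod_cast h1
        apply hrat
        refine ⟨-(q.coeff 0 : ℚ) / q.coeff 1, ?_⟩
        push_cast
        field_simp
        linear_combination -hq0
    have hPne : P ≠ 0 := by
      rw [ne_zero_iff] at hv
      intro h
      rw [h] at hc0 hc1 hc2
      simp at hc0 hc1 hc2
      tauto
    have hPdeg : P.natDegree = 2 :=
      le_antisymm (by rw [hP]; exact natDegree_quadratic_le) (hlow P hPne hP0)
    have hQ0 : aeval ξ P.primPart = 0 := aeval_primPart_eq_zero hPne hP0
    have hQne : P.primPart ≠ 0 := P.isPrimitive_primPart.ne_zero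
    have hQdeg : P.primPart.natDegree = 2 := by rw [natDegree_primPart, hPdeg]
    have hcoef : ∀ k, |P.primPart.coeff k| ≤ |P.coeff k| := by
      intro k
      conv_rhs => rw [P.eq_C_content_mul_primPart, coeff_C_mul, abs_mul]
      have : 1 ≤ |P.content| := Int.one_le_abs (by rwa [Ne, content_eq_zero_iff])
      nlinarith [abs_nonneg (P.primPart.coeff k)]
    have hheight : max |P.primPart.coeff 0| (max |P.primPart.coeff 1| |P.primPart.coeff 2|)
        ≤ supNorm v := by
      have h0 := hcoef 0
      have h1 := hcoef 1
      have h2 := hcoef 2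
      rw [hc0] at h0
      rw [hc1] at h1
      rw [hc2] at h2
      have := natAbs_le_supNorm v 0
      have := natAbs_le_supNorm v 1
      have := natAbs_le_supNorm v 2
      simp only [max_le_iff]
      rw [Int.abs_eq_natAbs (v _)] at h0 h1 h2
      omega
    have hmin : ∀ q : ℤ[X], q ≠ 0 → aeval ξ q = 0 → P.primPart.degree ≤ q.degree := by
      intro q hq hq0
      rw [degree_eq_natDegree hQne, degree_eq_natDegree hq, hQdeg]
      exact_mod_cast hlow q hq hq0
    rcases lt_or_gt_of_ne (leadingCoeff_ne_zero.mpr hQne) with hneg | hpos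
    · refine ⟨-P.primPart, ⟨neg_ne_zero.mpr hQne, by simp [hQdeg], by simp [hQ0], ?_,
        by simpa using hneg, by simpa using hmin⟩, by simpa [heightZ] using hheight⟩
      have := P.isPrimitive_primPart
      rw [isPrimitive_iff_isUnit_of_C_dvd] at this ⊢
      exact fun r hr => this r (by simpa using hr)
    · exact ⟨P.primPart, ⟨hQne, hQdeg.le, hQ0, P.isPrimitive_primPart, hpos, hmin⟩, hheight⟩

/-- If `θ` has only finitely many good quadratic approximations, then the derivative at `θ` of
an integer polynomial of degree at most `2` is controlled by its value at `θ`. -/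
lemma exists_derivForm_le {θ γ : ℝ} (hγ : 0 ≤ γ) (hθ : ∀ v : Fin 3 → ℤ, v ≠ 0 → form θ v ≠ 0)
    (hfin : {ξ : ℝ | ∃ p : ℤ[X], IsCanonicalPoly ξ p ∧
      |θ - ξ| ≤ (heightZ p : ℝ) ^ (-γ)}.Finite) :
    ∃ K : ℝ, 0 < K ∧ ∀ v : Fin 3 → ℤ, v ≠ 0 →
      |derivForm θ v| ≤ K * (|form θ v| * (supNorm v : ℝ) ^ γ + √(supNorm v * |form θ v|)) := by
  set S := {ξ : ℝ | ∃ p : ℤ[X], IsCanonicalPoly ξ p ∧ |θ - ξ| ≤ (heightZ p : ℝ) ^ (-γ)}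
  obtain ⟨δ, hδ, hδS⟩ : ∃ δ > 0, ∀ ξ ∈ S, ξ ≠ θ → δ ≤ |θ - ξ| := by
    rcases S.eq_empty_or_nonempty with h | h
    · exact ⟨1, one_pos, by simp [h]⟩
    have hfin' : (S \ {θ}).Finite := hfin.subset Set.sdiff_subset
    have hev : ∀ᶠ x in nhds θ, x ∉ S \ {θ} :=
      hfin'.isClosed.isOpen_compl.mem_nhds (by simp)
    obtain ⟨δ, hδ, hball⟩ := Metric.eventually_nhds_iff.mp hev
    refine ⟨δ, hδ, fun ξ hξ hne => ?_⟩
    by_contra! hlt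
    exact hball (y := ξ) (by rwa [Real.dist_eq, abs_sub_comm])
      ⟨hξ, hne⟩
  refine ⟨2 + 2 / δ, by positivity, fun v hv => ?_⟩
  have hM : (1 : ℝ) ≤ supNorm v := by exact_mod_cast supNorm_pos hv
  have hMγ : 1 ≤ (supNorm v : ℝ) ^ γ := Real.one_le_rpow hM hγ
  have hsq : 0 ≤ √(supNorm v * |form θ v|) := Real.sqrt_nonneg _
  have hL : 0 ≤ |form θ v| := abs_nonneg _
  have hd : 0 < 2 / δ := by positivity
  by_cases hD : derivForm θ v = 0
  · rw [hD, abs_zero]; positivity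
  have hDpos : 0 < |derivForm θ v| := abs_pos.mpr hD
  by_cases hdisc : 4 * |(v 2 : ℝ)| * |form θ v| ≤ derivForm θ v ^ 2
  · obtain ⟨x, hx, hxle⟩ := exists_small_root hD hdisc
    have hroot : form (θ + x) v = 0 := by
      rw [← hx]; unfold form derivForm; ring
    obtain ⟨p, hp, hheight⟩ := exists_isCanonicalPoly hv hroot
    have hx1 : |θ - (θ + x)| = |x| := by simp
    rw [le_div_iff₀ hDpos] at hxle
    by_cases hmem : θ + x ∈ S
    · have h1 := hδS _ hmem (fun h => hθ v hv (by rw [← hroot, h]))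
      rw [hx1] at h1
      have h2 : |derivForm θ v| ≤ 2 / δ * |form θ v| := by
        rw [div_mul_eq_mul_div, le_div_iff₀ hδ]
        nlinarith
      have h3 : |form θ v| ≤ |form θ v| * (supNorm v : ℝ) ^ γ := le_mul_of_one_le_right hL hMγ
      nlinarith [mul_nonneg hd.le hsq]
    · have h1 : (supNorm v : ℝ) ^ (-γ) < |x| := by
        have hpos : (0 : ℝ) < heightZ p := by exact_mod_cast heightZ_pos hp.1 hp.2.1
        have h2 : (supNorm v : ℝ) ^ (-γ) ≤ (heightZ p : ℝ) ^ (-γ) :=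
          Real.rpow_le_rpow_of_nonpos hpos (by exact_mod_cast hheight) (by linarith)
        refine h2.trans_lt ?_
        by_contra! hle
        exact hmem ⟨p, hp, by rwa [hx1]⟩
      rw [Real.rpow_neg (by positivity)] at h1
      have h2 : 1 < |x| * (supNorm v : ℝ) ^ γ := by
        rwa [inv_lt_iff_one_lt_mul₀ (by positivity)] at h1
      have h3 : |derivForm θ v| ≤ 2 * (|form θ v| * (supNorm v : ℝ) ^ γ) := by
        calc |derivForm θ v| ≤ |derivForm θ v| * (|x| * (supNorm v : ℝ) ^ γ) :=
              le_mul_of_one_le_right hDpos.le h2.le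
          _ = |x| * |derivForm θ v| * (supNorm v : ℝ) ^ γ := by ring
          _ ≤ 2 * |form θ v| * (supNorm v : ℝ) ^ γ := by gcongr
          _ = _ := by ring
      have : 0 ≤ 2 / δ * (|form θ v| * (supNorm v : ℝ) ^ γ) := by positivity
      nlinarith [mul_nonneg hd.le hsq]
  · push Not at hdisc
    have h1 : |derivForm θ v| ≤ 2 * √(supNorm v * |form θ v|) := by
      apply abs_le_of_sq_le_sq _ (by positivity)
      rw [mul_pow, Real.sq_sqrt (by positivity)]
      have := mul_le_mul_of_nonneg_right (abs_le_supNorm v 2) hL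
      linarith
    have : 0 ≤ (2 + 2 / δ) * (|form θ v| * (supNorm v : ℝ) ^ γ) := by positivity
    nlinarith [mul_nonneg hd.le hsq]

/-- The cross product of two integer vectors. -/
def cross (u v : Fin 3 → ℤ) : Fin 3 → ℤ :=
  ![u 1 * v 2 - u 2 * v 1, u 2 * v 0 - u 0 * v 2, u 0 * v 1 - u 1 * v 0]

/-- The determinant of three integer vectors. -/
def det3 (u v w : Fin 3 → ℤ) : ℤ :=
  cross u v 0 * w 0 + cross u v 1 * w 1 + cross u v 2 * w 2

lemma det3_eq (u v w : Fin 3 → ℤ) : det3 u v w = (u 1 * v 2 - u 2 * v 1) * w 0 +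
    (u 2 * v 0 - u 0 * v 2) * w 1 + (u 0 * v 1 - u 1 * v 0) * w 2 := rfl

lemma cross_parallel {a b u v : Fin 3 → ℤ} (hu : det3 a b u = 0) (hv : det3 a b v = 0)
    (i j : Fin 3) : cross u v i * cross a b j = cross u v j * cross a b i := by
  unfold det3 at hu hv
  fin_cases i <;> fin_cases j <;> simp [cross] at hu hv ⊢
  · linear_combination v 2 * hu - u 2 * hv
  · linear_combination u 1 * hv - v 1 * hu
  · linear_combination u 2 * hv - v 2 * hu
  · linear_combination v 0 * hu - u 0 * hv
  · linear_combination v 1 * hu - u 1 * hv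
  · linear_combination u 0 * hv - v 0 * hu

lemma exists_combination {u v w : Fin 3 → ℤ} (huv : cross u v ≠ 0) (h : det3 u v w = 0) :
    ∃ A B : ℝ, ∀ i, (w i : ℝ) = A * u i + B * v i := by
  have hR : ((u 1 : ℝ) * v 2 - u 2 * v 1) * w 0 + (u 2 * v 0 - u 0 * v 2) * w 1 +
      (u 0 * v 1 - u 1 * v 0) * w 2 = 0 := by
    rw [det3_eq] at h
    exact_mod_cast h
  rw [ne_zero_iff] at huv
  simp only [cross, Matrix.cons_val] at huv
  rcases huv with h0 | h0 | h0
  · have h0' : (u 1 : ℝ) * v 2 - u 2 * v 1 ≠ 0 := by exact_mod_cast h0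
    refine ⟨(w 1 * v 2 - w 2 * v 1) / (u 1 * v 2 - u 2 * v 1),
      (u 1 * w 2 - u 2 * w 1) / (u 1 * v 2 - u 2 * v 1), fun i => ?_⟩
    rw [← mul_right_inj' h0']
    field_simp
    fin_cases i <;> simp
    · linear_combination hR
    · ring
    · ring
  · have h0' : (u 2 : ℝ) * v 0 - u 0 * v 2 ≠ 0 := by exact_mod_cast h0
    refine ⟨(w 2 * v 0 - w 0 * v 2) / (u 2 * v 0 - u 0 * v 2),
      (u 2 * w 0 - u 0 * w 2) / (u 2 * v 0 - u 0 * v 2), fun i => ?_⟩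
    rw [← mul_right_inj' h0']
    field_simp
    fin_cases i <;> simp
    · ring
    · linear_combination hR
    · ring
  · have h0' : (u 0 : ℝ) * v 1 - u 1 * v 0 ≠ 0 := by exact_mod_cast h0
    refine ⟨(w 0 * v 1 - w 1 * v 0) / (u 0 * v 1 - u 1 * v 0),
      (u 0 * w 1 - u 1 * w 0) / (u 0 * v 1 - u 1 * v 0), fun i => ?_⟩
    rw [← mul_right_inj' h0']
    field_simp
    fin_cases i <;> simp
    · ring
    · ring
    · linear_combination hR

lemma exists_abs_eq_supNorm (v : Fin 3 → ℤ) : ∃ i, (supNorm v : ℝ) = |(v i : ℝ)| := by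
  have h : ∃ i, supNorm v = (v i).natAbs := by
    unfold supNorm
    rcases max_choice (v 0).natAbs (max (v 1).natAbs (v 2).natAbs) with h | h
    · exact ⟨0, h⟩
    · rcases max_choice (v 1).natAbs (v 2).natAbs with h' | h'
      · exact ⟨1, h.trans h'⟩
      · exact ⟨2, h.trans h'⟩
  obtain ⟨i, hi⟩ := h
  exact ⟨i, by rw [hi, Nat.cast_natAbs, Int.cast_abs]⟩

lemma finite_supNorm_le (n : ℕ) : {v : Fin 3 → ℤ | supNorm v ≤ n}.Finite := by
  refine (Set.finite_Icc (fun _ => -(n : ℤ)) (fun _ => (n : ℤ))).subset fun v hv => ?_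
  rw [Set.mem_ofPred_eq, supNorm_le_iff] at hv
  constructor <;> intro i <;> have := hv i <;> simp only <;> omega

lemma form_sub (θ : ℝ) (u v : Fin 3 → ℤ) : form θ (u - v) = form θ u - form θ v := by
  simp [form]; ring

/-- Dirichlet's theorem for the linear form `x₀ + x₁ θ + x₂ θ²`. -/
lemma dirichlet (θ : ℝ) : ∃ C : ℝ, 0 < C ∧ ∀ N : ℕ, 1 ≤ N → ∃ v : Fin 3 → ℤ, v ≠ 0 ∧
    supNorm v ≤ N ∧ |form θ v| ≤ C * (N : ℝ) ^ (-2 : ℝ) := by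
  set k : ℝ := 1 + |θ| + θ ^ 2 with hk
  have hk0 : 0 < k := by positivity
  refine ⟨2 * k, by positivity, fun N hN => ?_⟩
  have hN0 : (0 : ℝ) < N := by exact_mod_cast hN
  set s : Finset (Fin 3 → ℤ) := Fintype.piFinset fun _ => Finset.Icc 0 (N : ℤ)
  set t : Finset ℤ := Finset.Icc 0 ((N : ℤ) ^ 3)
  set f : (Fin 3 → ℤ) → ℤ := fun v => ⌊form θ v * N ^ 2 / (2 * k) + N ^ 3 / 2⌋ with hf
  have hcard : t.card < s.card := by
    have hs : s.card = (N + 1) ^ 3 := by simp [s, Fintype.card_piFinset]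
    have ht : t.card = N ^ 3 + 1 := by
      simp only [t, Int.card_Icc]
      have : (N : ℤ) ^ 3 + 1 - 0 = ((N ^ 3 + 1 : ℕ) : ℤ) := by push_cast; ring
      rw [this, Int.toNat_natCast]
    rw [hs, ht]
    nlinarith
  have hmaps : ∀ v ∈ s, f v ∈ t := by
    intro v hv
    rw [Fintype.mem_piFinset] at hv
    have hb : ∀ i, |(v i : ℝ)| ≤ N := by
      intro i
      have := Finset.mem_Icc.mp (hv i)
      rw [abs_of_nonneg (by exact_mod_cast this.1)]
      exact_mod_cast this.2
    have hform : |form θ v| ≤ k * N := by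
      unfold form
      calc _ ≤ |(v 0 : ℝ)| + |(v 1 : ℝ)| * |θ| + |(v 2 : ℝ)| * θ ^ 2 := by
            refine (abs_add_le _ _).trans ?_
            refine add_le_add ((abs_add_le _ _).trans ?_) ?_
            · rw [abs_mul]
            · rw [abs_mul, abs_of_nonneg (sq_nonneg θ)]
        _ ≤ N + N * |θ| + N * θ ^ 2 := by gcongr <;> exact hb _
        _ = k * N := by rw [hk]; ring
    have hq : |form θ v * N ^ 2 / (2 * k)| ≤ (N : ℝ) ^ 3 / 2 := by
      rw [abs_div, abs_mul, abs_of_pos (by positivity : 0 < 2 * k),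
        abs_of_pos (by positivity : (0 : ℝ) < N ^ 2), div_le_iff₀ (by positivity)]
      calc |form θ v| * N ^ 2 ≤ k * N * N ^ 2 := by gcongr
        _ = _ := by ring
    rw [abs_le] at hq
    refine Finset.mem_Icc.mpr ⟨Int.floor_nonneg.mpr (by linarith), ?_⟩
    have : (f v : ℝ) ≤ ((N : ℤ) ^ 3 : ℤ) := by
      push_cast
      exact (Int.floor_le _).trans (by linarith)
    exact_mod_cast this
  obtain ⟨u, hu, v, hv, huv, hfuv⟩ := Finset.exists_ne_map_eq_of_card_lt_of_maps_to hcard hmaps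
  refine ⟨u - v, sub_ne_zero.mpr huv, ?_, ?_⟩
  · rw [supNorm_le_iff]
    intro i
    have h1 := Finset.mem_Icc.mp (Fintype.mem_piFinset.mp hu i)
    have h2 := Finset.mem_Icc.mp (Fintype.mem_piFinset.mp hv i)
    simp only [Pi.sub_apply]
    omega
  · have h := (Int.abs_sub_lt_one_of_floor_eq_floor hfuv).le
    have h' : |form θ (u - v)| * N ^ 2 / (2 * k) ≤ 1 := by
      rw [form_sub]
      calc _ = |(form θ u - form θ v) * N ^ 2 / (2 * k)| := by
            rw [abs_div, abs_mul, abs_of_pos (by positivity : 0 < 2 * k),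
              abs_of_pos (by positivity : (0 : ℝ) < N ^ 2)]
        _ = |form θ u * N ^ 2 / (2 * k) + N ^ 3 / 2 -
              (form θ v * N ^ 2 / (2 * k) + N ^ 3 / 2)| := by congr 1; ring
        _ ≤ 1 := h
    rw [div_le_one (by positivity)] at h'
    rw [Real.rpow_neg hN0.le, Real.rpow_two, ← div_eq_mul_inv, le_div_iff₀ (by positivity)]
    exact h'

/-- A sequence of integer vectors that realizes a uniform exponent `α` of the linear form. -/
structure IsApproxSeq (θ α C : ℝ) (z : ℕ → Fin 3 → ℤ) : Prop where
  ne_zero : ∀ n, z n ≠ 0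
  strictMono : StrictMono fun n => supNorm (z n)
  half : ∀ n, |form θ (z (n + 1))| ≤ |form θ (z n)| / 2
  le : ∀ n, |form θ (z n)| ≤ C * (supNorm (z (n + 1)) : ℝ) ^ (-α)

lemma exists_minimal_le {θ α C ε : ℝ} (hα : 0 < α) (hC : 0 < C) (hε : 0 < ε)
    (happ : ∀ N : ℕ, 1 ≤ N → ∃ v : Fin 3 → ℤ, v ≠ 0 ∧ supNorm v ≤ N ∧
      |form θ v| ≤ C * (N : ℝ) ^ (-α)) :
    ∃ w : Fin 3 → ℤ, w ≠ 0 ∧ |form θ w| ≤ ε ∧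
      (∀ v, v ≠ 0 → supNorm v ≤ supNorm w → |form θ w| ≤ |form θ v|) ∧
      (2 ≤ supNorm w → ε ≤ 2 ^ α * C * (supNorm w : ℝ) ^ (-α)) := by
  classical
  have hex : ∃ n : ℕ, ∃ v : Fin 3 → ℤ, v ≠ 0 ∧ supNorm v ≤ n ∧ |form θ v| ≤ ε := by
    have hlim : Filter.Tendsto (fun n : ℕ => C * (n : ℝ) ^ (-α)) Filter.atTop (nhds 0) := by
      simpa using ((tendsto_rpow_neg_atTop hα).comp tendsto_natCast_atTop_atTop).const_mul C
    obtain ⟨n, hn, hn1⟩ :=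
      ((hlim.eventually (ge_mem_nhds hε)).and (Filter.eventually_ge_atTop 1)).exists
    obtain ⟨v, hv, hvn, hvf⟩ := happ n hn1
    exact ⟨n, v, hv, hvn, hvf.trans hn⟩
  obtain ⟨v, hv, hvn, hvε⟩ := Nat.find_spec hex
  have hmin := fun m (hm : m < Nat.find hex) => Nat.find_min hex hm
  set n := Nat.find hex
  have hfin : {v : Fin 3 → ℤ | v ≠ 0 ∧ supNorm v ≤ n}.Finite :=
    (finite_supNorm_le n).subset fun v hv => hv.2
  obtain ⟨w, ⟨hw, hwn⟩, hwmin⟩ :=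
    Set.exists_min_image _ (fun v => |form θ v|) hfin ⟨v, hv, hvn⟩
  have hwε : |form θ w| ≤ ε := (hwmin v ⟨hv, hvn⟩).trans hvε
  have hwn' : supNorm w = n := by
    by_contra hne
    exact hmin _ (lt_of_le_of_ne hwn hne) ⟨w, hw, le_rfl, hwε⟩
  refine ⟨w, hw, hwε, fun v hv hvw => hwmin v ⟨hv, hvw.trans hwn⟩, fun h2 => ?_⟩
  rw [hwn'] at h2 ⊢
  obtain ⟨x, hx, hxn, hxf⟩ := happ (n - 1) (by omega)
  have hxε : ε < |form θ x| := by
    by_contra! hle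
    exact hmin (n - 1) (by omega) ⟨x, hx, hxn, hle⟩
  have hn : (n : ℝ) / 2 ≤ (n - 1 : ℕ) := by
    rw [Nat.cast_sub (by omega)]
    have : (2 : ℝ) ≤ n := by exact_mod_cast h2
    push_cast
    linarith
  have hn0 : (0 : ℝ) < n := by exact_mod_cast (by omega : 0 < n)
  calc ε ≤ C * ((n - 1 : ℕ) : ℝ) ^ (-α) := hxε.le.trans hxf
    _ ≤ C * ((n : ℝ) / 2) ^ (-α) := by
        gcongr C * ?_
        exact Real.rpow_le_rpow_of_nonpos (by positivity) hn (by linarith)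
    _ = _ := by
        rw [Real.div_rpow hn0.le (by norm_num), Real.rpow_neg (by norm_num : (0 : ℝ) ≤ 2)]
        field_simp

lemma exists_isApproxSeq {θ α C : ℝ} (hα : 0 < α) (hC : 0 < C)
    (hθ : ∀ v : Fin 3 → ℤ, v ≠ 0 → form θ v ≠ 0)
    (happ : ∀ N : ℕ, 1 ≤ N → ∃ v : Fin 3 → ℤ, v ≠ 0 ∧ supNorm v ≤ N ∧
      |form θ v| ≤ C * (N : ℝ) ^ (-α)) :
    ∃ C' : ℝ, 0 < C' ∧ ∃ z, IsApproxSeq θ α C' z := by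
  let Good := {w : Fin 3 → ℤ // w ≠ 0 ∧
    ∀ v, v ≠ 0 → supNorm v ≤ supNorm w → |form θ w| ≤ |form θ v|}
  have hstep : ∀ a : Good, ∃ b : Good, supNorm a.1 < supNorm b.1 ∧
      |form θ b.1| ≤ |form θ a.1| / 2 ∧
      |form θ a.1| ≤ 2 * (2 ^ α * C) * (supNorm b.1 : ℝ) ^ (-α) := by
    rintro ⟨a, ha, hamin⟩
    have hpos : 0 < |form θ a| := abs_pos.mpr (hθ a ha)
    obtain ⟨b, hb, hbε, hbmin, hbX⟩ := exists_minimal_le hα hC (half_pos hpos) happ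
    have hlt : supNorm a < supNorm b := by
      by_contra! hle
      have := hamin b hb hle
      linarith
    refine ⟨⟨b, hb, hbmin⟩, hlt, hbε, ?_⟩
    have := hbX (by have := supNorm_pos ha; omega)
    simp only
    linarith
  choose next hnext using hstep
  obtain ⟨w, hw, -, hwmin, -⟩ := exists_minimal_le hα hC one_pos happ
  let z : ℕ → Good := fun n => next^[n] ⟨w, hw, hwmin⟩
  have hz : ∀ n, z (n + 1) = next (z n) := fun n => Function.iterate_succ_apply' _ _ _
  refine ⟨2 * (2 ^ α * C), by positivity, fun n => (z n).1, fun n => (z n).2.1,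
    strictMono_nat_of_lt_succ fun n => ?_, fun n => ?_, fun n => ?_⟩
  · simp only [hz]; exact (hnext (z n)).1
  · simp only [hz]; exact (hnext (z n)).2.1
  · simp only [hz]; exact (hnext (z n)).2.2

lemma supNorm_cast_pos {v : Fin 3 → ℤ} (hv : v ≠ 0) : (0 : ℝ) < supNorm v := by
  exact_mod_cast supNorm_pos hv

lemma cross_ne_zero_of_lt {θ : ℝ} {u v : Fin 3 → ℤ} (hu : form θ u ≠ 0)
    (huv : supNorm u ≤ supNorm v) (hv : v ≠ 0) (h : |form θ v| ≤ |form θ u| / 2) :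
    cross u v ≠ 0 := by
  intro h0
  have hc : ∀ k, (cross u v k : ℝ) = 0 := fun k => by simp [h0]
  have h01 : (u 0 : ℝ) * v 1 = u 1 * v 0 := by
    have := hc 2; simp [cross] at this; linarith
  have h02 : (u 0 : ℝ) * v 2 = u 2 * v 0 := by
    have := hc 1; simp [cross] at this; linarith
  have h12 : (u 1 : ℝ) * v 2 = u 2 * v 1 := by
    have := hc 0; simp [cross] at this; linarith
  have key : ∀ k, form θ u * v k = form θ v * u k := by
    intro k
    unfold form
    fin_cases k <;> simp only [Fin.zero_eta, Fin.mk_one, Fin.reduceFinMk]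
    · linear_combination -θ * h01 - θ ^ 2 * h02
    · linear_combination h01 - θ ^ 2 * h12
    · linear_combination h02 + θ * h12
  obtain ⟨k, hk⟩ := exists_abs_eq_supNorm v
  have h1 := congrArg abs (key k)
  rw [abs_mul, abs_mul, ← hk] at h1
  have h2 : |(u k : ℝ)| ≤ supNorm v := (abs_le_supNorm u k).trans (by exact_mod_cast huv)
  have h3 := abs_pos.mpr hu
  have h4 := supNorm_cast_pos hv
  have h5 : |form θ v| * |(u k : ℝ)| ≤ |form θ u| / 2 * supNorm v := by gcongr
  nlinarith [mul_pos h3 h4]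

lemma cross_forms (θ : ℝ) (u v : Fin 3 → ℤ) :
    form θ u * v 1 - form θ v * u 1 = cross u v 2 - θ ^ 2 * cross u v 0 ∧
    form θ u * v 2 - form θ v * u 2 = θ * cross u v 0 - cross u v 1 := by
  simp [form, cross]
  constructor <;> ring

lemma eq_zero_of_mul_le {a X : ℝ} {f : ℕ → ℝ}
    (hf : Filter.Tendsto f Filter.atTop (nhds 0)) (N : ℕ) (h : ∀ n ≥ N, |a| ≤ f n * X) :
    a = 0 := by
  have : |a| ≤ 0 * X :=
    ge_of_tendsto (hf.mul_const X) (Filter.eventually_atTop.mpr ⟨N, h⟩)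
  rw [zero_mul] at this
  exact abs_nonpos_iff.mp this

namespace IsApproxSeq

variable {θ α C : ℝ} {z : ℕ → Fin 3 → ℤ}

lemma pos (hz : IsApproxSeq θ α C z) (n : ℕ) : (0 : ℝ) < supNorm (z n) :=
  supNorm_cast_pos (hz.ne_zero n)

lemma one_le (hz : IsApproxSeq θ α C z) (n : ℕ) : (1 : ℝ) ≤ supNorm (z n) := by
  exact_mod_cast supNorm_pos (hz.ne_zero n)

lemma mono (hz : IsApproxSeq θ α C z) {m n : ℕ} (h : m ≤ n) :
    (supNorm (z m) : ℝ) ≤ supNorm (z n) := by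
  exact_mod_cast hz.strictMono.monotone h

lemma natCast_le (hz : IsApproxSeq θ α C z) (n : ℕ) : (n : ℝ) ≤ supNorm (z n) := by
  exact_mod_cast hz.strictMono.le_apply

lemma form_antitone (hz : IsApproxSeq θ α C z) : Antitone fun n => |form θ (z n)| :=
  antitone_nat_of_succ_le fun n => (hz.half n).trans (half_le_self (abs_nonneg _))

lemma half_of_lt (hz : IsApproxSeq θ α C z) {m n : ℕ} (h : m < n) :
    |form θ (z n)| ≤ |form θ (z m)| / 2 :=
  (hz.form_antitone (Nat.succ_le_of_lt h)).trans (hz.half m)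

lemma cross_ne_zero (hz : IsApproxSeq θ α C z) (hθ : ∀ v : Fin 3 → ℤ, v ≠ 0 → form θ v ≠ 0)
    {m n : ℕ} (h : m < n) : cross (z m) (z n) ≠ 0 :=
  cross_ne_zero_of_lt (hθ _ (hz.ne_zero m)) (hz.strictMono.monotone h.le) (hz.ne_zero n)
    (hz.half_of_lt h)

/-- The sequence does not stay in the plane spanned by two consecutive elements. -/
lemma exists_det3_ne_zero (hz : IsApproxSeq θ α C z) (hα : 1 < α) (hC : 0 < C)
    (hθ : ∀ v : Fin 3 → ℤ, v ≠ 0 → form θ v ≠ 0) (N : ℕ) :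
    ∃ j, N ≤ j ∧ det3 (z N) (z (N + 1)) (z j) ≠ 0 := by
  by_contra! hplane
  set c := cross (z N) (z (N + 1)) with hc
  have hc0 : c ≠ 0 := hz.cross_ne_zero hθ (Nat.lt_succ_self N)
  have hbound : ∀ n, ∀ k, |form θ (z n) * z (n + 1) k - form θ (z (n + 1)) * z n k| ≤
      2 * C * (supNorm (z (n + 1)) : ℝ) ^ (-(α - 1)) := by
    intro n k
    have h1 : |form θ (z (n + 1))| ≤ |form θ (z n)| := hz.form_antitone (Nat.le_succ n)
    have h2 := (abs_le_supNorm (z n) k).trans (hz.mono (Nat.le_succ n))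
    have h3 := abs_le_supNorm (z (n + 1)) k
    calc _ ≤ |form θ (z n)| * |(z (n + 1) k : ℝ)| + |form θ (z (n + 1))| * |(z n k : ℝ)| := by
          rw [← abs_mul, ← abs_mul]
          exact abs_sub _ _
      _ ≤ |form θ (z n)| * supNorm (z (n + 1)) + |form θ (z n)| * supNorm (z (n + 1)) := by
          gcongr
      _ = 2 * (|form θ (z n)| * supNorm (z (n + 1))) := by ring
      _ ≤ 2 * (C * (supNorm (z (n + 1)) : ℝ) ^ (-α) * supNorm (z (n + 1))) := by
          gcongr
          exact hz.le n
      _ = _ := by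
          rw [show -(α - 1) = -α + 1 by ring, Real.rpow_add (hz.pos _), Real.rpow_one]
          ring
  have hlim : Filter.Tendsto (fun n => 2 * C * (supNorm (z (n + 1)) : ℝ) ^ (-(α - 1)))
      Filter.atTop (nhds 0) := by
    have h1 : Filter.Tendsto (fun n => (supNorm (z (n + 1)) : ℝ)) Filter.atTop Filter.atTop :=
      tendsto_natCast_atTop_atTop.comp
        (hz.strictMono.tendsto_atTop.comp (Filter.tendsto_add_atTop_nat 1))
    simpa using ((tendsto_rpow_neg_atTop (sub_pos.mpr hα)).comp h1).const_mul (2 * C)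
  have hscale : ∀ n ≥ N, ∃ k, (1 : ℝ) ≤ |(cross (z n) (z (n + 1)) k : ℝ)| ∧
      ∀ i, (cross (z n) (z (n + 1)) k : ℝ) * c i = cross (z n) (z (n + 1)) i * c k := by
    intro n hn
    have hd := hz.cross_ne_zero hθ (Nat.lt_succ_self n)
    obtain ⟨k, hk⟩ := Function.ne_iff.mp hd
    refine ⟨k, ?_, fun i => ?_⟩
    · rw [← Int.cast_abs]
      exact_mod_cast Int.one_le_abs hk
    · exact_mod_cast cross_parallel (hplane n hn) (hplane (n + 1) (by omega)) k i
  have hlin : ∀ p q r : ℝ, (∀ n, |p * cross (z n) (z (n + 1)) 0 + q * cross (z n) (z (n + 1)) 1 +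
      r * cross (z n) (z (n + 1)) 2| ≤ 2 * C * (supNorm (z (n + 1)) : ℝ) ^ (-(α - 1))) →
      p * c 0 + q * c 1 + r * c 2 = 0 := by
    intro p q r hpqr
    refine eq_zero_of_mul_le (X := (supNorm c : ℝ)) hlim N fun n hn => ?_
    obtain ⟨k, hk1, hk⟩ := hscale n hn
    calc |p * c 0 + q * c 1 + r * c 2|
        ≤ |(cross (z n) (z (n + 1)) k : ℝ)| * |p * c 0 + q * c 1 + r * c 2| :=
          le_mul_of_one_le_left (abs_nonneg _) hk1
      _ = |p * cross (z n) (z (n + 1)) 0 + q * cross (z n) (z (n + 1)) 1 +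
            r * cross (z n) (z (n + 1)) 2| * |(c k : ℝ)| := by
          rw [← abs_mul, ← abs_mul]
          congr 1
          linear_combination p * hk 0 + q * hk 1 + r * hk 2
      _ ≤ _ := by
          gcongr
          · exact hpqr n
          · exact abs_le_supNorm c k
  have e1 : form θ ![c 2, 0, -c 0] = 0 := by
    have := hlin (-θ ^ 2) 0 1 fun n => by
      convert hbound n 1 using 2
      rw [(cross_forms θ _ _).1]; ring
    simp [form]
    linear_combination this
  have e2 : form θ ![-c 1, c 0, 0] = 0 := by
    have := hlin θ (-1) 0 fun n => by
      convert hbound n 2 using 2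
      rw [(cross_forms θ _ _).2]; ring
    simp [form]
    linear_combination this
  have e1' := not_imp_not.mp (hθ ![c 2, 0, -c 0]) e1
  have e2' := not_imp_not.mp (hθ ![-c 1, c 0, 0]) e2
  apply hc0
  have a2 := congrFun e1' 0
  have a1 := congrFun e2' 0
  have a0 := congrFun e2' 1
  simp at a0 a1 a2
  ext i
  fin_cases i <;> simp [a0, a1, a2]

/-- The next index at which three consecutive elements are linearly independent. -/
lemma exists_next (hz : IsApproxSeq θ α C z) (hα : 1 < α) (hC : 0 < C)
    (hθ : ∀ v : Fin 3 → ℤ, v ≠ 0 → form θ v ≠ 0) (N : ℕ) :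
    ∃ k, N ≤ k ∧ det3 (z N) (z (N + 1)) (z (k + 1)) = 0 ∧
      det3 (z k) (z (k + 1)) (z (k + 2)) ≠ 0 := by
  classical
  have hex := hz.exists_det3_ne_zero hα hC hθ N
  obtain ⟨hN, hdet⟩ := Nat.find_spec hex
  have hmin : ∀ m < Nat.find hex, N ≤ m → det3 (z N) (z (N + 1)) (z m) = 0 := by
    intro m hm hNm
    by_contra hne
    exact Nat.find_min hex hm ⟨hNm, hne⟩
  set j := Nat.find hex
  have hj : N + 2 ≤ j := by
    by_contra! hlt
    have : j = N ∨ j = N + 1 := by omega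
    apply hdet
    rcases this with h | h <;> rw [h, det3_eq] <;> ring
  obtain ⟨k, hk⟩ : ∃ k, j = k + 2 := ⟨j - 2, by omega⟩
  rw [hk] at hdet hmin hj
  have h1 := hmin (k + 1) (by omega) (by omega)
  refine ⟨k, by omega, h1, fun h0 => hdet ?_⟩
  obtain ⟨i, hi⟩ := Function.ne_iff.mp (hz.cross_ne_zero hθ (Nat.lt_succ_self k))
  have hpar := cross_parallel (hmin k (by omega) (by omega)) h1 i
  refine (mul_eq_zero.mp ?_).resolve_right hi
  rw [det3] at h0 ⊢
  linear_combination z (k + 2) 0 * hpar 0 + z (k + 2) 1 * hpar 1 + z (k + 2) 2 * hpar 2 +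
    cross (z N) (z (N + 1)) i * h0

end IsApproxSeq

lemma abs_derivForm_le (θ : ℝ) (v : Fin 3 → ℤ) :
    |derivForm θ v| ≤ (1 + 2 * |θ|) * supNorm v := by
  unfold derivForm
  calc _ ≤ |(v 1 : ℝ)| + 2 * |(v 2 : ℝ)| * |θ| := by
        refine (abs_add_le _ _).trans ?_
        rw [abs_mul, abs_mul, abs_two]
    _ ≤ supNorm v + 2 * supNorm v * |θ| := by gcongr <;> exact abs_le_supNorm v _
    _ = _ := by ring

lemma abs_det3_le {θ : ℝ} {u v w : Fin 3 → ℤ} (huv : supNorm u ≤ supNorm v)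
    (hvw : supNorm v ≤ supNorm w) (hLv : |form θ v| ≤ |form θ u|)
    (hLw : |form θ w| ≤ |form θ v|) :
    |(det3 u v w : ℝ)| ≤ 2 * (|form θ u| * |derivForm θ v| * supNorm w +
      |form θ v| * |derivForm θ u| * supNorm w + |form θ u| * |derivForm θ w| * supNorm v) := by
  have huv' : (supNorm u : ℝ) ≤ supNorm v := by exact_mod_cast huv
  have hvw' : (supNorm v : ℝ) ≤ supNorm w := by exact_mod_cast hvw
  have hexp : (det3 u v w : ℝ) =
      (form θ u * (derivForm θ v * w 2) - form θ u * (derivForm θ w * v 2)) -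
      (form θ v * (derivForm θ u * w 2) - form θ v * (derivForm θ w * u 2)) +
      (form θ w * (derivForm θ u * v 2) - form θ w * (derivForm θ v * u 2)) := by
    rw [det3_eq]
    push_cast
    unfold form derivForm
    ring
  have habs : ∀ a b : Fin 3 → ℤ, ∀ c : Fin 3 → ℤ, |form θ a * (derivForm θ b * c 2)| ≤
      |form θ a| * (|derivForm θ b| * supNorm c) := by
    intro a b c
    rw [abs_mul, abs_mul]
    gcongr
    exact abs_le_supNorm c 2
  have h1 := habs u v w
  have h2 := habs u w v
  have h3 := habs v u w
  have h4 : |form θ v * (derivForm θ w * u 2)| ≤ |form θ u| * (|derivForm θ w| * supNorm v) :=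
    (habs v w u).trans (by gcongr)
  have h5 : |form θ w * (derivForm θ u * v 2)| ≤ |form θ v| * (|derivForm θ u| * supNorm w) :=
    (habs w u v).trans (by gcongr)
  have hLwu := hLw.trans hLv
  have huw := huv'.trans hvw'
  have h6 : |form θ w * (derivForm θ v * u 2)| ≤ |form θ u| * (|derivForm θ v| * supNorm w) :=
    (habs w v u).trans (by gcongr)
  rw [hexp]
  simp only [abs_le] at *
  constructor <;> linarith [h1.1, h1.2, h2.1, h2.2, h3.1, h3.2, h4.1, h4.2, h5.1, h5.2, h6.1, h6.2]

/-- The determinant inequality for `u, v, v'` independent and `w` in the plane of `v, v'`. -/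
lemma supNorm_le_of_det3 {θ : ℝ} {u v v' w : Fin 3 → ℤ} (hdet : det3 u v v' ≠ 0)
    (hcross : cross v v' ≠ 0) (h0 : det3 v v' w = 0)
    (huv : supNorm u ≤ supNorm v) (hvv' : supNorm v ≤ supNorm v')
    (hv'w : supNorm v' ≤ supNorm w) (hform : form θ v ≠ 0)
    (hLv : |form θ v| ≤ |form θ u|) (hLv' : |form θ v'| ≤ |form θ v| / 2)
    (hLw : |form θ w| ≤ |form θ v| / 2) :
    (supNorm w : ℝ) ≤ 8 * supNorm v' * (|form θ u| * |derivForm θ v| * supNorm w +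
      |form θ v| * |derivForm θ u| * supNorm w + |form θ u| * |derivForm θ w| * supNorm v) := by
  obtain ⟨A, B, hAB⟩ := exists_combination hcross h0
  have hpos := abs_pos.mpr hform
  have hA : |A| ≤ |B| + 1 / 2 := by
    have hlin : A * form θ v = form θ w - B * form θ v' := by
      unfold form
      rw [hAB 0, hAB 1, hAB 2]
      ring
    have h1 := congrArg abs hlin
    rw [abs_mul] at h1
    have h2 : |form θ w - B * form θ v'| ≤ |form θ w| + |B| * |form θ v'| := by
      rw [← abs_mul]; exact abs_sub _ _
    have h3 : |B| * |form θ v'| ≤ |B| * (|form θ v| / 2) := by gcongr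
    have h4 : |A| * |form θ v| ≤ (|B| + 1 / 2) * |form θ v| := by
      nlinarith [mul_nonneg (abs_nonneg B) hpos.le]
    exact le_of_mul_le_mul_right h4 hpos
  have hB : |B| ≤ |(det3 u v w : ℝ)| := by
    have hmul : (det3 u v w : ℝ) = B * det3 u v v' := by
      rw [det3_eq, det3_eq]
      push_cast
      rw [hAB 0, hAB 1, hAB 2]
      ring
    rw [hmul, abs_mul]
    refine le_mul_of_one_le_right (abs_nonneg _) ?_
    rw [← Int.cast_abs]
    exact_mod_cast Int.one_le_abs hdet
  have hvv'R : (supNorm v : ℝ) ≤ supNorm v' := by exact_mod_cast hvv'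
  have hv'wR : (supNorm v' : ℝ) ≤ supNorm w := by exact_mod_cast hv'w
  have hW : (supNorm w : ℝ) ≤ 4 * supNorm v' * |B| := by
    obtain ⟨i, hi⟩ := exists_abs_eq_supNorm w
    have h1 : |(w i : ℝ)| ≤ |A| * supNorm v + |B| * supNorm v' := by
      rw [hAB i]
      refine (abs_add_le _ _).trans ?_
      rw [abs_mul, abs_mul]
      gcongr <;> exact abs_le_supNorm _ i
    have h2 : |A| * supNorm v ≤ (|B| + 1 / 2) * supNorm v := by gcongr
    have h3 : |B| * supNorm v ≤ |B| * supNorm v' := by gcongr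
    linarith
  have hdet' := abs_det3_le huv (hvv'.trans hv'w) hLv (hLw.trans (half_le_self hpos.le))
  have := mul_le_mul_of_nonneg_left (hB.trans hdet') (by positivity : (0 : ℝ) ≤ 4 * supNorm v')
  linarith

lemma rpow_neg_le_inv_sq {α X : ℝ} (hα : 2 ≤ α) (hX : 1 ≤ X) : X ^ (-α) ≤ (X ^ 2)⁻¹ := by
  rw [← Real.rpow_two, ← Real.rpow_neg (by linarith)]
  exact Real.rpow_le_rpow_of_exponent_le hX (by linarith)

/-- The terms of the determinant inequality not involving the last vector are negligible. -/
lemma small_terms {α γ C K c a X Y Lu Lv Du Dv : ℝ} (hα : 2 ≤ α) (hγ : 0 ≤ γ) (hC : 0 < C)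
    (hK : 0 < K) (hc : 0 < c) (ha : 1 ≤ a) (haX : a ≤ X) (hXY : X ≤ Y)
    (hgap : c * X ^ (α - 1) ≤ Y) (hLu0 : 0 ≤ Lu) (hLv0 : 0 ≤ Lv)
    (hLu : Lu ≤ C * X ^ (-α)) (hLv : Lv ≤ C * Y ^ (-α))
    (hDu : Du ≤ K * (Lu * a ^ γ + √(a * Lu))) (hDv : Dv ≤ K * (Lv * X ^ γ + √(X * Lv))) :
    (Lu * Dv + Lv * Du) * Y ≤ 2 * K * (C ^ 2 * c ^ (1 - α) + C * √C) *
      (X ^ (-(α ^ 2 - α + 1 - γ)) + X ^ (-1 : ℝ)) := by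
  have hX1 : 1 ≤ X := ha.trans haX
  have hX : 0 < X := by linarith
  have hY : 0 < Y := by linarith
  have hLu2 : Lu ≤ C * (X ^ 2)⁻¹ := hLu.trans (by gcongr; exact rpow_neg_le_inv_sq hα hX1)
  have hLv2 : Lv ≤ C * (Y ^ 2)⁻¹ :=
    hLv.trans (by gcongr; exact rpow_neg_le_inv_sq hα (hX1.trans hXY))
  have hmain : Lu * Lv * X ^ γ * Y ≤ C ^ 2 * c ^ (1 - α) * X ^ (-(α ^ 2 - α + 1 - γ)) := by
    calc Lu * Lv * X ^ γ * Y ≤ (C * X ^ (-α)) * (C * Y ^ (-α)) * X ^ γ * Y := by gcongr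
      _ = C ^ 2 * X ^ (γ - α) * Y ^ (1 - α) := by
          rw [show γ - α = -α + γ by ring, show 1 - α = -α + 1 by ring, Real.rpow_add hX,
            Real.rpow_add hY, Real.rpow_one]
          ring
      _ ≤ C ^ 2 * X ^ (γ - α) * (c * X ^ (α - 1)) ^ (1 - α) := by
          gcongr C ^ 2 * X ^ (γ - α) * ?_
          exact Real.rpow_le_rpow_of_nonpos (by positivity) hgap (by linarith)
      _ = C ^ 2 * c ^ (1 - α) * (X ^ (γ - α) * X ^ ((α - 1) * (1 - α))) := by
          rw [Real.mul_rpow hc.le (by positivity), ← Real.rpow_mul hX.le]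
          ring
      _ = _ := by
          rw [← Real.rpow_add hX]
          congr 2
          ring
  have hs1 : Lu * √(X * Lv) * Y ≤ C * √C * X ^ (-1 : ℝ) := by
    have : √(X * Lv) ≤ √C * (X / Y) := by
      rw [← Real.sqrt_sq (by positivity : 0 ≤ X / Y), ← Real.sqrt_mul hC.le]
      apply Real.sqrt_le_sqrt
      calc X * Lv ≤ X ^ 2 * (C * (Y ^ 2)⁻¹) := by gcongr; nlinarith
        _ = _ := by ring
    calc Lu * √(X * Lv) * Y ≤ C * (X ^ 2)⁻¹ * (√C * (X / Y)) * Y := by gcongr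
      _ = _ := by rw [Real.rpow_neg_one]; field_simp
  have hs2 : Lv * √(a * Lu) * Y ≤ C * √C * X ^ (-1 : ℝ) := by
    have : √(a * Lu) ≤ √C := by
      apply Real.sqrt_le_sqrt
      calc a * Lu ≤ X ^ 2 * (C * (X ^ 2)⁻¹) := by gcongr; nlinarith
        _ = C := by field_simp
    calc Lv * √(a * Lu) * Y ≤ C * (Y ^ 2)⁻¹ * √C * Y := by gcongr
      _ = C * √C * Y⁻¹ := by field_simp
      _ ≤ C * √C * X ^ (-1 : ℝ) := by rw [Real.rpow_neg_one]; gcongr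
  have hp1 : 0 ≤ C ^ 2 * c ^ (1 - α) * X ^ (-1 : ℝ) := by positivity
  have hp2 : 0 ≤ C * √C * X ^ (-(α ^ 2 - α + 1 - γ)) := by positivity
  calc (Lu * Dv + Lv * Du) * Y
      ≤ (Lu * (K * (Lv * X ^ γ + √(X * Lv))) + Lv * (K * (Lu * X ^ γ + √(a * Lu)))) * Y := by
        gcongr
        exact hDu.trans (by gcongr)
    _ = K * (2 * (Lu * Lv * X ^ γ * Y) + Lu * √(X * Lv) * Y + Lv * √(a * Lu) * Y) := by ring
    _ ≤ K * (2 * (C ^ 2 * c ^ (1 - α) * X ^ (-(α ^ 2 - α + 1 - γ))) + C * √C * X ^ (-1 : ℝ) +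
          C * √C * X ^ (-1 : ℝ)) := by gcongr
    _ ≤ K * (2 * (C ^ 2 * c ^ (1 - α) + C * √C) *
          (X ^ (-(α ^ 2 - α + 1 - γ)) + X ^ (-1 : ℝ))) := by
        gcongr
        linarith
    _ = _ := by ring

lemma main_term {α γ C K X Y W V Lu Lw Dw : ℝ} (hα : 2 ≤ α) (hC : 0 < C)
    (hK : 0 < K) (hX : 1 ≤ X) (hXY : X ≤ Y) (hYW : Y ≤ W) (hWV : W ≤ V)
    (hXlarge : 32 * C * K * √C ≤ X) (hLu0 : 0 ≤ Lu) (hLw0 : 0 ≤ Lw)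
    (hLu : Lu ≤ C * X ^ (-α)) (hLw : Lw ≤ C * V ^ (-α))
    (hDw : Dw ≤ K * (Lw * W ^ γ + √(W * Lw))) (h : W ≤ 16 * X * Y * Lu * Dw) :
    W ≤ 32 * K * C ^ 2 * (X ^ (1 - α) * Y * V ^ (-α) * W ^ γ) := by
  have hX0 : 0 < X := by linarith
  have hY0 : 0 < Y := by linarith
  have hW0 : 0 < W := by linarith
  have hV0 : 0 < V := by linarith
  have hLu2 : Lu ≤ C * (X ^ 2)⁻¹ := hLu.trans (by gcongr; exact rpow_neg_le_inv_sq hα hX)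
  have hsqrt : √(W * Lw) ≤ √C := by
    apply Real.sqrt_le_sqrt
    calc W * Lw ≤ W * (C * (V ^ 2)⁻¹) := by
          gcongr
          exact hLw.trans (by gcongr; exact rpow_neg_le_inv_sq hα (by linarith))
      _ ≤ V ^ 2 * (C * (V ^ 2)⁻¹) := by gcongr; nlinarith
      _ = C := by field_simp
  have h1 : 16 * X * Y * Lu * (K * √(W * Lw)) ≤ W / 2 := by
    calc 16 * X * Y * Lu * (K * √(W * Lw)) ≤ 16 * X * W * (C * (X ^ 2)⁻¹) * (K * √C) := by gcongr
      _ = 32 * C * K * √C * (W / 2) / X := by field_simp; norm_num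
      _ ≤ X * (W / 2) / X := by gcongr
      _ = W / 2 := by field_simp
  have h2 : 16 * X * Y * Lu * (K * (Lw * W ^ γ)) ≤
      16 * K * C ^ 2 * (X ^ (1 - α) * Y * V ^ (-α) * W ^ γ) := by
    calc _ ≤ 16 * X * Y * (C * X ^ (-α)) * (K * (C * V ^ (-α) * W ^ γ)) := by gcongr
      _ = _ := by
          rw [show 1 - α = -α + 1 by ring, Real.rpow_add hX0, Real.rpow_one]
          ring
  have h3 : 16 * X * Y * Lu * Dw ≤ 16 * X * Y * Lu * (K * (Lw * W ^ γ + √(W * Lw))) := by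
    gcongr
  linarith

namespace IsApproxSeq

variable {θ α C : ℝ} {z : ℕ → Fin 3 → ℤ}

lemma gap (hz : IsApproxSeq θ α C z) {n : ℕ} (hC : 0 < C)
    (hdet : det3 (z n) (z (n + 1)) (z (n + 2)) ≠ 0) :
    (6 * (1 + 2 * |θ|) * C)⁻¹ * (supNorm (z (n + 1)) : ℝ) ^ (α - 1) ≤ supNorm (z (n + 2)) := by
  have h01 : n ≤ n + 1 := by omega
  have h12 : n + 1 ≤ n + 2 := by omega
  have h := abs_det3_le (hz.strictMono.monotone h01) (hz.strictMono.monotone h12)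
    (hz.form_antitone h01) (hz.form_antitone h12)
  have h1 : (1 : ℝ) ≤ |(det3 (z n) (z (n + 1)) (z (n + 2)) : ℝ)| := by
    rw [← Int.cast_abs]
    exact_mod_cast Int.one_le_abs hdet
  have hX := hz.pos (n + 1)
  have hY := hz.pos (n + 2)
  have hm0 := hz.mono h01
  have hL := hz.form_antitone h01
  have hLe := hz.le n
  simp only at hL
  have hD0 := abs_derivForm_le θ (z n)
  have hD1 := abs_derivForm_le θ (z (n + 1))
  have hD2 := abs_derivForm_le θ (z (n + 2))
  set X : ℝ := (supNorm (z (n + 1)) : ℝ)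
  set Y : ℝ := (supNorm (z (n + 2)) : ℝ)
  set k := 1 + 2 * |θ| with hk
  have hk0 : 0 < k := by positivity
  have hD0' : |derivForm θ (z n)| ≤ k * X := hD0.trans (by gcongr)
  have key : 1 ≤ 6 * k * C * (X ^ (-α) * X) * Y := by
    calc (1 : ℝ) ≤ _ := h1.trans h
      _ ≤ 2 * (|form θ (z n)| * (k * X) * Y + |form θ (z n)| * (k * X) * Y +
            |form θ (z n)| * (k * Y) * X) := by gcongr
      _ = 6 * k * |form θ (z n)| * X * Y := by ring
      _ ≤ 6 * k * (C * X ^ (-α)) * X * Y := by gcongr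
      _ = _ := by ring
  have hXα : X ^ (α - 1) * (X ^ (-α) * X) = 1 := by
    rw [← Real.rpow_add_one hX.ne', ← Real.rpow_add hX]
    norm_num
  rw [inv_mul_le_iff₀ (by positivity)]
  calc X ^ (α - 1) ≤ X ^ (α - 1) * (6 * k * C * (X ^ (-α) * X) * Y) :=
        le_mul_of_one_le_right (by positivity) key
    _ = 6 * k * C * Y * (X ^ (α - 1) * (X ^ (-α) * X)) := by ring
    _ = _ := by rw [hXα, mul_one]

end IsApproxSeq

/-- The logarithm of `‖z (n + 2)‖ / ‖z (n + 1)‖ ^ (α - 1)`. -/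
noncomputable def logGap (α : ℝ) (z : ℕ → Fin 3 → ℤ) (n : ℕ) : ℝ :=
  Real.log (supNorm (z (n + 2))) - (α - 1) * Real.log (supNorm (z (n + 1)))

/-- The logarithmic form of the inequality provided by `main_term`. -/
lemma log_main_term {α γ c X Y W V : ℝ} (hc : 0 < c) (hX : 0 < X) (hY : 0 < Y) (hW : 0 < W)
    (hV : 0 < V) (h : W ≤ c * (X ^ (1 - α) * Y * V ^ (-α) * W ^ γ)) :
    α * (Real.log V - (α - 1) * Real.log W) ≤ Real.log Y - (α - 1) * Real.log X + Real.log c -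
      (α ^ 2 - α + 1 - γ) * Real.log W := by
  have h1 := Real.log_le_log hW h
  rw [Real.log_mul hc.ne' (by positivity), Real.log_mul (by positivity) (by positivity),
    Real.log_mul (by positivity) (by positivity), Real.log_mul (by positivity) (by positivity),
    Real.log_rpow hX, Real.log_rpow hV, Real.log_rpow hW] at h1
  linarith

namespace IsApproxSeq

variable {θ α C γ K : ℝ} {z : ℕ → Fin 3 → ℤ}

lemma log_le_logGap (hz : IsApproxSeq θ α C z) {n : ℕ} (hC : 0 < C)
    (hdet : det3 (z n) (z (n + 1)) (z (n + 2)) ≠ 0) :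
    Real.log (6 * (1 + 2 * |θ|) * C)⁻¹ ≤ logGap α z n := by
  have hX := hz.pos (n + 1)
  have h := Real.log_le_log (by positivity) (hz.gap hC hdet)
  rw [Real.log_mul (by positivity) (by positivity), Real.log_rpow hX] at h
  unfold logGap
  linarith

lemma exists_logGap_le (hz : IsApproxSeq θ α C z) (hα : 2 ≤ α) (hC : 0 < C)
    (hθ : ∀ v : Fin 3 → ℤ, v ≠ 0 → form θ v ≠ 0) (hγ0 : 0 ≤ γ) (hγ : γ < α ^ 2 - α + 1)
    (hK : 0 < K) (hD : ∀ v : Fin 3 → ℤ, v ≠ 0 → |derivForm θ v| ≤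
      K * (|form θ v| * (supNorm v : ℝ) ^ γ + √(supNorm v * |form θ v|))) :
    ∃ N : ℕ, ∀ n, N ≤ n → det3 (z n) (z (n + 1)) (z (n + 2)) ≠ 0 →
      ∃ k, n < k ∧ det3 (z k) (z (k + 1)) (z (k + 2)) ≠ 0 ∧
        logGap α z k ≤ logGap α z n - 1 := by
  set c := (6 * (1 + 2 * |θ|) * C)⁻¹ with hc
  have hc0 : 0 < c := by positivity
  set η := α ^ 2 - α + 1 - γ with hη
  have hη0 : 0 < η := by linarith
  set κ := 2 * K * (C ^ 2 * c ^ (1 - α) + C * √C) with hκ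
  have hlim : Filter.Tendsto (fun x : ℝ => κ * (x ^ (-η) + x ^ (-1 : ℝ))) Filter.atTop
      (nhds (κ * (0 + 0))) :=
    ((tendsto_rpow_neg_atTop hη0).add (tendsto_rpow_neg_atTop one_pos)).const_mul κ
  have hlog : Filter.Tendsto (fun x : ℝ => η * Real.log x) Filter.atTop Filter.atTop :=
    Real.tendsto_log_atTop.const_mul_atTop hη0
  obtain ⟨R, hR⟩ := Filter.eventually_atTop.mp
    (((hlim.eventually_le_const (show κ * (0 + 0) < 1 / 16 by norm_num)).and
      (hlog.eventually_ge_atTop (Real.log (32 * K * C ^ 2) + α - (α - 1) * Real.log c))).and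
      (Filter.eventually_ge_atTop (32 * C * K * √C)))
  obtain ⟨N, hN⟩ := exists_nat_ge R
  refine ⟨N, fun n hn hdet => ?_⟩
  have hRX : R ≤ supNorm (z (n + 1)) :=
    hN.trans ((by exact_mod_cast hn.trans n.le_succ : (N : ℝ) ≤ (n + 1 : ℕ)).trans
      (hz.natCast_le (n + 1)))
  obtain ⟨⟨hsmall, hlarge⟩, hXlarge⟩ := hR _ hRX
  obtain ⟨k, hk, hzero, hdetk⟩ := hz.exists_next (by linarith) hC hθ (n + 1)
  have hnk : n < k := by omega
  refine ⟨k, hnk, hdetk, ?_⟩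
  have hkey := supNorm_le_of_det3 (θ := θ) hdet (hz.cross_ne_zero hθ (by omega)) hzero
    (hz.strictMono.monotone (by omega)) (hz.strictMono.monotone (by omega))
    (hz.strictMono.monotone (by omega)) (hθ _ (hz.ne_zero _)) (hz.form_antitone (by omega))
    (hz.half_of_lt (by omega)) (hz.half_of_lt (by omega))
  have hW := hz.pos (k + 1)
  have hX1 := hz.one_le (n + 1)
  have hXY := hz.mono (show n + 1 ≤ n + 2 by omega)
  have hYW := hz.mono (show n + 2 ≤ k + 1 by omega)
  have hWV := hz.mono (show k + 1 ≤ k + 2 by omega)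
  have hrest := small_terms hα hγ0 hC hK hc0 (hz.one_le n) (hz.mono n.le_succ) hXY
    (hz.gap hC hdet) (abs_nonneg _) (abs_nonneg _) (hz.le n) (hz.le (n + 1))
    (hD _ (hz.ne_zero n)) (hD _ (hz.ne_zero (n + 1)))
  have hrest' := mul_le_mul_of_nonneg_right (hrest.trans hsmall) hW.le
  have hmain := main_term hα hC hK hX1 hXY hYW hWV hXlarge (abs_nonneg _) (abs_nonneg _)
    (hz.le n) (hz.le (k + 1)) (hD _ (hz.ne_zero (k + 1))) (by linarith)
  have hfin := log_main_term (by positivity) (hz.pos _) (hz.pos _) hW (hz.pos _) hmain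
  have hSn := hz.log_le_logGap hC hdet
  have hlogXW := mul_le_mul_of_nonneg_left
    (Real.log_le_log (hz.pos (n + 1)) (hXY.trans hYW)) hη0.le
  have hmul := mul_le_mul_of_nonneg_left hSn (show 0 ≤ α - 1 by linarith)
  change α * logGap α z k ≤ logGap α z n + _ - _ at hfin
  rw [← hc] at hmul
  refine le_of_mul_le_mul_left ?_ (show 0 < α by linarith)
  linarith

lemma false_of_derivForm_le (hz : IsApproxSeq θ α C z) (hα : 2 ≤ α) (hC : 0 < C)
    (hθ : ∀ v : Fin 3 → ℤ, v ≠ 0 → form θ v ≠ 0) (hγ0 : 0 ≤ γ) (hγ : γ < α ^ 2 - α + 1)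
    (hK : 0 < K) (hD : ∀ v : Fin 3 → ℤ, v ≠ 0 → |derivForm θ v| ≤
      K * (|form θ v| * (supNorm v : ℝ) ^ γ + √(supNorm v * |form θ v|))) : False := by
  obtain ⟨N, hN⟩ := hz.exists_logGap_le hα hC hθ hγ0 hγ hK hD
  obtain ⟨k, hk, -, hdet⟩ := hz.exists_next (by linarith) hC hθ N
  have hdescent : ∀ j : ℕ, ∃ n, N ≤ n ∧ det3 (z n) (z (n + 1)) (z (n + 2)) ≠ 0 ∧
      logGap α z n ≤ logGap α z k - j := by
    intro j
    induction j with
    | zero => exact ⟨k, hk, hdet, by simp⟩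
    | succ j ih =>
      obtain ⟨n, hn, hdetn, hle⟩ := ih
      obtain ⟨m, hm, hdetm, hle'⟩ := hN n hn hdetn
      refine ⟨m, hn.trans hm.le, hdetm, ?_⟩
      push_cast
      linarith
  obtain ⟨j, hj⟩ := exists_nat_gt (logGap α z k - Real.log (6 * (1 + 2 * |θ|) * C)⁻¹)
  obtain ⟨n, -, hdetn, hle⟩ := hdescent j
  linarith [hz.log_le_logGap hC hdetn]

end IsApproxSeq

lemma infinite_of_exponent_ge_two {θ α C γ : ℝ} (hα : 2 ≤ α) (hC : 0 < C)
    (hθ : ∀ v : Fin 3 → ℤ, v ≠ 0 → form θ v ≠ 0)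
    (happ : ∀ N : ℕ, 1 ≤ N → ∃ v : Fin 3 → ℤ, v ≠ 0 ∧ supNorm v ≤ N ∧
      |form θ v| ≤ C * (N : ℝ) ^ (-α))
    (hγ : γ < α ^ 2 - α + 1) :
    {ξ : ℝ | ∃ p : Polynomial ℤ, IsCanonicalPoly ξ p ∧
      |θ - ξ| ≤ (heightZ p : ℝ) ^ (-γ)}.Infinite := by
  intro hfin
  have hγ' : max γ 0 < α ^ 2 - α + 1 := max_lt hγ (by nlinarith)
  have hfin' : {ξ : ℝ | ∃ p : Polynomial ℤ, IsCanonicalPoly ξ p ∧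
      |θ - ξ| ≤ (heightZ p : ℝ) ^ (-max γ 0)}.Finite := by
    refine hfin.subset fun ξ ⟨p, hp, hle⟩ => ⟨p, hp, hle.trans ?_⟩
    refine Real.rpow_le_rpow_of_exponent_le ?_ (neg_le_neg (le_max_left _ _))
    exact_mod_cast heightZ_pos hp.1 hp.2.1
  obtain ⟨K, hK, hD⟩ := exists_derivForm_le (le_max_right γ 0) hθ hfin'
  obtain ⟨C', hC', z, hz⟩ := exists_isApproxSeq (by linarith) hC hθ happ
  exact hz.false_of_derivForm_le hα hC' hθ (le_max_right γ 0) hγ' hK hD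

lemma form_ne_zero {θ : ℝ}
    (hθ : ∀ p : Polynomial ℤ, p ≠ 0 → p.natDegree ≤ 2 → Polynomial.aeval θ p ≠ 0)
    {v : Fin 3 → ℤ} (hv : v ≠ 0) : form θ v ≠ 0 := by
  have h := hθ (Polynomial.C (v 2) * Polynomial.X ^ 2 + Polynomial.C (v 1) * Polynomial.X +
    Polynomial.C (v 0)) ?_ Polynomial.natDegree_quadratic_le
  · contrapose! h
    rw [← h]
    simp [form]
    ring
  · contrapose! hv
    have hcoeff := fun i => congrArg (Polynomial.coeff · i) hv
    funext i
    have h0 := hcoeff 0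
    have h1 := hcoeff 1
    have h2 := hcoeff 2
    simp only [Polynomial.coeff_add, Polynomial.coeff_C_mul, Polynomial.coeff_X_pow,
      Polynomial.coeff_X, Polynomial.coeff_C, Polynomial.coeff_zero] at h0 h1 h2
    norm_num at h0 h1 h2
    fin_cases i <;> assumption

lemma supNorm_le_of_enormZ_le {v : Fin 3 → ℤ} {N : ℕ} (h : enormZ v ≤ N) : supNorm v ≤ N := by
  rw [supNorm_le_iff]
  intro i
  have hi : |(v i : ℝ)| ≤ N := by
    refine (Real.abs_le_sqrt ?_).trans h
    have h0 := sq_nonneg (v 0 : ℝ)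
    have h1 := sq_nonneg (v 1 : ℝ)
    have h2 := sq_nonneg (v 2 : ℝ)
    fin_cases i <;> dsimp <;> linarith
  rw [← Int.cast_abs, Int.abs_eq_natAbs] at hi
  exact_mod_cast hi

end QuadraticApprox

/-- If `θ` is neither rational nor a quadratic irrationality, and `α > 0` is admissible for the
uniform exponent `ω̂(θ, θ²)` (witnessed by `C > 0`), then for every `γ < α² − α + 1` there are
infinitely many real algebraic numbers `ξ` of degree at most `2` with `|θ − ξ| ≤ H(ξ)^{−γ}`. -/
theorem approx_by_quadratic_algebraic (θ : ℝ)
    (hθ : ∀ p : Polynomial ℤ, p ≠ 0 → p.natDegree ≤ 2 → Polynomial.aeval θ p ≠ 0)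
    (α C : ℝ) (hα : 0 < α) (hC : 0 < C)
    (happrox : ∀ t : ℝ, 1 ≤ t → ∃ z : Fin 3 → ℤ, z ≠ 0 ∧ enormZ z ≤ t ∧
      |(z 0 : ℝ) + (z 1 : ℝ) * θ + (z 2 : ℝ) * θ ^ 2| ≤ C * t ^ (-α))
    (γ : ℝ) (hγ : γ < α ^ 2 - α + 1) :
    {ξ : ℝ | ∃ p : Polynomial ℤ, IsCanonicalPoly ξ p ∧
      |θ - ξ| ≤ (heightZ p : ℝ) ^ (-γ)}.Infinite := by
  have hθ' : ∀ v : Fin 3 → ℤ, v ≠ 0 → QuadraticApprox.form θ v ≠ 0 := fun _ hv =>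
    QuadraticApprox.form_ne_zero hθ hv
  rcases le_total 2 α with h2 | h2
  · refine QuadraticApprox.infinite_of_exponent_ge_two h2 hC hθ' (fun N hN => ?_) hγ
    obtain ⟨v, hv, hle, hform⟩ := happrox N (by exact_mod_cast hN)
    exact ⟨v, hv, QuadraticApprox.supNorm_le_of_enormZ_le hle, hform⟩
  · obtain ⟨C', hC', happ⟩ := QuadraticApprox.dirichlet θ
    exact QuadraticApprox.infinite_of_exponent_ge_two le_rfl hC' hθ' happ (by nlinarith)
end

section
/- Let θ be a real number that is neither rational nor a quadratic irrationality, and set L(x) = x₀ + x₁θ + x₂θ² and P(x) = x₁ + 2x₂θ for x = (x₀,x₁,x₂) ∈ ℤ³. If γ > 0 is such that there exist infinitely many x ∈ ℤ³ with |L(x)| ≤ |P(x)|·|x|^{−γ}, then for every γ' < γ there exist infinitely many real algebraic numbers ξ of degree at most 2 with |θ − ξ| ≤ H(ξ)^{−γ'}. (That is, ω_*(θ) ≥ ω_{LP}.) -/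
open Polynomial Filter Topology

/-- Every real root of a nonzero integer polynomial of degree at most `2` has a canonical
polynomial, and the latter divides the given polynomial. -/
lemma exists_isCanonicalPoly_dvd {ξ : ℝ} {f : ℤ[X]} (hf : f ≠ 0) (hdeg : f.natDegree ≤ 2)
    (hroot : aeval ξ f = 0) : ∃ p : ℤ[X], IsCanonicalPoly ξ p ∧ p ∣ f := by
  obtain ⟨p, hpirr, hpf, hpξ⟩ : ∃ p : ℤ[X], Irreducible p ∧ p ∣ f ∧ aeval ξ p = 0 := by
    obtain ⟨s, hs, u, hu⟩ := UniqueFactorizationMonoid.exists_prime_factors f hf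
    have hu0 : aeval ξ (u : ℤ[X]) ≠ 0 := (u.isUnit.map (aeval ξ)).ne_zero
    have hprod : aeval ξ s.prod = 0 := by
      rw [← hu, map_mul] at hroot
      exact (mul_eq_zero.mp hroot).resolve_right hu0
    rw [map_multiset_prod, Multiset.prod_eq_zero_iff, Multiset.mem_map] at hprod
    obtain ⟨p, hp, hp0⟩ := hprod
    exact ⟨p, (hs p hp).irreducible, (Multiset.dvd_prod hp).trans ⟨u, hu.symm⟩, hp0⟩
  obtain ⟨p, hpirr, hpf, hpξ, hlead⟩ :
      ∃ p : ℤ[X], Irreducible p ∧ p ∣ f ∧ aeval ξ p = 0 ∧ 0 < p.leadingCoeff := by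
    rcases lt_or_gt_of_ne (leadingCoeff_ne_zero.mpr hpirr.ne_zero) with h | h
    · exact ⟨-p, (Associated.refl p).neg_left.irreducible_iff.mpr hpirr, neg_dvd.mpr hpf,
        by simp [hpξ], by simpa using h⟩
    · exact ⟨p, hpirr, hpf, hpξ, h⟩
  have hnat : p.natDegree ≠ 0 := by
    intro h
    rw [eq_C_of_natDegree_eq_zero h] at hpξ
    apply hpirr.ne_zero
    rw [eq_C_of_natDegree_eq_zero h]
    simpa using hpξ
  have hprim : p.IsPrimitive := hpirr.isPrimitive hnat
  refine ⟨p, ⟨hpirr.ne_zero, (natDegree_le_of_dvd hpf hf).trans hdeg, hpξ, hprim, hlead, ?_⟩, hpf⟩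
  intro q hq hqξ
  have hirr : Irreducible (p.map (algebraMap ℤ ℚ)) :=
    (hprim.irreducible_iff_irreducible_map_fraction_map).mp hpirr
  have hmin := minpoly.eq_of_irreducible hirr (x := ξ) (by rwa [aeval_map_algebraMap])
  have hinj : Function.Injective (algebraMap ℤ ℚ) := Int.cast_injective
  have hdvd : minpoly ℚ ξ ∣ q.map (algebraMap ℤ ℚ) :=
    minpoly.dvd ℚ ξ (by rwa [aeval_map_algebraMap])
  have hle := degree_le_of_dvd ((Dvd.intro _ hmin).trans hdvd)
    ((Polynomial.map_ne_zero_iff hinj).mpr hq)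
  rwa [degree_map_eq_of_injective hinj, degree_map_eq_of_injective hinj] at hle

lemma one_le_heightZ {ξ : ℝ} {p : ℤ[X]} (hp : IsCanonicalPoly ξ p) : 1 ≤ heightZ p := by
  obtain ⟨-, hdeg, -, -, hlead, -⟩ := hp
  rw [leadingCoeff] at hlead
  unfold heightZ
  interval_cases h : p.natDegree <;> grind

/-- The height of a divisor with root `ξ` of an integer polynomial of degree at most `2`. -/
lemma heightZ_le_of_dvd {ξ B : ℝ} {p f : ℤ[X]} (hp : IsCanonicalPoly ξ p) (hpf : p ∣ f)
    (hf : f ≠ 0) (hdeg : f.natDegree ≤ 2) (hB : ∀ i, |(f.coeff i : ℝ)| ≤ B) :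
    (heightZ p : ℝ) ≤ (|ξ| + 1) * B := by
  obtain ⟨hp0, hpdeg, hpξ, -, hlead, -⟩ := hp
  obtain ⟨g, rfl⟩ := hpf
  have hg : g ≠ 0 := right_ne_zero_of_mul hf
  have hB0 : 0 ≤ B := (abs_nonneg _).trans (hB 0)
  have hξB : 0 ≤ |ξ| * B := by positivity
  have hcoeff : ∀ i, |(p.coeff i : ℝ)| ≤ (|ξ| + 1) * B := by
    rw [natDegree_mul hp0 hg] at hdeg
    by_cases hgd : g.natDegree = 0
    · intro i
      obtain ⟨c, rfl⟩ : ∃ c, g = C c := ⟨_, eq_C_of_natDegree_eq_zero hgd⟩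
      have hc : (1 : ℝ) ≤ |(c : ℝ)| := by
        have : c ≠ 0 := by simpa using hg
        exact_mod_cast Int.one_le_abs this
      have h := hB i
      rw [coeff_mul_C, Int.cast_mul, abs_mul] at h
      nlinarith [abs_nonneg (p.coeff i : ℝ)]
    · have hp1 : p.natDegree ≤ 1 := by omega
      have h0 : p.coeff 1 * ξ + p.coeff 0 = 0 := by
        rw [eq_X_add_C_of_natDegree_le_one hp1] at hpξ
        simpa using hpξ
      have h1 : |(p.coeff 1 : ℝ)| ≤ B := by
        have hlg : (1 : ℝ) ≤ |(g.leadingCoeff : ℝ)| := by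
          exact_mod_cast Int.one_le_abs (leadingCoeff_ne_zero.mpr hg)
        have h := hB (p * g).natDegree
        rw [coeff_natDegree, leadingCoeff_mul, Int.cast_mul, abs_mul] at h
        have hle : |(p.coeff 1 : ℝ)| ≤ |(p.leadingCoeff : ℝ)| := by
          rcases hp1.lt_or_eq with h' | h'
          · rw [coeff_eq_zero_of_natDegree_lt h']
            simp
          · rw [leadingCoeff, h']
        nlinarith [abs_nonneg (p.leadingCoeff : ℝ)]
      intro i
      match i with
      | 0 =>
        have : (p.coeff 0 : ℝ) = -(p.coeff 1 * ξ) := by linarith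
        rw [this, abs_neg, abs_mul]
        nlinarith [abs_nonneg ξ]
      | 1 => linarith
      | i + 2 =>
        rw [coeff_eq_zero_of_natDegree_lt (by omega)]
        simp only [Int.cast_zero, abs_zero]
        positivity
  unfold heightZ
  push_cast
  exact max_le (hcoeff 0) (max_le (hcoeff 1) (hcoeff 2))

lemma coeff_quadratic_zero (a b c : ℤ) : (C c * X ^ 2 + C b * X + C a).coeff 0 = a := by
  simp

lemma coeff_quadratic_one (a b c : ℤ) : (C c * X ^ 2 + C b * X + C a).coeff 1 = b := by
  simp [coeff_C, -eq_intCast, -map_intCast]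

lemma coeff_quadratic_two (a b c : ℤ) : (C c * X ^ 2 + C b * X + C a).coeff 2 = c := by
  simp [-eq_intCast, -map_intCast]

lemma quadratic_ne_zero {a b c : ℤ} (h : ¬(a = 0 ∧ b = 0 ∧ c = 0)) :
    C c * X ^ 2 + C b * X + C a ≠ 0 := by
  intro h0
  have ha := coeff_quadratic_zero a b c
  have hb := coeff_quadratic_one a b c
  have hc := coeff_quadratic_two a b c
  rw [h0, coeff_zero] at ha hb hc
  exact h ⟨ha.symm, hb.symm, hc.symm⟩

lemma aeval_quadratic (a b c : ℤ) (ξ : ℝ) :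
    aeval ξ (C c * X ^ 2 + C b * X + C a) = a + b * ξ + c * ξ ^ 2 := by
  simp only [map_add, map_mul, map_pow, aeval_C, aeval_X, algebraMap_int_eq, Int.coe_castRingHom]
  ring

/-- Roots of integer polynomials of degree at most `2` that approximate `θ` well in terms of a
bound `B` for the coefficients yield infinitely many good approximations in terms of height. -/
lemma infinite_approx_of_roots {θ γ γ' M : ℝ}
    (hθ : ∀ p : ℤ[X], p ≠ 0 → p.natDegree ≤ 2 → aeval θ p ≠ 0) (hγ' : 0 ≤ γ') (hγ : γ' < γ)
    (h : ∀ K : ℝ, ∃ B ≥ K, ∃ a b c : ℤ, ¬(a = 0 ∧ b = 0 ∧ c = 0) ∧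
      |(a : ℝ)| ≤ B ∧ |(b : ℝ)| ≤ B ∧ |(c : ℝ)| ≤ B ∧
      ∃ ξ : ℝ, a + b * ξ + c * ξ ^ 2 = 0 ∧ |θ - ξ| ≤ M * B ^ (-γ)) :
    {ξ : ℝ | ∃ p : ℤ[X], IsCanonicalPoly ξ p ∧ |θ - ξ| ≤ (heightZ p : ℝ) ^ (-γ')}.Infinite := by
  intro hfin
  obtain ⟨ε, hε, hball⟩ := Metric.isOpen_iff.mp hfin.isClosed.isOpen_compl θ (by
    rintro ⟨p, hp, -⟩
    exact hθ p hp.1 hp.2.1 hp.2.2.1)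
  have hγ0 : 0 < γ := hγ'.trans_lt hγ
  have lim1 : Tendsto (fun B : ℝ => M * B ^ (-γ)) atTop (𝓝 0) := by
    simpa using (tendsto_rpow_neg_atTop hγ0).const_mul M
  have lim2 : Tendsto (fun B : ℝ => M * (|θ| + 2) ^ γ' * B ^ (-(γ - γ'))) atTop (𝓝 0) := by
    simpa using (tendsto_rpow_neg_atTop (sub_pos.mpr hγ)).const_mul (M * (|θ| + 2) ^ γ')
  obtain ⟨K, hK⟩ := eventually_atTop.mp
    (((lim1.eventually (gt_mem_nhds (lt_min hε one_pos))).and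
      (lim2.eventually (gt_mem_nhds one_pos))).and (eventually_gt_atTop 0))
  obtain ⟨B, hBK, a, b, c, hne, ha, hb, hc, ξ, hξ, hdist⟩ := h K
  obtain ⟨⟨hB1, hB2⟩, hB0⟩ := hK B hBK
  set f : ℤ[X] := C c * X ^ 2 + C b * X + C a with hf
  have hfne : f ≠ 0 := quadratic_ne_zero hne
  have hfdeg : f.natDegree ≤ 2 := natDegree_quadratic_le
  have hfξ : aeval ξ f = 0 := by rw [hf, aeval_quadratic, hξ]
  obtain ⟨p, hp, hpf⟩ := exists_isCanonicalPoly_dvd hfne hfdeg hfξ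
  have hcoeff : ∀ i, |(f.coeff i : ℝ)| ≤ B := by
    intro i
    match i with
    | 0 => rwa [hf, coeff_quadratic_zero]
    | 1 => rwa [hf, coeff_quadratic_one]
    | 2 => rwa [hf, coeff_quadratic_two]
    | i + 3 =>
      rw [coeff_eq_zero_of_natDegree_lt (by omega)]
      simpa using hB0.le
  have hH := heightZ_le_of_dvd hp hpf hfne hfdeg hcoeff
  have hdlt := hdist.trans_lt hB1
  have hξθ : |ξ| ≤ |θ| + 1 := by
    have h1 := abs_sub_abs_le_abs_sub ξ θ
    rw [abs_sub_comm] at h1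
    linarith [min_le_right ε 1]
  have hH' : (heightZ p : ℝ) ≤ (|θ| + 2) * B := hH.trans (by nlinarith)
  have hHpos : (0 : ℝ) < heightZ p := by exact_mod_cast one_le_heightZ hp
  have hC : 0 < |θ| + 2 := by positivity
  refine hball (a := ξ) ?_ ⟨p, hp, ?_⟩
  · rw [Metric.mem_ball, dist_comm, Real.dist_eq]
    exact hdlt.trans_le (min_le_left _ _)
  · refine le_trans ?_ (Real.rpow_le_rpow_of_nonpos hHpos hH' (neg_nonpos.mpr hγ'))
    refine hdist.trans ?_
    rw [Real.mul_rpow hC.le hB0.le]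
    have hsplit : M * B ^ (-γ) =
        M * (|θ| + 2) ^ γ' * B ^ (-(γ - γ')) * ((|θ| + 2) ^ (-γ') * B ^ (-γ')) := by
      have e1 : (|θ| + 2) ^ γ' * (|θ| + 2) ^ (-γ') = 1 := by
        rw [← Real.rpow_add hC]
        simp
      have e2 : B ^ (-γ) = B ^ (-(γ - γ')) * B ^ (-γ') := by
        rw [← Real.rpow_add hB0]
        congr 1
        ring
      rw [e2]
      linear_combination (-(M * B ^ (-(γ - γ')) * B ^ (-γ'))) * e1
    rw [hsplit]
    exact mul_le_of_le_one_left (by positivity) hB2.le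

/-- A real quadratic `l + b * h + c * h ^ 2` with nonnegative discriminant has a root `h` with
`|h| ≤ 2 |l| / |b|`. -/
lemma exists_small_root {l b c : ℝ} (hb : b ≠ 0) (hD : 0 ≤ b ^ 2 - 4 * c * l) :
    ∃ h : ℝ, l + b * h + c * h ^ 2 = 0 ∧ |h| ≤ 2 * (|l| / |b|) := by
  wlog hpos : 0 < b generalizing l b c
  · obtain ⟨h, h1, h2⟩ := this (l := -l) (b := -b) (c := -c) (neg_ne_zero.mpr hb)
      (by nlinarith) (neg_pos.mpr (lt_of_le_of_ne (not_lt.mp hpos) hb))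
    exact ⟨h, by linarith, by simpa using h2⟩
  set s := √(b ^ 2 - 4 * c * l) with hs
  have hs0 : 0 ≤ s := Real.sqrt_nonneg _
  have hs2 : s ^ 2 = b ^ 2 - 4 * c * l := Real.sq_sqrt hD
  have hbs : 0 < b + s := by positivity
  refine ⟨-(2 * l) / (b + s), ?_, ?_⟩
  · field_simp
    linear_combination l * hs2
  · rw [abs_div, abs_neg, abs_mul, abs_two, abs_of_pos hbs, abs_of_pos hpos, mul_div_assoc]
    gcongr
    linarith

lemma abs_le_enormZ (z : Fin 3 → ℤ) (i : Fin 3) : |(z i : ℝ)| ≤ enormZ z := by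
  refine Real.abs_le_sqrt ?_
  fin_cases i <;> simp <;> nlinarith [sq_nonneg (z 0 : ℝ), sq_nonneg (z 1 : ℝ),
    sq_nonneg (z 2 : ℝ)]

lemma finite_setOf_enormZ_le (K : ℝ) : {z : Fin 3 → ℤ | enormZ z ≤ K}.Finite := by
  refine (Set.finite_Icc (fun _ : Fin 3 => -⌈K⌉) (fun _ => ⌈K⌉)).subset fun z hz => ?_
  have hK : ∀ i, |z i| ≤ ⌈K⌉ := fun i => by
    exact_mod_cast ((abs_le_enormZ z i).trans hz).trans (Int.le_ceil K)
  exact ⟨fun i => (abs_le.mp (hK i)).1, fun i => (abs_le.mp (hK i)).2⟩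

/-- Dirichlet's theorem, in the form needed for exponents below `1`. -/
lemma exists_linear_approx (θ K : ℝ) : ∃ B ≥ K, ∃ a b c : ℤ, ¬(a = 0 ∧ b = 0 ∧ c = 0) ∧
    |(a : ℝ)| ≤ B ∧ |(b : ℝ)| ≤ B ∧ |(c : ℝ)| ≤ B ∧
    ∃ ξ : ℝ, a + b * ξ + c * ξ ^ 2 = 0 ∧ |θ - ξ| ≤ (|θ| + 1) * B ^ (-1 : ℝ) := by
  obtain ⟨n, hn⟩ := exists_nat_gt (max K 0)
  have hn0 : (0 : ℝ) < n := (le_max_right _ _).trans_lt hn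
  obtain ⟨j, k, hk, hkn, hjk⟩ := Real.exists_int_int_abs_mul_sub_le θ (by exact_mod_cast hn0)
  have hk1 : (1 : ℝ) ≤ k := by exact_mod_cast hk
  have hkn' : (k : ℝ) ≤ n := by exact_mod_cast hkn
  have hn1 : (1 : ℝ) ≤ n := hk1.trans hkn'
  have hθn : 0 ≤ |θ| * n := by positivity
  have hinv : 1 / ((n : ℝ) + 1) ≤ 1 / n := by gcongr; linarith
  have hinv1 : 1 / (n : ℝ) ≤ 1 := by rw [div_le_one hn0]; exact hn1
  refine ⟨(|θ| + 1) * n, ?_, -j, k, 0, by omega, ?_, ?_, ?_, j / k, ?_, ?_⟩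
  · nlinarith [le_max_left K 0]
  · rw [Int.cast_neg, abs_neg]
    have h1 := abs_sub_abs_le_abs_sub (j : ℝ) (θ * k)
    rw [abs_sub_comm, abs_mul, abs_of_pos (by linarith : (0 : ℝ) < k), mul_comm θ] at h1
    nlinarith [abs_nonneg θ]
  · rw [abs_of_pos (by linarith)]
    nlinarith
  · simp only [Int.cast_zero, abs_zero]
    positivity
  · have : (k : ℝ) ≠ 0 := by positivity
    push_cast
    field_simp
    ring
  · have hk0 : (0 : ℝ) < k := by linarith
    have hC : |θ| + 1 ≠ 0 := by positivity
    have e1 : θ - j / k = (k * θ - j) / k := by field_simp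
    have e2 : (|θ| + 1) * ((|θ| + 1) * n)⁻¹ = 1 / n := by field_simp
    rw [Real.rpow_neg_one, e2, e1, abs_div, abs_of_pos hk0]
    exact (div_le_self (abs_nonneg _) hk1).trans (hjk.trans hinv)

/-- Let `θ` be neither rational nor a quadratic irrationality, `L(x) = x₀ + x₁θ + x₂θ²` and
`P(x) = x₁ + 2x₂θ`.  If `γ > 0` is such that infinitely many `x ∈ ℤ³` satisfy
`|L(x)| ≤ |P(x)|·|x|^{−γ}`, then for every `γ' < γ` there are infinitely many real algebraic
numbers `ξ` of degree at most `2` with `|θ − ξ| ≤ H(ξ)^{−γ'}`.  (That is, `ω_*(θ) ≥ ω_{LP}`.) -/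
theorem quadratic_approx_of_two_forms (θ : ℝ)
    (hθ : ∀ p : Polynomial ℤ, p ≠ 0 → p.natDegree ≤ 2 → Polynomial.aeval θ p ≠ 0)
    (γ : ℝ) (hγ : 0 < γ)
    (hinf : {z : Fin 3 → ℤ | |(z 0 : ℝ) + (z 1 : ℝ) * θ + (z 2 : ℝ) * θ ^ 2| ≤
      |(z 1 : ℝ) + 2 * (z 2 : ℝ) * θ| * enormZ z ^ (-γ)}.Infinite)
    (γ' : ℝ) (hγ' : γ' < γ) :
    {ξ : ℝ | ∃ p : Polynomial ℤ, IsCanonicalPoly ξ p ∧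
      |θ - ξ| ≤ (heightZ p : ℝ) ^ (-γ')}.Infinite := by
  suffices h : {ξ : ℝ | ∃ p : Polynomial ℤ, IsCanonicalPoly ξ p ∧
      |θ - ξ| ≤ (heightZ p : ℝ) ^ (-max γ' 0)}.Infinite by
    refine h.mono ?_
    rintro ξ ⟨p, hp, hle⟩
    refine ⟨p, hp, hle.trans ?_⟩
    exact Real.rpow_le_rpow_of_exponent_le (by exact_mod_cast one_le_heightZ hp)
      (neg_le_neg (le_max_left _ _))
  have hmax : max γ' 0 < γ := max_lt hγ' hγ
  rcases le_or_gt γ 1 with hγ1 | hγ1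
  · exact infinite_approx_of_roots hθ (le_max_right _ _) (hmax.trans_le hγ1)
      (exists_linear_approx θ)
  refine infinite_approx_of_roots (M := 2) hθ (le_max_right _ _) hmax fun K => ?_
  have hlim : Tendsto (fun B : ℝ => 4 * B ^ (-(γ - 1))) atTop (𝓝 0) := by
    simpa using (tendsto_rpow_neg_atTop (sub_pos.mpr hγ1)).const_mul 4
  obtain ⟨K', hK'⟩ := eventually_atTop.mp
    ((hlim.eventually (gt_mem_nhds one_pos)).and (eventually_gt_atTop 0))
  obtain ⟨z, hz, hzK⟩ := hinf.exists_notMem_finite (finite_setOf_enormZ_le (max K K'))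
  rw [Set.mem_ofPred_eq, not_le] at hzK
  have hBK : K ≤ enormZ z := (le_max_left _ _).trans hzK.le
  obtain ⟨hB1, hB0⟩ := hK' (enormZ z) ((le_max_right _ _).trans hzK.le)
  set B := enormZ z with hB
  rw [Set.mem_ofPred_eq] at hz
  have hne : ¬(z 0 = 0 ∧ z 1 = 0 ∧ z 2 = 0) := by
    rintro ⟨h0, h1, h2⟩
    simp [hB, enormZ, h0, h1, h2] at hB0
  set l : ℝ := z 0 + z 1 * θ + z 2 * θ ^ 2 with hl
  set b : ℝ := z 1 + 2 * z 2 * θ with hb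
  have hb0 : b ≠ 0 := by
    intro h0
    have hl0 : l = 0 := by simpa [h0] using hz
    refine hθ _ (quadratic_ne_zero hne) natDegree_quadratic_le ?_
    rw [aeval_quadratic, ← hl, hl0]
  have hD : 0 ≤ b ^ 2 - 4 * z 2 * l := by
    by_contra! hneg
    have hint : b ^ 2 - 4 * z 2 * l = ((z 1 ^ 2 - 4 * z 0 * z 2 : ℤ) : ℝ) := by
      push_cast
      ring
    rw [hint] at hneg
    have hle : ((z 1 ^ 2 - 4 * z 0 * z 2 : ℤ) : ℝ) ≤ -1 := by
      have h : z 1 ^ 2 - 4 * z 0 * z 2 < 0 := by exact_mod_cast hneg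
      exact_mod_cast Int.le_sub_one_of_lt h
    have hprod : |(z 2 : ℝ)| * |l| ≤ B * (|b| * B ^ (-γ)) :=
      mul_le_mul (abs_le_enormZ z 2) hz (abs_nonneg _) hB0.le
    have hexp : B * B ^ (-γ) = B ^ (-(γ - 1)) := by
      nth_rewrite 1 [← Real.rpow_one B]
      rw [← Real.rpow_add hB0]
      congr 1
      ring
    have hle' : z 2 * l ≤ |b| * B ^ (-(γ - 1)) := by
      rw [← hexp]
      have := le_abs_self (z 2 * l)
      rw [abs_mul] at this
      linarith
    nlinarith [abs_pos.mpr hb0, sq_abs b, sq_nonneg (|b| - 1)]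
  obtain ⟨h, h1, h2⟩ := exists_small_root hb0 hD
  refine ⟨B, hBK, z 0, z 1, z 2, hne, abs_le_enormZ z 0, abs_le_enormZ z 1, abs_le_enormZ z 2,
    θ + h, by rw [← h1]; ring, ?_⟩
  rw [sub_add_cancel_left, abs_neg]
  refine h2.trans ?_
  gcongr
  rwa [div_le_iff₀' (abs_pos.mpr hb0)]
end

section
/- Let θ₁, θ₂ be real numbers such that 1, θ₁, θ₂ are linearly independent over ℤ, let L(x) = x₀ + x₁θ₁ + x₂θ₂, and let (x_ν) be the sequence of minimal points of L. If for some index j the three consecutive minimal points x_{j−1}, x_j, x_{j+1} are linearly dependent (over ℚ), then x_{j+1} = t·x_j + x_{j−1} for some integer t. -/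
/-- The rational vector associated to an integer vector. -/
def toQ (v : Fin 3 → ℤ) : Fin 3 → ℚ := fun i => (v i : ℚ)

/-- The value of the linear form `L(x) = x₀ + x₁ θ₁ + x₂ θ₂` at an integer vector. -/
noncomputable def Lv (θ₁ θ₂ : ℝ) (v : Fin 3 → ℤ) : ℝ :=
  (v 0 : ℝ) + (v 1 : ℝ) * θ₁ + (v 2 : ℝ) * θ₂

/-- An integer vector as a point of Euclidean space. -/
noncomputable def toEuclid (v : Fin 3 → ℤ) : EuclideanSpace ℝ (Fin 3) :=
  WithLp.toLp 2 fun i => (v i : ℝ)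

lemma enormZ_eq_norm (v : Fin 3 → ℤ) : enormZ v = ‖toEuclid v‖ := by
  simp [enormZ, toEuclid, EuclideanSpace.norm_eq, Fin.sum_univ_three]

lemma enormZ_lt_enormZ_iff (v w : Fin 3 → ℤ) :
    enormZ v < enormZ w ↔ (v 0 : ℝ) ^ 2 + (v 1 : ℝ) ^ 2 + (v 2 : ℝ) ^ 2 <
      (w 0 : ℝ) ^ 2 + (w 1 : ℝ) ^ 2 + (w 2 : ℝ) ^ 2 :=
  Real.sqrt_lt_sqrt_iff (by positivity)

lemma enormZ_nonneg (v : Fin 3 → ℤ) : 0 ≤ enormZ v := Real.sqrt_nonneg _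

lemma enormZ_smul (k : ℤ) (v : Fin 3 → ℤ) : enormZ (k • v) = |(k : ℝ)| * enormZ v := by
  have h : toEuclid (k • v) = (k : ℝ) • toEuclid v := by
    ext i
    simp [toEuclid]
  rw [enormZ_eq_norm, enormZ_eq_norm, h, norm_smul, Real.norm_eq_abs]

lemma enormZ_add_le (v w : Fin 3 → ℤ) : enormZ (v + w) ≤ enormZ v + enormZ w := by
  have h : toEuclid (v + w) = toEuclid v + toEuclid w := by
    ext i
    simp [toEuclid]
  simpa only [enormZ_eq_norm, h] using norm_add_le (toEuclid v) (toEuclid w)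

lemma Lv_add (θ₁ θ₂ : ℝ) (v w : Fin 3 → ℤ) :
    Lv θ₁ θ₂ (v + w) = Lv θ₁ θ₂ v + Lv θ₁ θ₂ w := by
  simp only [Lv, Pi.add_apply, Int.cast_add]
  ring

lemma Lv_smul (θ₁ θ₂ : ℝ) (k : ℤ) (v : Fin 3 → ℤ) :
    Lv θ₁ θ₂ (k • v) = k * Lv θ₁ θ₂ v := by
  simp only [Lv, Pi.smul_apply, smul_eq_mul, Int.cast_mul]
  ring

lemma exists_two_mul_abs_sub_mul_le (p : ℤ) {k : ℤ} (hk : k ≠ 0) :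
    ∃ m : ℤ, 2 * |((p - m * k : ℤ) : ℝ)| ≤ |(k : ℝ)| := by
  have hk' : (k : ℝ) ≠ 0 := Int.cast_ne_zero.mpr hk
  refine ⟨round ((p : ℝ) / k), ?_⟩
  have h := abs_sub_round ((p : ℝ) / k)
  have e : (((p - round ((p : ℝ) / k) * k : ℤ)) : ℝ)
      = ((p : ℝ) / k - round ((p : ℝ) / k)) * k := by
    push_cast
    field_simp
  rw [e, abs_mul]
  nlinarith [abs_nonneg (k : ℝ)]

/-- Two consecutive minimal points are linearly independent. -/
lemma eq_zero_of_smul_add_smul_eq_zero {θ₁ θ₂ : ℝ} {u v : Fin 3 → ℤ}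
    (hv : 0 < Lv θ₁ θ₂ v) (hL : Lv θ₁ θ₂ v < Lv θ₁ θ₂ u) (hX : enormZ u < enormZ v)
    {p q : ℤ} (h : p • u + q • v = 0) : p = 0 ∧ q = 0 := by
  have h1 : p • u = (-q) • v := by rw [neg_smul]; exact eq_neg_of_add_eq_zero_left h
  have eX := congrArg enormZ h1
  have eL := congrArg (fun w => |Lv θ₁ θ₂ w|) h1
  simp only [Lv_smul, abs_mul, enormZ_smul, abs_of_pos hv, abs_of_pos (hv.trans hL)] at eX eL
  have hu := enormZ_nonneg u
  set P := |(p : ℝ)| with hP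
  set Q := |((-q : ℤ) : ℝ)| with hQ
  have hP0 : 0 ≤ P := abs_nonneg _
  have hQ0 : 0 ≤ Q := abs_nonneg _
  have hPQ : P ≤ Q := by
    by_contra! hlt
    nlinarith
  have hQP : Q = 0 := by
    by_contra hne
    have : 0 < Q := lt_of_le_of_ne hQ0 (Ne.symm hne)
    nlinarith
  have hP' : P = 0 := by linarith
  constructor
  · simpa [hP] using hP'
  · simpa [hQ] using hQP

/-- Two consecutive minimal points generate all the integer points of the plane they span. -/
lemma exists_eq_smul_add_smul {θ₁ θ₂ : ℝ} {u v : Fin 3 → ℤ}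
    (hv : 0 < Lv θ₁ θ₂ v) (hL : Lv θ₁ θ₂ v < Lv θ₁ θ₂ u) (hX : enormZ u < enormZ v)
    (hbest : ∀ y : Fin 3 → ℤ, y ≠ 0 → enormZ y < enormZ v → Lv θ₁ θ₂ u ≤ |Lv θ₁ θ₂ y|)
    {w : Fin 3 → ℤ} {k p q : ℤ} (hk : k ≠ 0) (h : k • w = p • u + q • v) :
    ∃ m n : ℤ, w = m • u + n • v := by
  obtain ⟨m, hm⟩ := exists_two_mul_abs_sub_mul_le p hk
  obtain ⟨n, hn⟩ := exists_two_mul_abs_sub_mul_le q hk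
  refine ⟨m, n, ?_⟩
  by_contra hne
  set y := w - (m • u + n • v) with hy
  have hy0 : y ≠ 0 := sub_ne_zero.mpr hne
  have e : k • y = (p - m * k) • u + (q - n * k) • v := by
    rw [hy, smul_sub, h]
    module
  have hk' : 0 < |(k : ℝ)| := abs_pos.mpr (Int.cast_ne_zero.mpr hk)
  have eX : |(k : ℝ)| * enormZ y ≤ |((p - m * k : ℤ) : ℝ)| * enormZ u +
      |((q - n * k : ℤ) : ℝ)| * enormZ v := by
    rw [← enormZ_smul, ← enormZ_smul, ← enormZ_smul, e]
    exact enormZ_add_le _ _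
  have eL : |(k : ℝ)| * |Lv θ₁ θ₂ y| ≤ |((p - m * k : ℤ) : ℝ)| * Lv θ₁ θ₂ u +
      |((q - n * k : ℤ) : ℝ)| * Lv θ₁ θ₂ v := by
    rw [← abs_mul, ← Lv_smul, e, Lv_add, Lv_smul, Lv_smul]
    refine (abs_add_le _ _).trans_eq ?_
    rw [abs_mul, abs_mul, abs_of_pos hv, abs_of_pos (hv.trans hL)]
  have hu := enormZ_nonneg u
  have hXy : enormZ y < enormZ v := by
    by_contra! hge
    nlinarith
  have hLy := hbest y hy0 hXy
  nlinarith

lemma exists_int_relation_of_not_linearIndependent {a b c : Fin 3 → ℤ}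
    (h : ¬ LinearIndependent ℚ ![toQ a, toQ b, toQ c]) :
    ∃ p q r : ℤ, (p ≠ 0 ∨ q ≠ 0 ∨ r ≠ 0) ∧ p • a + q • b + r • c = 0 := by
  have hd : (Matrix.of ![toQ a, toQ b, toQ c]).det = 0 := by
    by_contra hne
    exact h (Matrix.linearIndependent_rows_of_det_ne_zero hne)
  have hm : Matrix.of ![toQ a, toQ b, toQ c] =
      (Matrix.of ![a, b, c]).map (Int.castRingHom ℚ) := by
    ext i j
    fin_cases i <;> simp [toQ]
  rw [hm, ← RingHom.mapMatrix_apply, ← RingHom.map_det, eq_intCast, Int.cast_eq_zero] at hd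
  obtain ⟨g, hg, hgm⟩ := Matrix.exists_vecMul_eq_zero_iff.mpr hd
  refine ⟨g 0, g 1, g 2, ?_, ?_⟩
  · by_contra! hz
    exact hg (by ext i; fin_cases i <;> simp [hz])
  · ext i
    simpa [Matrix.vecMul, dotProduct, Fin.sum_univ_three] using congrFun hgm i

/-- The coefficient of `a` in `c = t • b + s • a` cannot be `-1` when `a, b, c` are consecutive
minimal points. -/
lemma ne_smul_sub {θ₁ θ₂ : ℝ} {a b c : Fin 3 → ℤ}
    (hc : 0 < Lv θ₁ θ₂ c) (hcb : Lv θ₁ θ₂ c < Lv θ₁ θ₂ b) (hba : Lv θ₁ θ₂ b < Lv θ₁ θ₂ a)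
    (hX : enormZ a < enormZ b)
    (hbest : ∀ y : Fin 3 → ℤ, y ≠ 0 → enormZ y < enormZ c → Lv θ₁ θ₂ b ≤ |Lv θ₁ θ₂ y|)
    (t : ℤ) : c ≠ t • b - a := by
  intro h
  have eL : Lv θ₁ θ₂ c = Lv θ₁ θ₂ (c - b) + Lv θ₁ θ₂ b := by
    rw [← Lv_add, sub_add_cancel]
  have eL' : Lv θ₁ θ₂ c + Lv θ₁ θ₂ a = t * Lv θ₁ θ₂ b := by
    rw [← Lv_add, ← Lv_smul, h, sub_add_cancel]
  have ht : (2 : ℝ) ≤ t := by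
    have : (1 : ℝ) < t := by
      by_contra! hle
      nlinarith
    exact_mod_cast this
  have hy0 : c - b ≠ 0 := by
    intro h0
    rw [sub_eq_zero.mp h0] at hcb
    exact lt_irrefl _ hcb
  have hy : ¬ enormZ (c - b) < enormZ c := by
    intro hlt
    have := hbest _ hy0 hlt
    rw [abs_of_neg (by linarith)] at this
    linarith
  rw [enormZ_lt_enormZ_iff] at hy hX
  simp only [h, Pi.sub_apply, Pi.smul_apply, smul_eq_mul, Int.cast_sub, Int.cast_mul] at hy
  nlinarith [sq_nonneg ((a 0 : ℝ) - b 0), sq_nonneg ((a 1 : ℝ) - b 1),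
    sq_nonneg ((a 2 : ℝ) - b 2), mul_nonneg (sub_nonneg.mpr ht)
      (by positivity : 0 ≤ (b 0 : ℝ) ^ 2 + (b 1 : ℝ) ^ 2 + (b 2 : ℝ) ^ 2)]

/-- If three consecutive minimal points `x_{j−1}, x_j, x_{j+1}` of the linear form
`L(x) = x₀ + x₁θ₁ + x₂θ₂` (with `1, θ₁, θ₂` linearly independent over `ℤ`) are linearly
dependent over `ℚ`, then `x_{j+1} = t·x_j + x_{j−1}` for some integer `t`. -/
theorem dependent_consecutive_minimal_points (θ₁ θ₂ : ℝ)
    (hind : ∀ a b c : ℤ, (a : ℝ) + (b : ℝ) * θ₁ + (c : ℝ) * θ₂ = 0 → a = 0 ∧ b = 0 ∧ c = 0)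
    -- `x` is the sequence of minimal points (best approximations) of `L`:
    (x : ℕ → Fin 3 → ℤ)
    (hx0 : ∀ ν, x ν ≠ 0)
    (hLpos : ∀ ν, 0 < Lv θ₁ θ₂ (x ν))
    (hXlt : ∀ ν, enormZ (x ν) < enormZ (x (ν + 1)))
    (hLlt : ∀ ν, Lv θ₁ θ₂ (x (ν + 1)) < Lv θ₁ θ₂ (x ν))
    (hbest : ∀ ν, ∀ y : Fin 3 → ℤ, y ≠ 0 → enormZ y < enormZ (x (ν + 1)) →
      Lv θ₁ θ₂ (x ν) ≤ |Lv θ₁ θ₂ y|)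
    (j : ℕ) (hj : 1 ≤ j)
    (hdep : ¬ LinearIndependent ℚ ![toQ (x (j - 1)), toQ (x j), toQ (x (j + 1))]) :
    ∃ t : ℤ, x (j + 1) = t • x j + x (j - 1) := by
  obtain ⟨i, rfl⟩ : ∃ i, j = i + 1 := ⟨j - 1, by omega⟩
  rw [Nat.add_sub_cancel] at hdep ⊢
  obtain ⟨p, q, r, hne, hrel⟩ := exists_int_relation_of_not_linearIndependent hdep
  have hr : r ≠ 0 := by
    rintro rfl
    rw [zero_smul, add_zero] at hrel
    obtain ⟨rfl, rfl⟩ :=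
      eq_zero_of_smul_add_smul_eq_zero (hLpos (i + 1)) (hLlt i) (hXlt i) hrel
    simp at hne
  have hr' : r • x (i + 1 + 1) = (-p) • x i + (-q) • x (i + 1) := by
    linear_combination hrel
  obtain ⟨s, t, hst⟩ :=
    exists_eq_smul_add_smul (hLpos (i + 1)) (hLlt i) (hXlt i) (hbest i) hr hr'
  have hs : s ≠ 0 := by
    rintro rfl
    have := eq_zero_of_smul_add_smul_eq_zero (hLpos (i + 1 + 1)) (hLlt (i + 1)) (hXlt (i + 1))
      (p := t) (q := -1) (by rw [hst]; module)
    omega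
  have hs' : s • x i = (-t) • x (i + 1) + (1 : ℤ) • x (i + 1 + 1) := by
    rw [hst]
    module
  obtain ⟨m, n, hmn⟩ := exists_eq_smul_add_smul (hLpos (i + 1 + 1)) (hLlt (i + 1))
    (hXlt (i + 1)) (hbest (i + 1)) hs hs'
  have hunit : n * s - 1 = 0 :=
    (eq_zero_of_smul_add_smul_eq_zero (hLpos (i + 1)) (hLlt i) (hXlt i)
      (p := n * s - 1) (q := m + n * t) (by
        rw [hst] at hmn
        rw [← sub_eq_zero.mpr hmn.symm]
        module)).1
  rcases Int.isUnit_iff.mp (IsUnit.of_mul_eq_one n (by linarith : s * n = 1)) with rfl | rfl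
  · exact ⟨t, by rw [hst]; module⟩
  · exact absurd (by rw [hst]; module) (ne_smul_sub (hLpos (i + 1 + 1)) (hLlt (i + 1)) (hLlt i)
      (hXlt i) (hbest (i + 1)) t)
end

section
/- Let θ₁, θ₂ be real numbers such that 1, θ₁, θ₂ are linearly independent over ℤ, let L(x) = x₀ + x₁θ₁ + x₂θ₂, and let (x_ν) be the sequence of minimal points of L with X_ν = |x_ν| and L_ν = L(x_ν). Let α > 2 and suppose L_j ≤ X_{j+1}^{−α} for all sufficiently large j. Then there exist a constant c > 0 and an index J such that for every j ≥ J for which x_{j−1}, x_j, x_{j+1} are linearly independent, one has X_{j+1} ≥ c·X_j^{α−1}. -/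
lemma enormZ_sq (v : Fin 3 → ℤ) :
    enormZ v ^ 2 = (v 0 : ℝ) ^ 2 + (v 1 : ℝ) ^ 2 + (v 2 : ℝ) ^ 2 :=
  Real.sq_sqrt (by positivity)

lemma enormZ_pos {v : Fin 3 → ℤ} (hv : v ≠ 0) : 0 < enormZ v := by
  refine (enormZ_nonneg v).lt_of_ne fun h => hv ?_
  have hsq := enormZ_sq v
  rw [← h] at hsq
  have h0 : (v 0 : ℝ) = 0 := by
    nlinarith [sq_nonneg (v 0 : ℝ), sq_nonneg (v 1 : ℝ), sq_nonneg (v 2 : ℝ)]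
  have h1 : (v 1 : ℝ) = 0 := by
    nlinarith [sq_nonneg (v 0 : ℝ), sq_nonneg (v 1 : ℝ), sq_nonneg (v 2 : ℝ)]
  have h2 : (v 2 : ℝ) = 0 := by
    nlinarith [sq_nonneg (v 0 : ℝ), sq_nonneg (v 1 : ℝ), sq_nonneg (v 2 : ℝ)]
  ext i
  fin_cases i
  · exact_mod_cast h0
  · exact_mod_cast h1
  · exact_mod_cast h2

/-- A `2 × 2` minor of two integer vectors is bounded by the product of their norms. -/
lemma abs_minor_le_enormZ_mul (v w : Fin 3 → ℤ) :
    |(v 1 : ℝ) * w 2 - v 2 * w 1| ≤ enormZ v * enormZ w := by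
  refine abs_le_of_sq_le_sq ?_ (mul_nonneg (enormZ_nonneg v) (enormZ_nonneg w))
  rw [mul_pow, enormZ_sq, enormZ_sq]
  nlinarith [sq_nonneg ((v 1 : ℝ) * w 1 + v 2 * w 2), sq_nonneg ((v 0 : ℝ) * w 0),
    sq_nonneg ((v 0 : ℝ) * w 1), sq_nonneg ((v 0 : ℝ) * w 2), sq_nonneg ((v 1 : ℝ) * w 0),
    sq_nonneg ((v 2 : ℝ) * w 0)]

/-- The determinant of three linearly independent integer vectors has absolute value at least one;
expanding it after replacing a column by the values of the linear form bounds these from below. -/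
lemma one_le_sum_abs_Lv_mul_of_linearIndependent (θ₁ θ₂ : ℝ) {a b c : Fin 3 → ℤ}
    (h : LinearIndependent ℚ ![toQ a, toQ b, toQ c]) :
    1 ≤ |Lv θ₁ θ₂ a| * (enormZ b * enormZ c) + |Lv θ₁ θ₂ b| * (enormZ a * enormZ c)
      + |Lv θ₁ θ₂ c| * (enormZ a * enormZ b) := by
  set d : ℤ := (Matrix.of ![a, b, c]).det with hd
  have hd0 : d ≠ 0 := by
    have hu := (Matrix.linearIndependent_rows_iff_isUnit (A := Matrix.of ![toQ a, toQ b, toQ c])).1 h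
    have hdet := ((Matrix.isUnit_iff_isUnit_det _).1 hu).ne_zero
    intro h0
    apply hdet
    have : (Matrix.of ![toQ a, toQ b, toQ c]).det = (d : ℚ) := by
      simp [hd, Matrix.det_fin_three, toQ]
    rw [this, h0, Int.cast_zero]
  have hexp : (d : ℝ) = Lv θ₁ θ₂ a * ((b 1 : ℝ) * c 2 - b 2 * c 1)
      - Lv θ₁ θ₂ b * ((a 1 : ℝ) * c 2 - a 2 * c 1)
      + Lv θ₁ θ₂ c * ((a 1 : ℝ) * b 2 - a 2 * b 1) := by
    simp [hd, Matrix.det_fin_three, Lv]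
    ring
  calc (1 : ℝ) ≤ |(d : ℝ)| := by exact_mod_cast Int.one_le_abs hd0
    _ ≤ _ := by
      rw [hexp]
      refine (abs_add_le _ _).trans (add_le_add ((abs_sub _ _).trans (add_le_add ?_ ?_)) ?_) <;>
      · rw [abs_mul]
        exact mul_le_mul_of_nonneg_left (abs_minor_le_enormZ_mul _ _) (abs_nonneg _)

/-- Jarník's inequality: if `α > 2` and `L_j ≤ X_{j+1}^{−α}` for all sufficiently large `j`,
then for all sufficiently large `j` with `x_{j−1}, x_j, x_{j+1}` linearly independent one has
`X_{j+1} ≥ c·X_j^{α−1}` for a positive constant `c`. -/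
theorem jarnik_norm_growth (θ₁ θ₂ : ℝ)
    (hind : ∀ a b c : ℤ, (a : ℝ) + (b : ℝ) * θ₁ + (c : ℝ) * θ₂ = 0 → a = 0 ∧ b = 0 ∧ c = 0)
    -- `x` is the sequence of minimal points (best approximations) of `L`:
    (x : ℕ → Fin 3 → ℤ)
    (hx0 : ∀ ν, x ν ≠ 0)
    (hLpos : ∀ ν, 0 < Lv θ₁ θ₂ (x ν))
    (hXlt : ∀ ν, enormZ (x ν) < enormZ (x (ν + 1)))
    (hLlt : ∀ ν, Lv θ₁ θ₂ (x (ν + 1)) < Lv θ₁ θ₂ (x ν))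
    (hbest : ∀ ν, ∀ y : Fin 3 → ℤ, y ≠ 0 → enormZ y < enormZ (x (ν + 1)) →
      Lv θ₁ θ₂ (x ν) ≤ |Lv θ₁ θ₂ y|)
    (α : ℝ) (hα : 2 < α)
    (hsii : ∃ J₀ : ℕ, ∀ j, J₀ ≤ j → Lv θ₁ θ₂ (x j) ≤ enormZ (x (j + 1)) ^ (-α)) :
    ∃ c > (0 : ℝ), ∃ J : ℕ, ∀ j, J ≤ j →
      LinearIndependent ℚ ![toQ (x (j - 1)), toQ (x j), toQ (x (j + 1))] →
      c * enormZ (x j) ^ (α - 1) ≤ enormZ (x (j + 1)) := by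
  obtain ⟨J₀, hJ₀⟩ := hsii
  refine ⟨1 / 3, by norm_num, J₀ + 1, fun j hj hli => ?_⟩
  obtain ⟨k, rfl⟩ : ∃ k, j = k + 1 := ⟨j - 1, by omega⟩
  rw [Nat.add_sub_cancel] at hli
  have h1 := one_le_sum_abs_Lv_mul_of_linearIndependent θ₁ θ₂ hli
  rw [abs_of_pos (hLpos _), abs_of_pos (hLpos _), abs_of_pos (hLpos _)] at h1
  have hL := hJ₀ k (by omega)
  have hA := enormZ_nonneg (x k)
  have hB := enormZ_pos (hx0 (k + 1))
  have hC := enormZ_nonneg (x (k + 1 + 1))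
  have hAB := hXlt k
  have hBC := hXlt (k + 1)
  have hL1 := hLlt k
  have hL2 := hLlt (k + 1)
  have hp0 := hLpos k
  have hp1 := hLpos (k + 1)
  have hp2 := hLpos (k + 1 + 1)
  set A := enormZ (x k)
  set B := enormZ (x (k + 1))
  set C := enormZ (x (k + 1 + 1))
  have h2 : Lv θ₁ θ₂ (x (k + 1)) * (A * C) ≤ Lv θ₁ θ₂ (x k) * (B * C) := by gcongr
  have h3 : Lv θ₁ θ₂ (x (k + 1 + 1)) * (A * B) ≤ Lv θ₁ θ₂ (x k) * (B * C) := by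
    rw [mul_comm B C]
    gcongr
    · exact (hL2.trans hL1).le
    · exact (hAB.trans hBC).le
  have h4 : Lv θ₁ θ₂ (x k) * (B * C) ≤ B ^ (-α) * (B * C) := by gcongr
  have h5 : 1 ≤ 3 * (B ^ (-α) * (B * C)) := by linarith
  have hBpow : B ^ (α - 1) * (B ^ (-α) * B) = 1 := by
    rw [← Real.rpow_add_one hB.ne', ← Real.rpow_add hB, show α - 1 + (-α + 1) = 0 by ring,
      Real.rpow_zero]
  have h6 := mul_le_mul_of_nonneg_left h5 (Real.rpow_nonneg hB.le (α - 1))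
  have h7 : B ^ (α - 1) * (3 * (B ^ (-α) * (B * C))) = 3 * C := by
    linear_combination 3 * C * hBpow
  linarith
end
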